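/- Let f ∈ ℬ and suppose that the problem (P) admits a unique nondecreasing viscosity solution u. Then with probability one, n^{-1/d} U_n converges to u locally uniformly on [0,∞)^d: for every M > 0, sup_{x ∈ [0,M]^d} |n^{-1/d} U_n(x) − u(x)| → 0 as n → ∞. -/

import Mathlib

open MeasureTheory Filter Set Topology

noncomputable section

/-- `ℓ(A)`: the maximal cardinality of a chain (finite subset totally ordered by the
coordinatewise partial order `≤`) contained in `A ⊆ ℝ^d`. -/
def chainLength (d : ℕ) (A : Set (Fin d → ℝ)) : ℕ :=
  sSup {n : ℕ | ∃ C : Finset (Fin d → ℝ),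
    ↑C ⊆ A ∧ IsChain (· ≤ ·) (C : Set (Fin d → ℝ)) ∧ C.card = n}

/-- The class `ℬ` of nonnegative, locally bounded, Lebesgue-measurable functions. -/
def MemB (d : ℕ) (f : (Fin d → ℝ) → ℝ) : Prop :=
  Measurable f ∧ (∀ x, 0 ≤ f x) ∧ ∀ x : Fin d → ℝ, ∃ U ∈ 𝓝 x, BddAbove (f '' U)

/-- The Euclidean norm on `ℝ^d` (modelled as `Fin d → ℝ`). -/
def euclNorm (d : ℕ) (x : Fin d → ℝ) : ℝ := Real.sqrt (∑ i, (x i) ^ 2)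

/-- The expectation `E[ℓ_n]` of the length of a longest chain among `n` i.i.d. points
uniformly distributed in the unit cube `[0,1]^d`. -/
def BWexpect (d n : ℕ) : ℝ :=
  ∫ X : Fin n → Fin d → ℝ, (chainLength d (Set.range X) : ℝ)
    ∂(Measure.pi fun _ => volume.restrict (Set.Icc (0 : Fin d → ℝ) 1))

/-- `c` is the Bollobás–Winkler constant `c_d`: `c > 0` and `n^{-1/d} E[ℓ_n] → c`. -/
def IsBWConstant (d : ℕ) (c : ℝ) : Prop :=
  0 < c ∧ Tendsto (fun n : ℕ => (n : ℝ) ^ (-(1 : ℝ) / d) * BWexpect d n) atTop (nhds c)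

/-- A Poisson point process on `ℝ^d` with intensity function `g`, on a probability space
`(Ω, P)`: a random at-most-countable subset of `ℝ^d` such that for every bounded Borel set `A`
the count `#(pts ω ∩ A)` is measurable with Poisson distribution of mean `∫_A g`, and counts of
pairwise disjoint Borel sets are independent. -/
structure PoissonPP (d : ℕ) {Ω : Type*} [MeasurableSpace Ω] (P : Measure Ω)
    (g : (Fin d → ℝ) → ℝ) where
  pts : Ω → Set (Fin d → ℝ)
  countable : ∀ ω, (pts ω).Countable
  measur : ∀ A : Set (Fin d → ℝ), MeasurableSet A → Bornology.IsBounded A →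
    ∀ k : ℕ, MeasurableSet {ω | (pts ω ∩ A).encard = k}
  poisson : ∀ A : Set (Fin d → ℝ), MeasurableSet A → Bornology.IsBounded A →
    ∀ k : ℕ, P {ω | (pts ω ∩ A).encard = k}
      = ENNReal.ofReal (Real.exp (-(∫ x in A, g x)) * (∫ x in A, g x) ^ k / k.factorial)
  indep : ∀ (n : ℕ) (A : Fin n → Set (Fin d → ℝ)),
    (∀ i, MeasurableSet (A i)) → (∀ i, Bornology.IsBounded (A i)) →
    (Pairwise fun i j => Disjoint (A i) (A j)) →
    ∀ k : Fin n → ℕ,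
      P (⋂ i, {ω | (pts ω ∩ A i).encard = k i})
        = ∏ i, P {ω | (pts ω ∩ A i).encard = k i}

/-- Upper semicontinuous envelope `f*`. -/
def upperEnv (d : ℕ) (f : (Fin d → ℝ) → ℝ) (x : Fin d → ℝ) : ℝ := limsup f (𝓝 x)

/-- Lower semicontinuous envelope `f_*`. -/
def lowerEnv (d : ℕ) (f : (Fin d → ℝ) → ℝ) (x : Fin d → ℝ) : ℝ := liminf f (𝓝 x)

/-- The simplex `S_{x,v} = {z : z ≤ x, ⟨x-z,v⟩ ≤ 1}`. -/
def simplexS (d : ℕ) (x v : Fin d → ℝ) : Set (Fin d → ℝ) :=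
  {z | z ≤ x ∧ ∑ i, (x i - z i) * v i ≤ 1}

/-- `u` is a nondecreasing viscosity solution of the problem (P):
`u_{x_1} ⋯ u_{x_d} = (c_d/d)^d f` in `(0,∞)^d`, `u = 0` on `∂ℝ^d_+`. -/
def IsNDViscSol (d : ℕ) (c : ℝ) (f u : (Fin d → ℝ) → ℝ) : Prop :=
  ContinuousOn u (Set.Ici 0) ∧
  (∀ x y : Fin d → ℝ, 0 ≤ x → x ≤ y → u x ≤ u y) ∧
  (∀ x : Fin d → ℝ, 0 ≤ x → (∃ i, x i = 0) → u x = 0) ∧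
  (∀ x₀ : Fin d → ℝ, (∀ i, 0 < x₀ i) →
    ∀ φ : (Fin d → ℝ) → ℝ, ContDiff ℝ ((⊤ : ℕ∞) : WithTop ℕ∞) φ →
      IsLocalMaxOn (fun y => u y - φ y) (Set.Ici 0) x₀ →
      ∏ i, fderiv ℝ φ x₀ (Pi.single i 1) ≤ (c / d) ^ d * upperEnv d f x₀) ∧
  (∀ x₀ : Fin d → ℝ, (∀ i, 0 < x₀ i) →
    ∀ φ : (Fin d → ℝ) → ℝ, ContDiff ℝ ((⊤ : ℕ∞) : WithTop ℕ∞) φ →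
      IsLocalMinOn (fun y => u y - φ y) (Set.Ici 0) x₀ →
      (c / d) ^ d * lowerEnv d f x₀ ≤ ∏ i, fderiv ℝ φ x₀ (Pi.single i 1))

/-! ### Independent Bernoulli random subsets -/

/-- Expectation of `F S` when `S` is a random subset of the elements of a list, the element `a`
being in `S` with probability `p a`, independently. -/
def bernExp {ι : Type*} [DecidableEq ι] (p : ι → ℝ) : List ι → (Finset ι → ℝ) → ℝ
  | [], F => F ∅
  | a :: l, F => (1 - p a) * bernExp p l F + p a * bernExp p l (fun S => F (insert a S))

namespace bernExp

variable {ι : Type*} [DecidableEq ι] {p : ι → ℝ}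

lemma add (l : List ι) (F G : Finset ι → ℝ) :
    bernExp p l (fun S => F S + G S) = bernExp p l F + bernExp p l G := by
  induction l generalizing F G with
  | nil => rfl
  | cons a l ih => simp only [bernExp, ih]; ring

lemma const_mul (l : List ι) (k : ℝ) (F : Finset ι → ℝ) :
    bernExp p l (fun S => k * F S) = k * bernExp p l F := by
  induction l generalizing F with
  | nil => rfl
  | cons a l ih => simp only [bernExp, ih]; ring

lemma const (l : List ι) (k : ℝ) : bernExp p l (fun _ => k) = k := by
  induction l with
  | nil => rfl
  | cons a l ih => simp only [bernExp, ih]; ring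

lemma sum {κ : Type*} (l : List ι) (s : Finset κ) (F : κ → Finset ι → ℝ) :
    bernExp p l (fun S => ∑ k ∈ s, F k S) = ∑ k ∈ s, bernExp p l (F k) := by
  classical
  induction s using Finset.induction_on with
  | empty => simpa using const l 0
  | insert a s ha ih => simp only [Finset.sum_insert ha, add, ih]

lemma mono (hp : ∀ i, 0 ≤ p i) (hp1 : ∀ i, p i ≤ 1) (l : List ι) {F G : Finset ι → ℝ}
    (h : ∀ S, F S ≤ G S) : bernExp p l F ≤ bernExp p l G := by
  induction l generalizing F G with
  | nil => exact h _
  | cons a l ih =>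
    have h1 := ih h
    have h2 := ih (F := fun S => F (insert a S)) (G := fun S => G (insert a S)) fun S => h _
    simp only [bernExp]
    have := hp a
    have := hp1 a
    gcongr

lemma mono_prob {q : ι → ℝ} (hp : ∀ i, 0 ≤ p i) (hpq : ∀ i, p i ≤ q i) (hq : ∀ i, q i ≤ 1)
    (l : List ι) {F : Finset ι → ℝ} (hF : Monotone F) : bernExp p l F ≤ bernExp q l F := by
  induction l generalizing F with
  | nil => exact le_rfl
  | cons a l ih =>
    have h1 := ih hF
    have hF' : Monotone (fun S => F (insert a S)) :=
      fun S T h => hF (Finset.insert_subset_insert a h)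
    have h2 := ih hF'
    have h3 : bernExp p l F ≤ bernExp p l (fun S => F (insert a S)) :=
      mono hp (fun i => (hpq i).trans (hq i)) l fun S => hF (Finset.subset_insert a S)
    simp only [bernExp]
    have := hp a
    have := hpq a
    have := hq a
    nlinarith [mul_nonneg (sub_nonneg.2 (hpq a)) (sub_nonneg.2 h3),
      mul_nonneg (sub_nonneg.2 (hq a)) (sub_nonneg.2 h1),
      mul_nonneg ((hp a).trans (hpq a)) (sub_nonneg.2 h2)]

lemma congr (l : List ι) {F G : Finset ι → ℝ}
    (h : ∀ S, (∀ i ∈ S, i ∈ l) → F S = G S) : bernExp p l F = bernExp p l G := by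
  induction l generalizing F G with
  | nil => exact h _ (by simp)
  | cons a l ih =>
    simp only [bernExp]
    rw [ih (fun S hS => h S fun i hi => List.mem_cons_of_mem _ (hS i hi)),
      ih (F := fun S => F (insert a S)) (G := fun S => G (insert a S))]
    intro S hS
    refine h _ fun i hi => ?_
    rcases Finset.mem_insert.1 hi with rfl | hi
    · simp
    · exact List.mem_cons_of_mem _ (hS i hi)

lemma subset_indicator (l : List ι) (T : Finset ι) :
    bernExp p l (fun S => if S ⊆ T then 1 else 0)
      = (l.map fun i => if i ∈ T then 1 else 1 - p i).prod := by
  induction l with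
  | nil => simp [bernExp]
  | cons a l ih =>
    simp only [bernExp, List.map_cons, List.prod_cons, ih, Finset.insert_subset_iff]
    by_cases ha : a ∈ T
    · simp only [ha, true_and, ih, if_true]; ring
    · simp only [ha, false_and, if_false, const]; ring

end bernExp

/-- A function on the subsets of a finite set is determined by its sums over down-sets. -/
lemma eq_of_sum_powerset_eq {ι : Type*} [DecidableEq ι] {w w' : Finset ι → ℝ}
    (h : ∀ T : Finset ι, ∑ S ∈ T.powerset, w S = ∑ S ∈ T.powerset, w' S) : w = w' := by
  funext T
  induction T using Finset.strongInduction with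
  | H T ih =>
    have hT := h T
    rw [← Finset.insert_erase (Finset.mem_powerset_self T),
      Finset.sum_insert (Finset.notMem_erase _ _),
      Finset.sum_insert (Finset.notMem_erase _ _)] at hT
    have : ∑ S ∈ T.powerset.erase T, w S = ∑ S ∈ T.powerset.erase T, w' S :=
      Finset.sum_congr rfl fun S hS => ih S <| by
        rw [Finset.mem_erase, Finset.mem_powerset] at hS
        exact lt_of_le_of_ne hS.2 hS.1
    linarith

/-- Weights on subsets with the void probabilities of an independent Bernoulli family are those
of the Bernoulli family. -/
lemma sum_weights_eq_bernExp {ι : Type*} [DecidableEq ι] [Fintype ι] {p : ι → ℝ}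
    {w : Finset ι → ℝ}
    (h : ∀ T : Finset ι, ∑ S ∈ T.powerset, w S = ∏ i ∈ Tᶜ, (1 - p i)) (F : Finset ι → ℝ) :
    ∑ S, w S * F S = bernExp p Finset.univ.toList F := by
  have key : w = fun S => bernExp p Finset.univ.toList (fun S' => if S' = S then 1 else 0) := by
    refine eq_of_sum_powerset_eq fun T => ?_
    rw [h T, ← bernExp.sum]
    have : (fun S' : Finset ι => ∑ k ∈ T.powerset, if S' = k then (1 : ℝ) else 0)
        = fun S' => if S' ⊆ T then 1 else 0 := by
      funext S'
      rw [Finset.sum_ite_eq]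
      simp
    rw [this, bernExp.subset_indicator, Finset.prod_map_toList, Finset.prod_ite]
    simp only [Finset.prod_const_one, one_mul]
    refine Finset.prod_congr ?_ fun _ _ => rfl
    ext; simp
  have hF : F = fun S' => ∑ S, F S * (if S' = S then 1 else 0) := by
    funext S'
    simp
  conv_rhs => rw [hF]
  rw [bernExp.sum, key]
  exact Finset.sum_congr rfl fun S _ => by rw [bernExp.const_mul, mul_comm]

/-- Entropy of a function on a two-point space with weights `1 - p`, `p`. -/
def twoPointEnt (p A B : ℝ) : ℝ :=
  (1 - p) * (A * Real.log A) + p * (B * Real.log B)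
    - ((1 - p) * A + p * B) * Real.log ((1 - p) * A + p * B)

lemma convexComb_pos {p A B : ℝ} (hp : 0 ≤ p) (hp1 : p ≤ 1) (hA : 0 < A) (hB : 0 < B) :
    0 < (1 - p) * A + p * B := by
  rcases eq_or_lt_of_le hp with rfl | hp
  · simpa
  · have := mul_nonneg (sub_nonneg.2 hp1) hA.le
    have := mul_pos hp hB
    linarith

lemma mul_log_sub_ge {A m A₀ m₀ : ℝ} (hA : 0 < A) (hm : 0 < m) (hA₀ : 0 < A₀) (hm₀ : 0 < m₀) :
    A - m * A₀ / m₀ ≤ A * (Real.log A - Real.log m) - A * (Real.log A₀ - Real.log m₀) := by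
  have h := Real.log_le_sub_one_of_pos (show 0 < m * A₀ / (A * m₀) by positivity)
  rw [Real.log_div (by positivity) (by positivity), Real.log_mul hm.ne' hA₀.ne',
    Real.log_mul hA.ne' hm₀.ne'] at h
  have h2 := mul_le_mul_of_nonneg_left h hA.le
  have h3 : A * (m * A₀ / (A * m₀) - 1) = m * A₀ / m₀ - A := by
    field_simp
  rw [h3] at h2
  linarith

/-- Tangent-plane inequality for the two-point entropy. -/
lemma twoPointEnt_ge {p A B A₀ B₀ : ℝ} (hp : 0 ≤ p) (hp1 : p ≤ 1) (hA : 0 < A) (hB : 0 < B)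
    (hA₀ : 0 < A₀) (hB₀ : 0 < B₀) :
    (1 - p) * (Real.log A₀ - Real.log ((1 - p) * A₀ + p * B₀)) * A
      + p * (Real.log B₀ - Real.log ((1 - p) * A₀ + p * B₀)) * B ≤ twoPointEnt p A B := by
  have hm := convexComb_pos hp hp1 hA hB
  have hm₀ := convexComb_pos hp hp1 hA₀ hB₀
  have h1 := mul_le_mul_of_nonneg_left (mul_log_sub_ge hA hm hA₀ hm₀) (sub_nonneg.2 hp1)
  have h2 := mul_le_mul_of_nonneg_left (mul_log_sub_ge hB hm hB₀ hm₀) hp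
  rw [twoPointEnt]
  set m := (1 - p) * A + p * B with hmdef
  set m₀ := (1 - p) * A₀ + p * B₀ with hm₀def
  have h3 : (1 - p) * (A - m * A₀ / m₀) + p * (B - m * B₀ / m₀) = 0 := by
    have : (1 - p) * (A - m * A₀ / m₀) + p * (B - m * B₀ / m₀) = m - m * (m₀ / m₀) := by
      rw [hmdef, hm₀def]; ring
    rw [this, div_self hm₀.ne']; ring
  have h4 : m * Real.log m = (1 - p) * (A * Real.log m) + p * (B * Real.log m) := by
    rw [hmdef]; ring
  nlinarith

lemma twoPointEnt_exp_le {p θ a b : ℝ} (hp : 0 ≤ p) (hp1 : p ≤ 1) (hab : b = a ∨ b = a + 1) :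
    twoPointEnt p (Real.exp (θ * a)) (Real.exp (θ * b))
      ≤ (Real.exp (-θ) + θ - 1) * (p * (Real.exp (θ * b) * (b - a))) := by
  rcases hab with rfl | rfl
  · rw [twoPointEnt]
    have : (1 - p) * Real.exp (θ * b) + p * Real.exp (θ * b) = Real.exp (θ * b) := by ring
    rw [this]
    apply le_of_eq; ring
  · rw [twoPointEnt]
    have hx := Real.exp_pos θ
    have hm := convexComb_pos hp hp1 one_pos hx
    have e1 : Real.exp (θ * (a + 1)) = Real.exp (θ * a) * Real.exp θ := by
      rw [← Real.exp_add]; ring_nf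
    have e2 : (1 - p) * Real.exp (θ * a) + p * Real.exp (θ * (a + 1))
        = Real.exp (θ * a) * ((1 - p) * 1 + p * Real.exp θ) := by rw [e1]; ring
    rw [e2, Real.log_mul (Real.exp_pos _).ne' hm.ne', Real.log_exp, Real.log_exp, e1]
    set m := (1 - p) * 1 + p * Real.exp θ with hmdef
    have hlog : m - 1 ≤ m * Real.log m := by
      have h := Real.log_le_sub_one_of_pos (inv_pos.2 hm)
      rw [Real.log_inv] at h
      have h2 := mul_le_mul_of_nonneg_left h hm.le
      rw [mul_sub, mul_inv_cancel₀ hm.ne'] at h2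
      linarith
    have hE := Real.exp_pos (θ * a)
    have e3 : Real.exp (-θ) * Real.exp θ = 1 := by rw [← Real.exp_add]; simp
    have h3 := mul_le_mul_of_nonneg_left hlog hE.le
    have e4 : (Real.exp (-θ) + θ - 1) * (p * (Real.exp (θ * a) * Real.exp θ * (a + 1 - a)))
        = p * Real.exp (θ * a) * (1 + θ * Real.exp θ - Real.exp θ) := by
      linear_combination p * Real.exp (θ * a) * e3
    rw [e4]
    have e5 : p * Real.exp θ = m - 1 + p := by rw [hmdef]; ring
    have e6 : (1 - p) * (Real.exp (θ * a) * (θ * a)) +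
        p * (Real.exp (θ * a) * Real.exp θ * (θ * (a + 1)))
        = Real.exp (θ * a) * (m * (θ * a) + (m - 1 + p) * θ) := by
      linear_combination (Real.exp (θ * a) * (θ * a) + Real.exp (θ * a) * θ) * e5
    have e7 : p * Real.exp (θ * a) * (1 + θ * Real.exp θ - Real.exp θ)
        = Real.exp (θ * a) * (p + θ * (m - 1 + p) - (m - 1 + p)) := by
      linear_combination (Real.exp (θ * a) * (θ - 1)) * e5
    rw [e6, e7]
    nlinarith

namespace bernExp

variable {ι : Type*} [DecidableEq ι] {p : ι → ℝ}

lemma pos (hp : ∀ i, 0 ≤ p i) (hp1 : ∀ i, p i ≤ 1) (l : List ι) {F : Finset ι → ℝ}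
    (h : ∀ S, 0 < F S) : 0 < bernExp p l F := by
  induction l generalizing F with
  | nil => exact h _
  | cons a l ih => exact convexComb_pos (hp a) (hp1 a) (ih h) (ih fun S => h _)

/-- Joint convexity of the two-point entropy. -/
lemma twoPointEnt_le (hp : ∀ i, 0 ≤ p i) (hp1 : ∀ i, p i ≤ 1) {q : ℝ} (hq : 0 ≤ q) (hq1 : q ≤ 1)
    (l : List ι) {F G : Finset ι → ℝ} (hF : ∀ S, 0 < F S) (hG : ∀ S, 0 < G S) :
    twoPointEnt q (bernExp p l F) (bernExp p l G)
      ≤ bernExp p l (fun S => twoPointEnt q (F S) (G S)) := by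
  have hA := pos hp hp1 l hF
  have hB := pos hp hp1 l hG
  have := mono hp hp1 l (fun S => twoPointEnt_ge hq hq1 (hF S) (hG S) hA hB)
  refine le_trans (le_of_eq ?_) this
  rw [add, const_mul, const_mul, twoPointEnt]
  ring

/-- Modified logarithmic Sobolev inequality for functions with `0`-`1` increments. -/
lemma entropy_le (hp : ∀ i, 0 ≤ p i) (hp1 : ∀ i, p i ≤ 1) (θ : ℝ) (l : List ι) (hl : l.Nodup)
    {L : Finset ι → ℝ} (hL : ∀ S, ∀ a ∉ S, L (insert a S) = L S ∨ L (insert a S) = L S + 1) :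
    bernExp p l (fun S => Real.exp (θ * L S) * Real.log (Real.exp (θ * L S)))
        - bernExp p l (fun S => Real.exp (θ * L S))
          * Real.log (bernExp p l (fun S => Real.exp (θ * L S)))
      ≤ (Real.exp (-θ) + θ - 1) * bernExp p l
          (fun S => Real.exp (θ * L S) * (l.map fun i => L S - L (S.erase i)).sum) := by
  induction l generalizing L with
  | nil => simp [bernExp]
  | cons a l ih =>
    obtain ⟨hal, hl⟩ := List.nodup_cons.1 hl
    have hL' : ∀ S, ∀ b ∉ S, L (insert a (insert b S)) = L (insert a S)
        ∨ L (insert a (insert b S)) = L (insert a S) + 1 := by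
      intro S b hb
      by_cases hba : b = a
      · subst hba; simp
      · rw [Finset.insert_comm]
        exact hL _ _ (by simp [hba, hb])
    have h0 := ih hl hL
    have h1 := ih (L := fun S => L (insert a S)) hl hL'
    have h2 := twoPointEnt_le hp hp1 (hp a) (hp1 a) l (F := fun S => Real.exp (θ * L S))
      (G := fun S => Real.exp (θ * L (insert a S))) (fun S => Real.exp_pos _)
      (fun S => Real.exp_pos _)
    have h3 : bernExp p l (fun S => twoPointEnt (p a) (Real.exp (θ * L S))
          (Real.exp (θ * L (insert a S))))
        ≤ (Real.exp (-θ) + θ - 1) * (p a * bernExp p l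
          (fun S => Real.exp (θ * L (insert a S)) * (L (insert a S) - L (S.erase a)))) := by
      rw [← const_mul, ← const_mul]
      have e : bernExp p l (fun S => twoPointEnt (p a) (Real.exp (θ * L S))
          (Real.exp (θ * L (insert a S)))) = bernExp p l (fun S =>
            twoPointEnt (p a) (Real.exp (θ * L (S.erase a))) (Real.exp (θ * L (insert a S)))) := by
        refine congr l fun S hS => ?_
        rw [Finset.erase_eq_of_notMem fun h => hal (hS a h)]
      rw [e]
      refine mono hp hp1 l fun S => twoPointEnt_exp_le (hp a) (hp1 a) ?_
      have := hL (S.erase a) a (Finset.notMem_erase a S)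
      rwa [show insert a (S.erase a) = insert a S by ext; simp; tauto] at this
    have e0 : bernExp p l (fun S => Real.exp (θ * L S)
          * ((a :: l).map fun i => L S - L (S.erase i)).sum)
        = bernExp p l (fun S => Real.exp (θ * L S) * (l.map fun i => L S - L (S.erase i)).sum) := by
      refine congr l fun S hS => ?_
      rw [List.map_cons, List.sum_cons, Finset.erase_eq_of_notMem fun h => hal (hS a h)]
      simp
    have e1 : bernExp p l (fun S => Real.exp (θ * L (insert a S))
          * ((a :: l).map fun i => L (insert a S) - L ((insert a S).erase i)).sum)
        = bernExp p l (fun S => Real.exp (θ * L (insert a S)) * (L (insert a S) - L (S.erase a)))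
        + bernExp p l (fun S => Real.exp (θ * L (insert a S))
            * (l.map fun i => L (insert a S) - L (insert a (S.erase i))).sum) := by
      rw [← add]
      refine congr l fun S hS => ?_
      have haS : a ∉ S := fun h => hal (hS a h)
      rw [List.map_cons, List.sum_cons, Finset.erase_insert haS, Finset.erase_eq_of_notMem haS,
        ← mul_add]
      congr 3
      refine List.map_congr_left fun i hi => ?_
      rw [Finset.erase_insert_of_ne]
      rintro rfl; exact hal hi
    simp only [bernExp] at *
    rw [e0, e1]
    rw [twoPointEnt] at h2
    have hpa := hp a
    have hpa1 := sub_nonneg.2 (hp1 a)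
    have h0' := mul_le_mul_of_nonneg_left h0 hpa1
    have h1' := mul_le_mul_of_nonneg_left h1 hpa
    linarith

lemma hasDerivAt_exp (l : List ι) (L : Finset ι → ℝ) (θ : ℝ) :
    HasDerivAt (fun t => bernExp p l (fun S => Real.exp (t * L S)))
      (bernExp p l (fun S => Real.exp (θ * L S) * L S)) θ := by
  induction l generalizing L with
  | nil =>
    simp only [bernExp]
    simpa using ((hasDerivAt_id θ).mul_const (L ∅)).exp
  | cons a l ih =>
    simp only [bernExp]
    exact ((ih L).const_mul _).add ((ih fun S => L (insert a S)).const_mul _)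

end bernExp

/-- A differential inequality forcing sub-Poissonian growth of a cumulant generating function. -/
lemma le_exp_sub_one_mul_of_deriv {K K' : ℝ → ℝ} (hK : ∀ t, HasDerivAt K (K' t) t) (h0 : K 0 = 0)
    (hineq : ∀ t, (1 - Real.exp (-t)) * K' t ≤ K t) (t : ℝ) :
    K t ≤ (Real.exp t - 1) * K' 0 := by
  set h : ℝ → ℝ := fun s => K s / (Real.exp s - 1) with hdef
  have hne : ∀ s : ℝ, s ≠ 0 → Real.exp s - 1 ≠ 0 := fun s hs => by
    rw [sub_ne_zero]; exact fun e => hs (Real.exp_eq_one_iff s |>.1 e)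
  have hder : ∀ s : ℝ, s ≠ 0 → HasDerivAt h
      ((K' s * (Real.exp s - 1) - K s * Real.exp s) / (Real.exp s - 1) ^ 2) s := fun s hs =>
    (hK s).div ((Real.hasDerivAt_exp s).sub_const 1) (hne s hs)
  have hneg : ∀ s : ℝ, (K' s * (Real.exp s - 1) - K s * Real.exp s) / (Real.exp s - 1) ^ 2 ≤ 0 := by
    intro s
    apply div_nonpos_of_nonpos_of_nonneg _ (sq_nonneg _)
    have h1 := mul_le_mul_of_nonneg_left (hineq s) (Real.exp_pos s).le
    have e : Real.exp s * Real.exp (-s) = 1 := by rw [← Real.exp_add]; simp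
    have e2 : Real.exp s * ((1 - Real.exp (-s)) * K' s) = (Real.exp s - 1) * K' s := by
      linear_combination (-K' s) * e
    rw [e2] at h1
    linarith
  have hlim : Tendsto h (𝓝[≠] 0) (𝓝 (K' 0)) := by
    have h1 := hasDerivAt_iff_tendsto_slope.1 (hK 0)
    have h2 := hasDerivAt_iff_tendsto_slope.1 (Real.hasDerivAt_exp 0)
    have h3 := h1.div h2 (by simp)
    rw [Real.exp_zero, div_one] at h3
    refine h3.congr' ?_
    filter_upwards [self_mem_nhdsWithin] with s hs
    have hs' : s ≠ 0 := hs
    simp only [Pi.div_apply, slope_def_field, h0, sub_zero, Real.exp_zero, hdef]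
    have := hne s hs'
    field_simp
  rcases lt_trichotomy t 0 with ht | rfl | ht
  · have hanti : AntitoneOn h (Set.Iio 0) := by
      refine antitoneOn_of_deriv_nonpos (convex_Iio 0)
        (fun s hs => (hder s (ne_of_lt hs)).continuousAt.continuousWithinAt) ?_ ?_
      · rw [interior_Iio]
        exact fun s hs => (hder s (ne_of_lt hs)).differentiableAt.differentiableWithinAt
      · rw [interior_Iio]
        exact fun s hs => by rw [(hder s (ne_of_lt hs)).deriv]; exact hneg s
    have hle : K' 0 ≤ h t := by
      have hlim' : Tendsto h (𝓝[<] 0) (𝓝 (K' 0)) :=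
        hlim.mono_left (nhdsWithin_mono 0 fun s hs => ne_of_lt hs)
      refine le_of_tendsto hlim' ?_
      have : Set.Ioi t ∈ 𝓝[<] (0 : ℝ) := mem_nhdsWithin_of_mem_nhds (Ioi_mem_nhds ht)
      filter_upwards [this, self_mem_nhdsWithin] with s hs hs0
      exact hanti ht hs0 (le_of_lt hs)
    have hexp : Real.exp t - 1 < 0 := by rw [sub_neg]; exact Real.exp_lt_one_iff.2 ht
    have : K t = (Real.exp t - 1) * h t := by rw [hdef]; field_simp [hexp.ne]
    rw [this]
    exact mul_le_mul_of_nonpos_left hle hexp.le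
  · simp [h0]
  · have hanti : AntitoneOn h (Set.Ioi 0) := by
      refine antitoneOn_of_deriv_nonpos (convex_Ioi 0)
        (fun s hs => (hder s (ne_of_gt hs)).continuousAt.continuousWithinAt) ?_ ?_
      · rw [interior_Ioi]
        exact fun s hs => (hder s (ne_of_gt hs)).differentiableAt.differentiableWithinAt
      · rw [interior_Ioi]
        exact fun s hs => by rw [(hder s (ne_of_gt hs)).deriv]; exact hneg s
    have hle : h t ≤ K' 0 := by
      have hlim' : Tendsto h (𝓝[>] 0) (𝓝 (K' 0)) :=
        hlim.mono_left (nhdsWithin_mono 0 fun s hs => ne_of_gt hs)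
      refine ge_of_tendsto hlim' ?_
      have : Set.Iio t ∈ 𝓝[>] (0 : ℝ) := mem_nhdsWithin_of_mem_nhds (Iio_mem_nhds ht)
      filter_upwards [this, self_mem_nhdsWithin] with s hs hs0
      exact hanti hs0 ht (le_of_lt hs)
    have hexp : 0 < Real.exp t - 1 := by rw [sub_pos]; exact Real.one_lt_exp_iff.2 ht
    have : K t = (Real.exp t - 1) * h t := by rw [hdef]; field_simp [hexp.ne']
    rw [this]
    exact mul_le_mul_of_nonneg_left hle hexp.le

/-- Sub-Poissonian bound for the moment generating function of a self-bounding function of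
independent Bernoulli variables. -/
lemma bernExp_exp_le {ι : Type*} [DecidableEq ι] {p : ι → ℝ} (hp : ∀ i, 0 ≤ p i)
    (hp1 : ∀ i, p i ≤ 1) (l : List ι) (hl : l.Nodup) {L : Finset ι → ℝ}
    (hL : ∀ S, ∀ a ∉ S, L (insert a S) = L S ∨ L (insert a S) = L S + 1)
    (hself : ∀ S, (l.map fun i => L S - L (S.erase i)).sum ≤ L S) (θ : ℝ) :
    bernExp p l (fun S => Real.exp (θ * L S)) ≤ Real.exp ((Real.exp θ - 1) * bernExp p l L) := by
  set M : ℝ → ℝ := fun t => bernExp p l (fun S => Real.exp (t * L S)) with hM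
  set M' : ℝ → ℝ := fun t => bernExp p l (fun S => Real.exp (t * L S) * L S) with hM'
  have hMpos : ∀ t, 0 < M t := fun t => bernExp.pos hp hp1 l fun S => Real.exp_pos _
  have hder : ∀ t, HasDerivAt (fun s => Real.log (M s)) (M' t / M t) t := fun t =>
    (bernExp.hasDerivAt_exp l L t).log (hMpos t).ne'
  have key := le_exp_sub_one_mul_of_deriv hder (by simp [hM, bernExp.const]) (fun t => ?_) θ
  · have e : M' 0 / M 0 = bernExp p l L := by simp [hM, hM', bernExp.const]
    rw [e] at key
    calc M θ = Real.exp (Real.log (M θ)) := (Real.exp_log (hMpos θ)).symm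
      _ ≤ _ := Real.exp_le_exp.2 key
  · have h := bernExp.entropy_le hp hp1 t l hl hL
    have e1 : bernExp p l (fun S => Real.exp (t * L S) * Real.log (Real.exp (t * L S)))
        = t * M' t := by
      rw [hM', ← bernExp.const_mul]
      congr 1; funext S
      rw [Real.log_exp]; ring
    have hph : 0 ≤ Real.exp (-t) + t - 1 := by linarith [Real.add_one_le_exp (-t)]
    have h2 : bernExp p l
          (fun S => Real.exp (t * L S) * (l.map fun i => L S - L (S.erase i)).sum) ≤ M' t :=
      bernExp.mono hp hp1 l fun S => mul_le_mul_of_nonneg_left (hself S) (Real.exp_pos _).le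
    rw [e1] at h
    have h3 := h.trans (mul_le_mul_of_nonneg_left h2 hph)
    change t * M' t - M t * Real.log (M t) ≤ _ at h3
    rw [← mul_div_assoc, div_le_iff₀ (hMpos t)]
    linarith

/-! ### Largest members of a hereditary family -/

section MaxCard

open Classical in
/-- The maximal cardinality of a subset of `S` in the family `𝓕`. -/
def maxCard {ι : Type*} (𝓕 : Finset ι → Prop) (S : Finset ι) : ℕ :=
  (S.powerset.filter 𝓕).sup Finset.card

variable {ι : Type*} {𝓕 : Finset ι → Prop}

lemma card_le_maxCard {S C : Finset ι} (hC : C ⊆ S) (h : 𝓕 C) : C.card ≤ maxCard 𝓕 S := by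
  classical
  exact Finset.le_sup (f := Finset.card) (by simp [hC, h])

lemma exists_card_eq_maxCard (h0 : 𝓕 ∅) (S : Finset ι) :
    ∃ C ⊆ S, 𝓕 C ∧ C.card = maxCard 𝓕 S := by
  classical
  obtain ⟨C, hC, h⟩ := Finset.exists_mem_eq_sup (S.powerset.filter 𝓕) ⟨∅, by simp [h0]⟩ Finset.card
  simp only [Finset.mem_filter, Finset.mem_powerset] at hC
  refine ⟨C, hC.1, hC.2, ?_⟩
  rw [← h, maxCard]

lemma maxCard_mono (h0 : 𝓕 ∅) : Monotone (maxCard 𝓕) := fun S T hST => by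
  obtain ⟨C, hC, h, hc⟩ := exists_card_eq_maxCard h0 S
  rw [← hc]
  exact card_le_maxCard (hC.trans hST) h

lemma maxCard_le_erase_add_one [DecidableEq ι] (h0 : 𝓕 ∅) (hsub : ∀ C D, 𝓕 C → D ⊆ C → 𝓕 D)
    (S : Finset ι) (a : ι) : maxCard 𝓕 S ≤ maxCard 𝓕 (S.erase a) + 1 := by
  obtain ⟨C, hC, h, hc⟩ := exists_card_eq_maxCard h0 S
  have h1 := card_le_maxCard (Finset.erase_subset_erase a hC) (hsub _ _ h (Finset.erase_subset a C))
  have h2 := Finset.pred_card_le_card_erase (s := C) (a := a)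
  omega

lemma maxCard_insert [DecidableEq ι] (h0 : 𝓕 ∅) (hsub : ∀ C D, 𝓕 C → D ⊆ C → 𝓕 D)
    (S : Finset ι) (a : ι) (ha : a ∉ S) :
    (maxCard 𝓕 (insert a S) : ℝ) = maxCard 𝓕 S
      ∨ (maxCard 𝓕 (insert a S) : ℝ) = maxCard 𝓕 S + 1 := by
  have h1 := maxCard_le_erase_add_one h0 hsub (insert a S) a
  rw [Finset.erase_insert ha] at h1
  have h2 := maxCard_mono h0 (Finset.subset_insert a S)
  norm_cast
  omega

lemma sum_maxCard_sub_erase_le [Fintype ι] [DecidableEq ι] (h0 : 𝓕 ∅)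
    (hsub : ∀ C D, 𝓕 C → D ⊆ C → 𝓕 D) (S : Finset ι) :
    ((Finset.univ.toList : List ι).map fun i => (maxCard 𝓕 S : ℝ) - maxCard 𝓕 (S.erase i)).sum
      ≤ maxCard 𝓕 S := by
  rw [Finset.sum_map_toList]
  obtain ⟨C, hC, h, hc⟩ := exists_card_eq_maxCard h0 S
  have key : ∀ i, (maxCard 𝓕 S : ℝ) - maxCard 𝓕 (S.erase i) ≤ if i ∈ C then 1 else 0 := by
    intro i
    split_ifs with hi
    · have := maxCard_le_erase_add_one h0 hsub S i
      have : (maxCard 𝓕 S : ℝ) ≤ maxCard 𝓕 (S.erase i) + 1 := by exact_mod_cast this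
      linarith
    · have : C ⊆ S.erase i := fun x hx => Finset.mem_erase.2 ⟨fun e => hi (e ▸ hx), hC hx⟩
      have := card_le_maxCard this h
      rw [hc] at this
      have : (maxCard 𝓕 S : ℝ) ≤ maxCard 𝓕 (S.erase i) := by exact_mod_cast this
      linarith
  refine (Finset.sum_le_sum fun i _ => key i).trans (le_of_eq ?_)
  rw [← hc]; simp

end MaxCard

/-! ### Chain lengths of finite sets -/

section Chains

variable {d : ℕ} {A B : Set (Fin d → ℝ)}

lemma card_le_chainLength (hA : A.Finite) {C : Finset (Fin d → ℝ)} (hC : ↑C ⊆ A)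
    (h : IsChain (· ≤ ·) (C : Set (Fin d → ℝ))) : C.card ≤ chainLength d A := by
  refine le_csSup ⟨hA.toFinset.card, ?_⟩ ⟨C, hC, h, rfl⟩
  rintro n ⟨D, hD, -, rfl⟩
  exact Finset.card_le_card fun x hx => by simpa using hD hx

lemma exists_card_eq_chainLength (hA : A.Finite) : ∃ C : Finset (Fin d → ℝ), ↑C ⊆ A ∧
    IsChain (· ≤ ·) (C : Set (Fin d → ℝ)) ∧ C.card = chainLength d A := by
  refine Nat.sSup_mem (s := {n : ℕ | ∃ C : Finset (Fin d → ℝ),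
    ↑C ⊆ A ∧ IsChain (· ≤ ·) (C : Set (Fin d → ℝ)) ∧ C.card = n}) ⟨0, ∅, by simp⟩
    ⟨hA.toFinset.card, ?_⟩
  rintro n ⟨D, hD, -, rfl⟩
  exact Finset.card_le_card fun x hx => by simpa using hD hx

lemma chainLength_mono (hB : B.Finite) (h : A ⊆ B) : chainLength d A ≤ chainLength d B := by
  obtain ⟨C, hC, hch, hc⟩ := exists_card_eq_chainLength (hB.subset h)
  rw [← hc]
  exact card_le_chainLength hB (hC.trans h) hch

lemma chainLength_le_ncard (hA : A.Finite) : chainLength d A ≤ A.ncard := by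
  obtain ⟨C, hC, hch, hc⟩ := exists_card_eq_chainLength hA
  rw [← hc, ← Set.ncard_coe_finset]
  exact Set.ncard_le_ncard hC hA

@[simp] lemma chainLength_empty : chainLength d ∅ = 0 := by
  simpa using chainLength_le_ncard (d := d) (A := ∅) Set.finite_empty

lemma chainLength_union_le (hA : A.Finite) (hB : B.Finite) :
    chainLength d (A ∪ B) ≤ chainLength d A + chainLength d B := by
  classical
  obtain ⟨C, hC, hch, hc⟩ := exists_card_eq_chainLength (hA.union hB)
  have h1 : (C.filter (· ∈ A)).card ≤ chainLength d A :=
    card_le_chainLength hA (fun x hx => (Finset.mem_filter.1 hx).2)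
      (hch.mono fun x hx => (Finset.mem_filter.1 hx).1)
  have h2 : (C.filter (¬ · ∈ A)).card ≤ chainLength d B :=
    card_le_chainLength hB (fun x hx => by
      have := Finset.mem_filter.1 hx
      exact (hC this.1).resolve_left this.2)
      (hch.mono fun x hx => (Finset.mem_filter.1 hx).1)
  have h3 := Finset.card_filter_add_card_filter_not (s := C) (· ∈ A)
  omega

lemma chainLength_iUnion_le {ι : Type*} (s : Finset ι) {B : ι → Set (Fin d → ℝ)}
    (hB : ∀ i, (B i).Finite) :
    chainLength d (⋃ i ∈ s, B i) ≤ ∑ i ∈ s, chainLength d (B i) := by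
  classical
  induction s using Finset.induction_on with
  | empty => simp
  | insert a s ha ih =>
    rw [Finset.set_biUnion_insert, Finset.sum_insert ha]
    exact (chainLength_union_le (hB a) (s.finite_toSet.biUnion fun i _ => hB i)).trans
      (Nat.add_le_add_left ih _)

lemma chainLength_image {G : (Fin d → ℝ) → Fin d → ℝ} (hA : A.Finite)
    (hG : ∀ x y, G x ≤ G y ↔ x ≤ y) : chainLength d (G '' A) = chainLength d A := by
  classical
  have hinj : Function.Injective G := fun x y h =>
    le_antisymm ((hG x y).1 h.le) ((hG y x).1 h.ge)
  apply le_antisymm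
  · obtain ⟨C, hC, hch, hc⟩ := exists_card_eq_chainLength (hA.image G)
    obtain ⟨D, hD, rfl⟩ := Finset.subset_set_image_iff.1 hC
    rw [← hc, Finset.card_image_of_injective _ hinj]
    refine card_le_chainLength hA hD fun x hx y hy hxy => ?_
    have := hch (Finset.mem_coe.2 (Finset.mem_image_of_mem G hx))
      (Finset.mem_coe.2 (Finset.mem_image_of_mem G hy)) (hinj.ne hxy)
    simpa only [hG] using this
  · obtain ⟨C, hC, hch, hc⟩ := exists_card_eq_chainLength hA
    rw [← hc, ← Finset.card_image_of_injective C hinj]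
    refine card_le_chainLength (hA.image G) ?_ ?_
    · rw [Finset.coe_image]; exact Set.image_mono hC
    · rw [Finset.coe_image]
      rintro _ ⟨x, hx, rfl⟩ _ ⟨y, hy, rfl⟩ hxy
      simpa only [hG] using hch hx hy fun e => hxy (e ▸ rfl)

end Chains

/-! ### Discretization of the unit cube -/

section Cells

variable {d : ℕ}

/-- The cell of index `i` in the partition of the unit cube into cubes of side `1 / k`. -/
def gridCell (d k : ℕ) (i : Fin d → Fin (k + 1)) : Set (Fin d → ℝ) :=
  {z | z ∈ Set.Icc 0 1 ∧ ∀ j, ⌊(k : ℝ) * z j⌋₊ = i j}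

open Classical in
/-- The indices of the cells met by `A`. -/
def occupied (k : ℕ) (A : Set (Fin d → ℝ)) : Finset (Fin d → Fin (k + 1)) :=
  Finset.univ.filter fun i => (A ∩ gridCell d k i).Nonempty

/-- Any two distinct indices are comparable, strictly in each coordinate. -/
def IsStrictChain {k : ℕ} (C : Finset (Fin d → Fin k)) : Prop :=
  (C : Set (Fin d → Fin k)).Pairwise fun a b => (∀ j, a j < b j) ∨ ∀ j, b j < a j

/-- Maximal cardinality of a strict chain of occupied cells. -/
def gridLength (k : ℕ) (A : Set (Fin d → ℝ)) : ℕ := maxCard IsStrictChain (occupied k A)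

lemma mem_occupied {k : ℕ} {A : Set (Fin d → ℝ)} {i : Fin d → Fin (k + 1)} :
    i ∈ occupied k A ↔ (A ∩ gridCell d k i).Nonempty := by
  simp [occupied]

lemma isStrictChain_empty {k : ℕ} : IsStrictChain (∅ : Finset (Fin d → Fin k)) := by
  simp [IsStrictChain]

lemma IsStrictChain.subset {k : ℕ} (C D : Finset (Fin d → Fin k)) (h : IsStrictChain C)
    (hDC : D ⊆ C) : IsStrictChain D := Set.Pairwise.mono (by exact_mod_cast hDC) h

lemma measurableSet_gridCell (k : ℕ) (i : Fin d → Fin (k + 1)) :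
    MeasurableSet (gridCell d k i) := by
  have : gridCell d k i = Set.Icc 0 1 ∩ ⋂ j, {z | ⌊(k : ℝ) * z j⌋₊ = i j} := by
    ext z; simp [gridCell]
  rw [this]
  refine measurableSet_Icc.inter (MeasurableSet.iInter fun j => ?_)
  exact (Nat.measurable_floor.comp ((measurable_pi_apply j).const_mul _))
    (measurableSet_singleton _)

lemma pairwise_disjoint_gridCell (k : ℕ) : Pairwise (Function.onFun Disjoint (gridCell d k)) := by
  intro i i' hii'
  refine Set.disjoint_left.2 fun z hz hz' => hii' ?_
  funext j
  exact Fin.ext ((hz.2 j).symm.trans (hz'.2 j))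

lemma gridLength_le_chainLength {A : Set (Fin d → ℝ)} (hA : A.Finite) (k : ℕ) :
    gridLength k A ≤ chainLength d A := by
  classical
  obtain ⟨C, hC, h, hc⟩ := exists_card_eq_maxCard (isStrictChain_empty) (occupied k A)
  have hex : ∀ i ∈ C, ∃ z, z ∈ A ∧ z ∈ gridCell d k i := fun i hi => mem_occupied.1 (hC hi)
  choose! g hgA hg using hex
  have hinj : Set.InjOn g C := by
    intro i hi i' hi' e
    by_contra hne
    exact Set.disjoint_left.1 (pairwise_disjoint_gridCell k hne) (hg i hi) (e ▸ hg i' hi')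
  have hlt : ∀ i ∈ C, ∀ i' ∈ C, (∀ j, i j < i' j) → g i ≤ g i' := by
    intro i hi i' hi' hlt j
    by_contra! hcon
    have h1 : ⌊(k : ℝ) * g i' j⌋₊ ≤ ⌊(k : ℝ) * g i j⌋₊ :=
      Nat.floor_le_floor (mul_le_mul_of_nonneg_left hcon.le (Nat.cast_nonneg k))
    rw [(hg i hi).2 j, (hg i' hi').2 j] at h1
    exact absurd (hlt j) (not_lt.2 h1)
  rw [gridLength, ← hc, ← Finset.card_image_of_injOn hinj]
  refine card_le_chainLength hA ?_ ?_
  · intro z hz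
    obtain ⟨i, hi, rfl⟩ := Finset.mem_image.1 (Finset.mem_coe.1 hz)
    exact hgA i hi
  · rw [Finset.coe_image]
    rintro _ ⟨i, hi, rfl⟩ _ ⟨i', hi', rfl⟩ hne
    rcases h hi hi' (fun e => hne (e ▸ rfl)) with hl | hl
    · exact Or.inl (hlt i hi i' hi' hl)
    · exact Or.inr (hlt i' hi' i hi hl)

lemma eventually_gridLength_eq (hd : 0 < d) {A : Set (Fin d → ℝ)} (hA : A.Finite)
    (hcube : A ⊆ Set.Icc 0 1) (hinj : ∀ j, Set.InjOn (fun z : Fin d → ℝ => z j) A) :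
    ∀ᶠ k : ℕ in atTop, gridLength k A = chainLength d A := by
  classical
  have hsep : ∀ᶠ k : ℕ in atTop, ∀ z ∈ A, ∀ z' ∈ A, ∀ j, z j < z' j →
      ⌊(k : ℝ) * z j⌋₊ < ⌊(k : ℝ) * z' j⌋₊ := by
    rw [hA.eventually_all]
    intro z hz
    rw [hA.eventually_all]
    intro z' hz'
    rw [eventually_all]
    intro j
    by_cases hlt : z j < z' j
    · have hpos : 0 < z' j - z j := sub_pos.2 hlt
      have := (tendsto_natCast_atTop_atTop (R := ℝ)).atTop_mul_const hpos
      filter_upwards [this.eventually_ge_atTop 1] with k hk _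
      have h0 : 0 ≤ (k : ℝ) * z j := mul_nonneg (Nat.cast_nonneg k) ((hcube hz).1 j)
      rw [Nat.lt_iff_add_one_le, Nat.le_floor_iff (by nlinarith)]
      push_cast
      have := Nat.floor_le h0
      linarith
    · exact Eventually.of_forall fun k h => absurd h hlt
  filter_upwards [hsep] with k hk
  refine le_antisymm (gridLength_le_chainLength hA k) ?_
  obtain ⟨C, hC, hch, hc⟩ := exists_card_eq_chainLength hA
  have hfl : ∀ z ∈ A, ∀ j, ⌊(k : ℝ) * z j⌋₊ < k + 1 := by
    intro z hz j
    rw [Nat.lt_succ_iff]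
    refine Nat.floor_le_of_le ?_
    have := (hcube hz).2 j
    simp only [Pi.one_apply] at this
    nlinarith [(Nat.cast_nonneg k : (0 : ℝ) ≤ k)]
  let idx : (Fin d → ℝ) → Fin d → Fin (k + 1) := fun z j =>
    if h : ⌊(k : ℝ) * z j⌋₊ < k + 1 then ⟨_, h⟩ else 0
  have hidx : ∀ z ∈ A, ∀ j, (idx z j : ℕ) = ⌊(k : ℝ) * z j⌋₊ := by
    intro z hz j
    simp only [idx, dif_pos (hfl z hz j)]
  have hcmp : ∀ z ∈ A, ∀ z' ∈ A, z ≠ z' → z ≤ z' → ∀ j, idx z j < idx z' j := by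
    intro z hz z' hz' hne hle j
    rw [Fin.lt_def, hidx z hz, hidx z' hz']
    exact hk z hz z' hz' j (lt_of_le_of_ne (hle j) fun e => hne (hinj j hz hz' e))
  have hpair : ∀ z ∈ C, ∀ z' ∈ C, z ≠ z' →
      (∀ j, idx z j < idx z' j) ∨ ∀ j, idx z' j < idx z j := by
    intro z hz z' hz' hne
    rcases hch hz hz' hne with h | h
    · exact Or.inl (hcmp z (hC hz) z' (hC hz') hne h)
    · exact Or.inr (hcmp z' (hC hz') z (hC hz) hne.symm h)
  have hinjidx : Set.InjOn idx C := by
    intro z hz z' hz' e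
    by_contra hne
    rcases hpair z hz z' hz' hne with h | h
    · exact (h ⟨0, hd⟩).ne (by rw [e])
    · exact (h ⟨0, hd⟩).ne (by rw [e])
  rw [← hc, ← Finset.card_image_of_injOn hinjidx]
  refine card_le_maxCard ?_ ?_
  · intro i hi
    obtain ⟨z, hz, rfl⟩ := Finset.mem_image.1 hi
    exact mem_occupied.2 ⟨z, hC hz, hcube (hC hz), fun j => (hidx z (hC hz) j).symm⟩
  · rw [IsStrictChain, Finset.coe_image]
    rintro _ ⟨z, hz, rfl⟩ _ ⟨z', hz', rfl⟩ hne
    exact hpair z hz z' hz' fun e => hne (e ▸ rfl)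

end Cells

/-! ### Random subsets of the unit cube with Poissonian void probabilities -/

/-- `Y` is an almost surely finite random subset of the unit cube, with almost surely pairwise
distinct coordinates, which avoids `A` with probability `exp (-m A)`. -/
structure IsVoidModel {d : ℕ} {Ω : Type*} [MeasurableSpace Ω] (P : Measure Ω)
    (m : Measure (Fin d → ℝ)) (Y : Ω → Set (Fin d → ℝ)) : Prop where
  subset_cube : ∀ᵐ ω ∂P, Y ω ⊆ Set.Icc 0 1
  finite : ∀ᵐ ω ∂P, (Y ω).Finite
  injOn : ∀ᵐ ω ∂P, ∀ j, Set.InjOn (fun z : Fin d → ℝ => z j) (Y ω)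
  measurableSet_void : ∀ A, MeasurableSet A → MeasurableSet {ω | Y ω ∩ A = ∅}
  void : ∀ A, MeasurableSet A → P.real {ω | Y ω ∩ A = ∅} = Real.exp (-m.real A)

namespace IsVoidModel

variable {d : ℕ} {Ω : Type*} [MeasurableSpace Ω] {P : Measure Ω}
  {m : Measure (Fin d → ℝ)} {Y : Ω → Set (Fin d → ℝ)}

lemma measurableSet_occupied_eq (h : IsVoidModel P m Y) (k : ℕ)
    (S : Finset (Fin d → Fin (k + 1))) : MeasurableSet {ω | occupied k (Y ω) = S} := by
  have e : {ω | occupied k (Y ω) = S}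
      = ⋂ i, {ω | (Y ω ∩ gridCell d k i).Nonempty ↔ i ∈ S} := by
    ext ω
    simp only [Set.mem_ofPred_eq, Set.mem_iInter, Finset.ext_iff, mem_occupied]
  rw [e]
  refine MeasurableSet.iInter fun i => ?_
  have hv := h.measurableSet_void _ (measurableSet_gridCell k i)
  by_cases hi : i ∈ S
  · convert hv.compl using 1
    ext ω; simp [hi, Set.nonempty_iff_ne_empty]
  · convert hv using 1
    ext ω; simp [hi, Set.not_nonempty_iff_eq_empty]

lemma measurable_comp_occupied (h : IsVoidModel P m Y) (k : ℕ) {β : Type*} [MeasurableSpace β]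
    (F : Finset (Fin d → Fin (k + 1)) → β) : Measurable fun ω => F (occupied k (Y ω)) := by
  intro s _
  have : (fun ω => F (occupied k (Y ω))) ⁻¹' s
      = ⋃ S ∈ {S | F S ∈ s}, {ω | occupied k (Y ω) = S} := by
    ext ω; simp
  rw [this]
  exact MeasurableSet.biUnion (Set.to_countable _) fun S _ => h.measurableSet_occupied_eq k S

lemma integral_comp_occupied [IsProbabilityMeasure P] [IsFiniteMeasure m]
    (h : IsVoidModel P m Y) (k : ℕ)
    (F : Finset (Fin d → Fin (k + 1)) → ℝ) :
    ∫ ω, F (occupied k (Y ω)) ∂P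
      = bernExp (fun i => 1 - Real.exp (-m.real (gridCell d k i))) Finset.univ.toList F := by
  classical
  rw [← sum_weights_eq_bernExp (w := fun S => P.real {ω | occupied k (Y ω) = S})]
  · have e : (fun ω => F (occupied k (Y ω)))
        = fun ω => ∑ S, F S * Set.indicator {ω | occupied k (Y ω) = S} 1 ω := by
      funext ω
      simp [Set.indicator_apply]
    rw [e, integral_finsetSum]
    · refine Finset.sum_congr rfl fun S _ => ?_
      rw [integral_const_mul, integral_indicator_one (h.measurableSet_occupied_eq k S), mul_comm]
    · intro S _
      exact ((integrable_const (1 : ℝ)).indicator (h.measurableSet_occupied_eq k S)).const_mul _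
  · intro T
    have e1 : ∑ S ∈ T.powerset, P.real {ω | occupied k (Y ω) = S}
        = P.real {ω | Y ω ∩ (⋃ i ∈ Tᶜ, gridCell d k i) = ∅} := by
      rw [← measureReal_biUnion_finset]
      · congr 1
        ext ω
        simp only [Set.mem_iUnion, Finset.mem_powerset, Set.mem_ofPred_eq, exists_prop,
          exists_eq_right', Set.inter_iUnion, Set.iUnion_eq_empty, Finset.mem_compl]
        constructor
        · intro hs i hi
          rw [← Set.not_nonempty_iff_eq_empty, ← mem_occupied]
          exact fun hm => hi (hs hm)
        · intro hs i hi
          by_contra hiT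
          have := hs i hiT
          rw [← Set.not_nonempty_iff_eq_empty, ← mem_occupied] at this
          exact this hi
      · intro S _ S' _ hne
        exact Set.disjoint_left.2 fun ω h1 h2 => hne (h1.symm.trans h2)
      · exact fun S _ => h.measurableSet_occupied_eq k S
    rw [e1, h.void _ (Finset.measurableSet_biUnion _ fun i _ => measurableSet_gridCell k i),
      measureReal_biUnion_finset (fun i _ j _ hij => pairwise_disjoint_gridCell k hij)
        (fun i _ => measurableSet_gridCell k i), ← Finset.sum_neg_distrib, Real.exp_sum]
    exact Finset.prod_congr rfl fun i _ => by ring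

lemma lintegral_comp_occupied [IsProbabilityMeasure P] [IsFiniteMeasure m]
    (h : IsVoidModel P m Y) (k : ℕ)
    {F : Finset (Fin d → Fin (k + 1)) → ℝ} (hF : ∀ S, 0 ≤ F S) :
    ∫⁻ ω, ENNReal.ofReal (F (occupied k (Y ω))) ∂P = ENNReal.ofReal
      (bernExp (fun i => 1 - Real.exp (-m.real (gridCell d k i))) Finset.univ.toList F) := by
  rw [← h.integral_comp_occupied k F, ofReal_integral_eq_lintegral_ofReal _
    (Eventually.of_forall fun ω => hF _)]
  obtain ⟨K, hK⟩ := (Set.finite_range F).bddAbove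
  refine Integrable.of_bound (h.measurable_comp_occupied k F).aestronglyMeasurable K
    (Eventually.of_forall fun ω => ?_)
  rw [Real.norm_of_nonneg (hF _)]
  exact hK ⟨_, rfl⟩

lemma ae_eventually_gridLength_eq (hd : 0 < d) (h : IsVoidModel P m Y) :
    ∀ᵐ ω ∂P, ∀ᶠ k : ℕ in atTop, gridLength k (Y ω) = chainLength d (Y ω) := by
  filter_upwards [h.subset_cube, h.finite, h.injOn] with ω h0 h1 h2
  exact eventually_gridLength_eq hd h1 h0 h2

lemma aemeasurable_chainLength (hd : 0 < d) (h : IsVoidModel P m Y) :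
    AEMeasurable (fun ω => (chainLength d (Y ω) : ℝ)) P := by
  refine aemeasurable_of_tendsto_metrizable_ae atTop (f := fun k ω => (gridLength k (Y ω) : ℝ))
    (fun k => (h.measurable_comp_occupied k
      fun S => (maxCard IsStrictChain S : ℝ)).aemeasurable) ?_
  filter_upwards [h.ae_eventually_gridLength_eq hd] with ω hω
  refine tendsto_const_nhds.congr' ?_
  filter_upwards [hω] with k hk
  rw [hk]

/-- Fatou's lemma for functions of the discretized chain length. -/
lemma lintegral_comp_chainLength_le (hd : 0 < d) (h : IsVoidModel P m Y) (F : ℕ → ℝ) :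
    ∫⁻ ω, ENNReal.ofReal (F (chainLength d (Y ω))) ∂P
      ≤ liminf (fun k => ∫⁻ ω, ENNReal.ofReal (F (gridLength k (Y ω))) ∂P) atTop := by
  refine le_trans (le_of_eq (lintegral_congr_ae ?_)) (lintegral_liminf_le fun k =>
    h.measurable_comp_occupied k fun S => ENNReal.ofReal (F (maxCard IsStrictChain S)))
  filter_upwards [h.ae_eventually_gridLength_eq hd] with ω hω
  refine (Tendsto.liminf_eq ?_).symm
  refine tendsto_const_nhds.congr' ?_
  filter_upwards [hω] with k hk
  rw [← hk]

lemma lintegral_gridLength_le (h : IsVoidModel P m Y) (k : ℕ) :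
    ∫⁻ ω, ENNReal.ofReal (gridLength k (Y ω)) ∂P
      ≤ ∫⁻ ω, ENNReal.ofReal (chainLength d (Y ω)) ∂P := by
  refine lintegral_mono_ae ?_
  filter_upwards [h.finite] with ω hω
  exact ENNReal.ofReal_le_ofReal (by exact_mod_cast gridLength_le_chainLength hω k)

/-- Comparison of expected chain lengths for ordered intensities. -/
lemma lintegral_chainLength_mono [IsProbabilityMeasure P] [IsFiniteMeasure m]
    (hd : 0 < d) (h : IsVoidModel P m Y)
    {Ω' : Type*} [MeasurableSpace Ω'] {P' : Measure Ω'} [IsProbabilityMeasure P']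
    {m' : Measure (Fin d → ℝ)} [IsFiniteMeasure m'] {Y' : Ω' → Set (Fin d → ℝ)}
    (h' : IsVoidModel P' m' Y') (hm : m ≤ m') :
    ∫⁻ ω, ENNReal.ofReal (chainLength d (Y ω)) ∂P
      ≤ ∫⁻ ω, ENNReal.ofReal (chainLength d (Y' ω)) ∂P' := by
  refine (h.lintegral_comp_chainLength_le hd fun n => (n : ℝ)).trans ?_
  refine (liminf_le_liminf (v := fun _ => ∫⁻ ω, ENNReal.ofReal (chainLength d (Y' ω)) ∂P')
    (Eventually.of_forall fun k => ?_)).trans (by simp)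
  refine le_trans ?_ (h'.lintegral_gridLength_le k)
  have e := h.lintegral_comp_occupied k (F := fun S => (maxCard IsStrictChain S : ℝ))
    (fun S => Nat.cast_nonneg _)
  have e' := h'.lintegral_comp_occupied k (F := fun S => (maxCard IsStrictChain S : ℝ))
    (fun S => Nat.cast_nonneg _)
  simp only [gridLength, e, e']
  refine ENNReal.ofReal_le_ofReal (bernExp.mono_prob ?_ ?_ ?_ _ ?_)
  · intro i
    rw [sub_nonneg, Real.exp_le_one_iff, neg_nonpos]
    exact measureReal_nonneg
  · intro i
    have : m.real (gridCell d k i) ≤ m'.real (gridCell d k i) :=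
      ENNReal.toReal_mono (measure_ne_top _ _) (hm _)
    gcongr
  · intro i
    rw [sub_le_self_iff]
    exact (Real.exp_pos _).le
  · exact fun S T hST => by exact_mod_cast maxCard_mono isStrictChain_empty hST

lemma lintegral_exp_gridLength_le [IsProbabilityMeasure P] [IsFiniteMeasure m]
    (h : IsVoidModel P m Y) (θ : ℝ) (k : ℕ) :
    ∫⁻ ω, ENNReal.ofReal (Real.exp (θ * gridLength k (Y ω))) ∂P
      ≤ ENNReal.ofReal (Real.exp ((Real.exp θ - 1) * ∫ ω, (gridLength k (Y ω) : ℝ) ∂P)) := by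
  have e := h.lintegral_comp_occupied k (F := fun S => Real.exp (θ * maxCard IsStrictChain S))
    (fun S => (Real.exp_pos _).le)
  have e' := h.integral_comp_occupied k (F := fun S => (maxCard IsStrictChain S : ℝ))
  simp only [gridLength, e, e']
  refine ENNReal.ofReal_le_ofReal (bernExp_exp_le ?_ ?_ _ (Finset.nodup_toList _) ?_ ?_ θ)
  · intro i
    rw [sub_nonneg, Real.exp_le_one_iff, neg_nonpos]
    exact measureReal_nonneg
  · intro i
    rw [sub_le_self_iff]
    exact (Real.exp_pos _).le
  · exact fun S a ha => maxCard_insert isStrictChain_empty IsStrictChain.subset S a ha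
  · exact fun S => sum_maxCard_sub_erase_le isStrictChain_empty IsStrictChain.subset S

lemma tendsto_integral_gridLength (hd : 0 < d) (h : IsVoidModel P m Y)
    (hinteg : Integrable (fun ω => (chainLength d (Y ω) : ℝ)) P) :
    Tendsto (fun k => ∫ ω, (gridLength k (Y ω) : ℝ) ∂P) atTop
      (𝓝 (∫ ω, (chainLength d (Y ω) : ℝ) ∂P)) := by
  refine tendsto_integral_of_dominated_convergence (fun ω => (chainLength d (Y ω) : ℝ))
    (fun k => (h.measurable_comp_occupied k
      fun S => (maxCard IsStrictChain S : ℝ)).aestronglyMeasurable) hinteg (fun k => ?_) ?_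
  · filter_upwards [h.finite] with ω hω
    rw [Real.norm_of_nonneg (Nat.cast_nonneg _)]
    exact_mod_cast gridLength_le_chainLength hω k
  · filter_upwards [h.ae_eventually_gridLength_eq hd] with ω hω
    refine tendsto_const_nhds.congr' ?_
    filter_upwards [hω] with k hk
    rw [hk]

/-- The chain length has a sub-Poissonian moment generating function. -/
lemma lintegral_exp_chainLength_le [IsProbabilityMeasure P] [IsFiniteMeasure m]
    (hd : 0 < d) (h : IsVoidModel P m Y)
    (hinteg : Integrable (fun ω => (chainLength d (Y ω) : ℝ)) P) (θ : ℝ) :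
    ∫⁻ ω, ENNReal.ofReal (Real.exp (θ * chainLength d (Y ω))) ∂P
      ≤ ENNReal.ofReal (Real.exp ((Real.exp θ - 1) * ∫ ω, (chainLength d (Y ω) : ℝ) ∂P)) := by
  refine (h.lintegral_comp_chainLength_le hd fun n => Real.exp (θ * n)).trans ?_
  refine (liminf_le_liminf (Eventually.of_forall fun k => h.lintegral_exp_gridLength_le θ k)).trans
    (le_of_eq (Tendsto.liminf_eq ?_))
  exact (ENNReal.continuous_ofReal.tendsto _).comp ((Real.continuous_exp.tendsto _).comp
    ((h.tendsto_integral_gridLength hd hinteg).const_mul _))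

end IsVoidModel

/-- Two-sided Chernoff bound from a sub-Poissonian moment generating function. -/
lemma measure_abs_sub_ge_le {Ω : Type*} [MeasurableSpace Ω] {P : Measure Ω} {X : Ω → ℝ} {μ : ℝ}
    (hX : AEMeasurable X P) (hμ : 0 ≤ μ)
    (hmgf : ∀ θ : ℝ, ∫⁻ ω, ENNReal.ofReal (Real.exp (θ * X ω)) ∂P
      ≤ ENNReal.ofReal (Real.exp ((Real.exp θ - 1) * μ))) {θ : ℝ} (hθ : 0 ≤ θ) (hθ1 : θ ≤ 1)
    (t : ℝ) : P {ω | t ≤ |X ω - μ|} ≤ 2 * ENNReal.ofReal (Real.exp (θ ^ 2 * μ - θ * t)) := by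
  have key : ∀ η : ℝ, |η| ≤ 1 → P {ω | |η| * t ≤ η * (X ω - μ)}
      ≤ ENNReal.ofReal (Real.exp (η ^ 2 * μ - |η| * t)) := by
    intro η hη
    have hsq : Real.exp η - 1 - η ≤ η ^ 2 :=
      (le_abs_self _).trans (Real.abs_exp_sub_one_sub_id_le hη)
    have hmeas : AEMeasurable (fun ω => ENNReal.ofReal (Real.exp (η * X ω))) P :=
      ((Real.measurable_exp.comp_aemeasurable (hX.const_mul η))).ennreal_ofReal
    have hpos := Real.exp_pos (η * μ + |η| * t)
    have hsub : {ω | |η| * t ≤ η * (X ω - μ)}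
        ⊆ {ω | ENNReal.ofReal (Real.exp (η * μ + |η| * t))
          ≤ ENNReal.ofReal (Real.exp (η * X ω))} := by
      intro ω hω
      refine ENNReal.ofReal_le_ofReal (Real.exp_le_exp.2 ?_)
      have : |η| * t ≤ η * (X ω - μ) := hω
      linarith
    refine (measure_mono hsub).trans ((meas_ge_le_lintegral_div hmeas
      (by simpa using hpos) ENNReal.ofReal_ne_top).trans ?_)
    refine (ENNReal.div_le_div_right (hmgf η) _).trans ?_
    rw [← ENNReal.ofReal_div_of_pos hpos, ← Real.exp_sub]
    refine ENNReal.ofReal_le_ofReal (Real.exp_le_exp.2 ?_)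
    nlinarith
  rcases eq_or_lt_of_le hθ with rfl | hpos
  · have h0 := hmgf 0
    have hP : P Set.univ ≤ 1 := by simpa using h0
    refine (measure_mono (Set.subset_univ _)).trans (hP.trans ?_)
    simp
  have h1 := key θ (by rwa [abs_of_nonneg hθ])
  have h2 := key (-θ) (by rwa [abs_neg, abs_of_nonneg hθ])
  rw [abs_neg, neg_sq] at h2
  rw [abs_of_nonneg hθ] at h1 h2
  have hsub : {ω | t ≤ |X ω - μ|} ⊆ {ω | θ * t ≤ θ * (X ω - μ)} ∪ {ω | θ * t ≤ -θ * (X ω - μ)} := by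
    intro ω hω
    rcases le_abs.1 (show t ≤ |X ω - μ| from hω) with h | h
    · exact Or.inl (mul_le_mul_of_nonneg_left h hθ)
    · refine Or.inr ?_
      have := mul_le_mul_of_nonneg_left h hθ
      show θ * t ≤ -θ * (X ω - μ)
      linarith
  refine (measure_mono hsub).trans ((measure_union_le _ _).trans ?_)
  rw [two_mul]
  exact add_le_add h1 h2

/-! ### Poisson averages of sequences -/

/-- The mass of `n` under the Poisson distribution of mean `r`. -/
def poissonWeight (r : ℝ) (n : ℕ) : ℝ := Real.exp (-r) * r ^ n / n.factorial

lemma poissonWeight_nonneg {r : ℝ} (hr : 0 ≤ r) (n : ℕ) : 0 ≤ poissonWeight r n := by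
  unfold poissonWeight; positivity

lemma hasSum_poissonWeight_mul_pow (r x : ℝ) :
    HasSum (fun n => poissonWeight r n * x ^ n) (Real.exp (-(r * (1 - x)))) := by
  have h := NormedSpace.expSeries_div_hasSum_exp (r * x)
  rw [← Real.exp_eq_exp_ℝ] at h
  have h2 := h.mul_left (Real.exp (-r))
  rw [← Real.exp_add] at h2
  rw [show -(r * (1 - x)) = -r + r * x by ring]
  have e : (fun n => poissonWeight r n * x ^ n)
      = fun n : ℕ => Real.exp (-r) * ((r * x) ^ n / n.factorial) := by
    funext n
    simp only [poissonWeight, mul_pow]; ring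
  rw [e]; exact h2

lemma hasSum_poissonWeight (r : ℝ) : HasSum (poissonWeight r) 1 := by
  simpa using hasSum_poissonWeight_mul_pow r 1

lemma hasSum_poissonWeight_mul_nat {r s : ℝ} {g : ℕ → ℝ}
    (h : HasSum (fun n => poissonWeight r n * g (n + 1)) s) :
    HasSum (fun n => poissonWeight r n * (n * g n)) (r * s) := by
  have h2 : HasSum (fun n : ℕ => poissonWeight r (n + 1) * ((n + 1 : ℕ) * g (n + 1))) (r * s) := by
    refine Eq.mp ?_ (h.mul_left r)
    congr 1
    funext n
    simp only [poissonWeight, Nat.factorial_succ, pow_succ]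
    push_cast
    have : (n.factorial : ℝ) ≠ 0 := by positivity
    have : (n : ℝ) + 1 ≠ 0 := by positivity
    field_simp
  have h3 := (hasSum_nat_add_iff (f := fun n : ℕ => poissonWeight r n * (n * g n)) 1).1 h2
  simpa only [Finset.sum_range_one, Nat.cast_zero, zero_mul, mul_zero, add_zero] using h3

lemma hasSum_poissonWeight_mean (r : ℝ) : HasSum (fun n => poissonWeight r n * n) r := by
  have h := hasSum_poissonWeight_mul_nat (r := r) (s := 1) (g := fun _ => 1)
    (by simpa using hasSum_poissonWeight r)
  simpa only [mul_one] using h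

lemma hasSum_poissonWeight_sq (r : ℝ) :
    HasSum (fun n => poissonWeight r n * ((n : ℝ) * n)) (r * (r + 1)) := by
  refine hasSum_poissonWeight_mul_nat (g := fun n => (n : ℝ)) ?_
  convert (hasSum_poissonWeight_mean r).add (hasSum_poissonWeight r) using 2 with n
  push_cast; ring

/-- The expectation of `e N` for a Poisson variable `N` of mean `r`. -/
def poissonAvg (r : ℝ) (e : ℕ → ℝ) : ℝ := ∑' n, poissonWeight r n * e n

lemma summable_poissonAvg {r : ℝ} (hr : 0 ≤ r) {e : ℕ → ℝ} (h0 : ∀ n, 0 ≤ e n)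
    (h1 : ∀ n, e n ≤ n) : Summable fun n => poissonWeight r n * e n :=
  Summable.of_nonneg_of_le (fun n => mul_nonneg (poissonWeight_nonneg hr n) (h0 n))
    (fun n => mul_le_mul_of_nonneg_left (h1 n) (poissonWeight_nonneg hr n))
    (hasSum_poissonWeight_mean r).summable

lemma poissonAvg_nonneg {r : ℝ} (hr : 0 ≤ r) {e : ℕ → ℝ} (h0 : ∀ n, 0 ≤ e n) :
    0 ≤ poissonAvg r e := tsum_nonneg fun n => mul_nonneg (poissonWeight_nonneg hr n) (h0 n)

lemma rpow_le_tangent {s r x : ℝ} (hs : 0 ≤ s) (hs1 : s ≤ 1) (hr : 0 < r) (hx : 0 ≤ x) :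
    x ^ s ≤ r ^ s * (s * (x / r) + (1 - s)) := by
  have h := Real.geom_mean_le_arith_mean2_weighted hs (sub_nonneg.2 hs1)
    (div_nonneg hx hr.le) zero_le_one (by ring)
  rw [Real.one_rpow, mul_one, mul_one, Real.div_rpow hx hr.le] at h
  rwa [div_le_iff₀ (Real.rpow_pos_of_pos hr s), mul_comm] at h

lemma rpow_ge_parabola {s r x ε : ℝ} (hs : 0 ≤ s) (hs1 : s ≤ 1) (hr : 0 < r) (hx : 0 ≤ x)
    (hε : 0 < ε) : r ^ s * (1 - ε - (x / r - 1) ^ 2 / ε) ≤ x ^ s := by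
  set t := x / r with ht
  have ht0 : 0 ≤ t := div_nonneg hx hr.le
  have hxt : x ^ s = r ^ s * t ^ s := by
    rw [ht, Real.div_rpow hx hr.le]
    have := (Real.rpow_pos_of_pos hr s).ne'
    field_simp
  rw [hxt]
  refine mul_le_mul_of_nonneg_left ?_ (Real.rpow_pos_of_pos hr s).le
  have h1 : min t 1 ≤ t ^ s := by
    rcases le_total t 1 with h | h
    · rw [min_eq_left h]
      rcases eq_or_lt_of_le ht0 with h0 | h0
      · rw [← h0]; exact Real.rpow_nonneg le_rfl s
      · calc t = t ^ (1 : ℝ) := (Real.rpow_one t).symm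
          _ ≤ t ^ s := Real.rpow_le_rpow_of_exponent_ge h0 h hs1
    · rw [min_eq_right h]; exact Real.one_le_rpow h hs
  refine le_trans ?_ h1
  have h2 : |t - 1| ≤ ε + (t - 1) ^ 2 / ε := by
    rw [← sq_abs]
    have h3 : 0 ≤ |t - 1| ^ 2 / ε := by positivity
    rcases le_total |t - 1| ε with h | h
    · linarith
    · have : |t - 1| ≤ |t - 1| ^ 2 / ε := by
        rw [le_div_iff₀ hε, sq]
        exact mul_le_mul_of_nonneg_left h (abs_nonneg _)
      linarith
  rw [abs_le] at h2
  have h4 : 0 ≤ (t - 1) ^ 2 / ε := by positivity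
  refine le_min ?_ ?_ <;> linarith

lemma poissonAvg_upper {r s A C : ℝ} (hr : 0 < r) (hs : 0 ≤ s) (hs1 : s ≤ 1) (hA : 0 ≤ A)
    {e : ℕ → ℝ} (h0 : ∀ n, 0 ≤ e n) (h1 : ∀ n, e n ≤ n) (h : ∀ n : ℕ, e n ≤ A * (n : ℝ) ^ s + C) :
    poissonAvg r e ≤ A * r ^ s + C := by
  have hsum := (((hasSum_poissonWeight_mean r).mul_left (A * r ^ s * s / r)).add
    ((hasSum_poissonWeight r).mul_left (A * r ^ s * (1 - s) + C)))
  have hle := hasSum_le (fun n => ?_) (summable_poissonAvg hr.le h0 h1).hasSum hsum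
  · refine hle.trans (le_of_eq ?_)
    field_simp; ring
  · have hw := poissonWeight_nonneg hr.le n
    have hb : e n ≤ A * (r ^ s * (s * ((n : ℝ) / r) + (1 - s))) + C :=
      (h n).trans (by gcongr; exact rpow_le_tangent hs hs1 hr (Nat.cast_nonneg n))
    refine (mul_le_mul_of_nonneg_left hb hw).trans (le_of_eq ?_)
    ring

lemma poissonAvg_lower {r s A C ε : ℝ} (hr : 0 < r) (hs : 0 ≤ s) (hs1 : s ≤ 1) (hA : 0 ≤ A)
    (hε : 0 < ε) {e : ℕ → ℝ} (h0 : ∀ n, 0 ≤ e n) (h1 : ∀ n, e n ≤ n)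
    (h : ∀ n : ℕ, A * (n : ℝ) ^ s - C ≤ e n) :
    A * r ^ s * (1 - ε - 1 / (r * ε)) - C ≤ poissonAvg r e := by
  have hsum := (((hasSum_poissonWeight_sq r).mul_left (-(A * r ^ s) / (ε * r ^ 2))).add
    ((hasSum_poissonWeight_mean r).mul_left (2 * (A * r ^ s) / (ε * r)))).add
    ((hasSum_poissonWeight r).mul_left (A * r ^ s * (1 - ε - 1 / ε) - C))
  have hle := hasSum_le (fun n => ?_) hsum (summable_poissonAvg hr.le h0 h1).hasSum
  · refine le_trans (le_of_eq ?_) hle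
    field_simp; ring
  · have hw := poissonWeight_nonneg hr.le n
    have hb : A * (r ^ s * (1 - ε - ((n : ℝ) / r - 1) ^ 2 / ε)) - C ≤ e n :=
      le_trans (by gcongr; exact rpow_ge_parabola hs hs1 hr (Nat.cast_nonneg n) hε) (h n)
    refine le_trans (le_of_eq ?_) (mul_le_mul_of_nonneg_left hb hw)
    field_simp; ring

/-- Poissonization does not change the asymptotics of a sequence growing like `c n ^ s`. -/
lemma tendsto_poissonAvg {s c : ℝ} (hs : 0 < s) (hs1 : s ≤ 1) (hc : 0 < c) {e : ℕ → ℝ}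
    (h0 : ∀ n, 0 ≤ e n) (h1 : ∀ n, e n ≤ n)
    (he : Tendsto (fun n : ℕ => (n : ℝ) ^ (-s) * e n) atTop (𝓝 c)) :
    Tendsto (fun r => r ^ (-s) * poissonAvg r e) atTop (𝓝 c) := by
  have hbound : ∀ ε > 0, ∃ C, 0 ≤ C ∧ ∀ n : ℕ, e n ≤ (c + ε) * (n : ℝ) ^ s + C ∧
      (c - ε) * (n : ℝ) ^ s - C ≤ e n := by
    intro ε hε
    obtain ⟨N, hN⟩ := eventually_atTop.1 ((Metric.tendsto_nhds.1 he ε hε).and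
      (eventually_gt_atTop 0))
    refine ⟨N + |c - ε| * N ^ s, by positivity, fun n => ?_⟩
    rcases le_total N n with hn | hn
    · obtain ⟨hd, hpos⟩ := hN n hn
      rw [Real.dist_eq, abs_lt] at hd
      have hp : 0 < (n : ℝ) ^ s := Real.rpow_pos_of_pos (by exact_mod_cast hpos) s
      rw [Real.rpow_neg (Nat.cast_nonneg n)] at hd
      have e1 : e n = (n : ℝ) ^ s * (((n : ℝ) ^ s)⁻¹ * e n) := by field_simp
      have hC : 0 ≤ (N : ℝ) + |c - ε| * N ^ s := by positivity
      constructor <;> nlinarith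
    · have hnN : (n : ℝ) ≤ N := by exact_mod_cast hn
      have hpow : (n : ℝ) ^ s ≤ (N : ℝ) ^ s := Real.rpow_le_rpow (Nat.cast_nonneg n) hnN hs.le
      have hn0 : 0 ≤ (n : ℝ) ^ s := Real.rpow_nonneg (Nat.cast_nonneg n) s
      constructor
      · have := h1 n
        have : 0 ≤ (c + ε) * (n : ℝ) ^ s := by positivity
        have : 0 ≤ |c - ε| * (N : ℝ) ^ s := by positivity
        linarith
      · have := h0 n
        have h3 : (c - ε) * (n : ℝ) ^ s ≤ |c - ε| * (N : ℝ) ^ s :=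
          (mul_le_mul_of_nonneg_right (le_abs_self _) hn0).trans
            (mul_le_mul_of_nonneg_left hpow (abs_nonneg _))
        have := (Nat.cast_nonneg N : (0 : ℝ) ≤ N)
        linarith
  have hneg : Tendsto (fun r : ℝ => r ^ (-s)) atTop (𝓝 0) := tendsto_rpow_neg_atTop hs
  refine tendsto_order.2 ⟨fun a ha => ?_, fun a ha => ?_⟩
  · obtain ⟨ε, hε, hεc, hlt⟩ : ∃ ε > 0, ε < c ∧ a < (c - ε) * (1 - ε) := by
      have hcont : Tendsto (fun ε : ℝ => (c - ε) * (1 - ε)) (𝓝[>] 0) (𝓝 ((c - 0) * (1 - 0))) :=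
        Continuous.tendsto (f := fun ε : ℝ => (c - ε) * (1 - ε)) (by fun_prop) 0 |>.mono_left
          nhdsWithin_le_nhds
      have h1 := (tendsto_order.1 hcont).1 a (by simpa using ha)
      have h2 : ∀ᶠ ε : ℝ in 𝓝[>] 0, ε < c := mem_nhdsWithin_of_mem_nhds (Iio_mem_nhds hc)
      obtain ⟨ε, ⟨h1, h2⟩, h3⟩ := ((h1.and h2).and self_mem_nhdsWithin).exists
      exact ⟨ε, h3, h2, h1⟩
    obtain ⟨C, hC, hb⟩ := hbound ε hε
    have hlim : Tendsto (fun r : ℝ => (c - ε) * (1 - ε - 1 / (r * ε)) - r ^ (-s) * C) atTop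
        (𝓝 ((c - ε) * (1 - ε - 0) - 0 * C)) := by
      refine Tendsto.sub (Tendsto.const_mul _ (Tendsto.const_sub _ ?_)) (hneg.mul_const C)
      simp only [one_div]
      exact (tendsto_id.atTop_mul_const hε).inv_tendsto_atTop
    filter_upwards [(tendsto_order.1 hlim).1 a (by simpa using hlt),
      eventually_gt_atTop 0] with r hr hr0
    refine hr.trans_le ?_
    have hl := poissonAvg_lower hr0 hs.le hs1 (sub_nonneg.2 hεc.le) hε h0 h1 (fun n => (hb n).2)
    have hp : 0 < r ^ (-s) := Real.rpow_pos_of_pos hr0 _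
    refine le_trans (le_of_eq ?_) (mul_le_mul_of_nonneg_left hl hp.le)
    have : r ^ (-s) * r ^ s = 1 := by rw [← Real.rpow_add hr0]; simp
    linear_combination (-(c - ε) * (1 - ε - 1 / (r * ε))) * this
  · obtain ⟨ε, hε, hlt⟩ : ∃ ε > 0, c + ε < a := ⟨(a - c) / 2, by linarith, by linarith⟩
    obtain ⟨C, hC, hb⟩ := hbound ε hε
    have hlim : Tendsto (fun r : ℝ => (c + ε) + r ^ (-s) * C) atTop (𝓝 ((c + ε) + 0 * C)) :=
      (hneg.mul_const C).const_add _
    filter_upwards [(tendsto_order.1 hlim).2 a (by simpa using hlt),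
      eventually_gt_atTop 0] with r hr hr0
    refine lt_of_le_of_lt ?_ hr
    have hl := poissonAvg_upper hr0 hs.le hs1 (by positivity) h0 h1 (fun n => (hb n).1)
    have hp : 0 < r ^ (-s) := Real.rpow_pos_of_pos hr0 _
    refine (mul_le_mul_of_nonneg_left hl hp.le).trans (le_of_eq ?_)
    have : r ^ (-s) * r ^ s = 1 := by rw [← Real.rpow_add hr0]; simp
    linear_combination (c + ε) * this

/-- Rescaled form of `tendsto_poissonAvg` along multiples of `β`. -/
lemma tendsto_poissonAvg_nat_mul {s c β : ℝ} (hs : 0 < s) (hs1 : s ≤ 1) (hc : 0 < c) (hβ : 0 ≤ β)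
    {e : ℕ → ℝ} (h0 : ∀ n, 0 ≤ e n) (h1 : ∀ n, e n ≤ n)
    (he : Tendsto (fun n : ℕ => (n : ℝ) ^ (-s) * e n) atTop (𝓝 c)) :
    Tendsto (fun n : ℕ => (n : ℝ) ^ (-s) * poissonAvg (n * β) e) atTop (𝓝 (c * β ^ s)) := by
  rcases eq_or_lt_of_le hβ with rfl | hβ
  · have e0 : poissonAvg 0 e = 0 := by
      refine le_antisymm ?_ (poissonAvg_nonneg le_rfl h0)
      refine hasSum_le (fun n => ?_) (summable_poissonAvg le_rfl h0 h1).hasSum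
        (hasSum_poissonWeight_mean 0)
      exact mul_le_mul_of_nonneg_left (h1 n) (poissonWeight_nonneg le_rfl n)
    simp [e0, Real.zero_rpow hs.ne']
  · have h2 := (tendsto_poissonAvg hs hs1 hc h0 h1 he).comp
      ((tendsto_natCast_atTop_atTop (R := ℝ)).atTop_mul_const hβ)
    have h3 := h2.mul_const (β ^ s)
    refine h3.congr fun n => ?_
    simp only [Function.comp]
    rw [Real.mul_rpow (Nat.cast_nonneg n) hβ.le, Real.rpow_neg hβ.le]
    have := (Real.rpow_pos_of_pos hβ s).ne'
    field_simp

/-! ### A Poisson number of uniform points in the unit cube -/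

lemma measurableEmbedding_sigmaMk {ι : Type*} {α : ι → Type*} [∀ i, MeasurableSpace (α i)]
    (i : ι) : MeasurableEmbedding (Sigma.mk i : α i → Sigma α) := by
  refine ⟨sigma_mk_injective, fun s hs => ?_, fun s hs => ?_⟩
  · exact MeasurableSpace.measurableSet_iInf.1 hs i
  · refine MeasurableSpace.measurableSet_iInf.2 fun j => ?_
    change MeasurableSet (Sigma.mk j ⁻¹' (Sigma.mk i '' s))
    by_cases h : j = i
    · subst h
      rwa [preimage_image_eq _ sigma_mk_injective]
    · rw [preimage_image_sigmaMk_of_ne h]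
      exact MeasurableSet.empty

/-- The uniform distribution on the unit cube. -/
def uniformCube (d : ℕ) : Measure (Fin d → ℝ) := volume.restrict (Icc 0 1)

instance (d : ℕ) : IsProbabilityMeasure (uniformCube d) := by
  constructor
  rw [uniformCube, Measure.restrict_apply_univ, Real.volume_Icc_pi]
  simp

/-- The law of a Poisson number of mean `r` of uniform points in the unit cube. -/
def poissonized (d : ℕ) (r : ℝ) : Measure (Σ n : ℕ, Fin n → Fin d → ℝ) :=
  Measure.sum fun n => ENNReal.ofReal (poissonWeight r n) •
    (Measure.pi fun _ : Fin n => uniformCube d).map (Sigma.mk n)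

lemma tsum_ofReal_poissonWeight_mul {r s : ℝ} (hr : 0 ≤ r) {e : ℕ → ℝ} (he : ∀ n, 0 ≤ e n)
    (h : HasSum (fun n => poissonWeight r n * e n) s) :
    ∑' n, ENNReal.ofReal (poissonWeight r n) * ENNReal.ofReal (e n) = ENNReal.ofReal s := by
  rw [← h.tsum_eq, ENNReal.ofReal_tsum_of_nonneg
    (fun n => mul_nonneg (poissonWeight_nonneg hr n) (he n)) h.summable]
  exact tsum_congr fun n => (ENNReal.ofReal_mul (poissonWeight_nonneg hr n)).symm

lemma lintegral_poissonized {d : ℕ} {r : ℝ} (F : (Σ n : ℕ, Fin n → Fin d → ℝ) → ENNReal) :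
    ∫⁻ ω, F ω ∂poissonized d r = ∑' n, ENNReal.ofReal (poissonWeight r n) *
      ∫⁻ X, F ⟨n, X⟩ ∂(Measure.pi fun _ : Fin n => uniformCube d) := by
  rw [poissonized, lintegral_sum_measure]
  refine tsum_congr fun n => ?_
  rw [lintegral_smul_measure, (measurableEmbedding_sigmaMk n).lintegral_map, smul_eq_mul]

lemma ae_poissonized {d : ℕ} {r : ℝ} {p : (Σ n : ℕ, Fin n → Fin d → ℝ) → Prop}
    (h : ∀ n, ∀ᵐ X ∂(Measure.pi fun _ : Fin n => uniformCube d), p ⟨n, X⟩) :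
    ∀ᵐ ω ∂poissonized d r, p ω := by
  refine Measure.ae_sum_iff.2 fun n => Measure.ae_smul_measure ?_ _
  exact (measurableEmbedding_sigmaMk n).ae_map_iff.2 (h n)

lemma isProbabilityMeasure_poissonized (d : ℕ) {r : ℝ} (hr : 0 ≤ r) :
    IsProbabilityMeasure (poissonized d r) := by
  constructor
  rw [← lintegral_one, lintegral_poissonized]
  have h := tsum_ofReal_poissonWeight_mul hr (e := fun _ => 1) (fun _ => zero_le_one)
    (by simpa using hasSum_poissonWeight r)
  simpa using h

lemma ae_pi_injective (d n : ℕ) : ∀ᵐ X ∂(Measure.pi fun _ : Fin n => uniformCube d),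
    ∀ j, Set.InjOn (fun z : Fin d → ℝ => z j) (Set.range X) := by
  have key : ∀ i i' : Fin n, i ≠ i' → ∀ j : Fin d, ∀ᵐ X : Fin n → Fin d → ℝ, X i j ≠ X i' j := by
    intro i i' hi j
    let L : (Fin n → Fin d → ℝ) →ₗ[ℝ] ℝ :=
      (LinearMap.proj (φ := fun _ : Fin d => ℝ) j ∘ₗ
        LinearMap.proj (φ := fun _ : Fin n => Fin d → ℝ) i) -
      (LinearMap.proj (φ := fun _ : Fin d => ℝ) j ∘ₗ
        LinearMap.proj (φ := fun _ : Fin n => Fin d → ℝ) i')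
    have hne : LinearMap.ker L ≠ ⊤ := by
      intro htop
      have h1 : (Pi.single i (Pi.single j 1) : Fin n → Fin d → ℝ) ∈ LinearMap.ker L := by
        rw [htop]; trivial
      simp [L, hi.symm] at h1
    have h0 := Measure.addHaar_submodule (volume : Measure (Fin n → Fin d → ℝ)) _ hne
    refine measure_mono_null (fun X hX => ?_) h0
    simp only [mem_compl_iff, mem_ofPred_eq, not_not] at hX
    simpa [L, sub_eq_zero] using hX
  have hac : ∀ᵐ X ∂(Measure.pi fun _ : Fin n => uniformCube d), ∀ i i' : Fin n, i ≠ i' →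
      ∀ j : Fin d, X i j ≠ X i' j := by
    simp only [uniformCube]
    rw [← Measure.restrict_pi_pi]
    refine ae_restrict_of_ae ?_
    simp only [ae_all_iff]
    exact key
  filter_upwards [hac] with X hX j
  rintro _ ⟨i, rfl⟩ _ ⟨i', rfl⟩ h
  by_contra hne
  exact hX i i' (fun h => hne (by rw [h])) j h

lemma isVoidModel_poissonized (d : ℕ) {r : ℝ} (hr : 0 ≤ r) :
    IsVoidModel (poissonized d r) (ENNReal.ofReal r • uniformCube d)
      (fun ω => Set.range ω.2) := by
  have hset : ∀ (A : Set (Fin d → ℝ)) (n : ℕ),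
      {X : Fin n → Fin d → ℝ | Set.range X ∩ A = ∅} = Set.univ.pi fun _ => Aᶜ := by
    intro A n
    ext X
    simp [Set.eq_empty_iff_forall_notMem]
  have hmeas : ∀ A : Set (Fin d → ℝ), MeasurableSet A →
      MeasurableSet {ω : Σ n : ℕ, Fin n → Fin d → ℝ | Set.range ω.2 ∩ A = ∅} := by
    intro A hA
    refine MeasurableSpace.measurableSet_iInf.2 fun n => ?_
    change MeasurableSet {X : Fin n → Fin d → ℝ | Set.range X ∩ A = ∅}
    rw [hset]
    exact MeasurableSet.univ_pi fun _ => hA.compl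
  refine ⟨ae_poissonized fun n => ?_, Eventually.of_forall fun ω => Set.finite_range _,
    ae_poissonized fun n => ae_pi_injective d n, hmeas, fun A hA => ?_⟩
  · have : ∀ i : Fin n, ∀ᵐ X ∂(Measure.pi fun _ : Fin n => uniformCube d), X i ∈ Icc 0 1 := by
      intro i
      refine (Measure.quasiMeasurePreserving_eval _ i).ae ?_
      exact ae_restrict_mem measurableSet_Icc
    filter_upwards [ae_all_iff.2 this] with X hX
    rintro _ ⟨i, rfl⟩
    exact hX i
  · have hq0 : 0 ≤ 1 - (uniformCube d).real A := sub_nonneg.2 measureReal_le_one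
    have h1 : poissonized d r {ω | Set.range ω.2 ∩ A = ∅}
        = ENNReal.ofReal (Real.exp (-(r * (uniformCube d).real A))) := by
      rw [← lintegral_indicator_one (hmeas A hA), lintegral_poissonized,
        ← tsum_ofReal_poissonWeight_mul hr (fun n => pow_nonneg hq0 n)
          (by simpa using hasSum_poissonWeight_mul_pow r (1 - (uniformCube d).real A))]
      refine tsum_congr fun n => ?_
      congr 1
      have : (fun X : Fin n → Fin d → ℝ => {ω : Σ n : ℕ, Fin n → Fin d → ℝ |
          Set.range ω.2 ∩ A = ∅}.indicator (1 : (Σ n : ℕ, Fin n → Fin d → ℝ) → ENNReal) ⟨n, X⟩)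
          = {X : Fin n → Fin d → ℝ | Set.range X ∩ A = ∅}.indicator 1 := by
        funext X
        simp only [indicator, mem_ofPred_eq, Pi.one_apply]
      rw [this, hset, lintegral_indicator_one (MeasurableSet.univ_pi fun _ => hA.compl),
        Measure.pi_pi, Finset.prod_const, Finset.card_univ, Fintype.card_fin,
        ENNReal.ofReal_pow hq0, ← probReal_compl_eq_one_sub hA, ofReal_measureReal]
    rw [measureReal_def, h1, ENNReal.toReal_ofReal (Real.exp_nonneg _)]
    simp [measureReal_def, hr]

lemma aemeasurable_chainLength_range {d : ℕ} (hd : 0 < d) (n : ℕ) :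
    AEMeasurable (fun X : Fin n → Fin d → ℝ => (chainLength d (Set.range X) : ℝ))
      (Measure.pi fun _ => uniformCube d) := by
  have h := (isVoidModel_poissonized d (zero_le_one (α := ℝ))).aemeasurable_chainLength hd
  rw [poissonized, aemeasurable_sum_measure_iff] at h
  have h2 := (h n).smul_measure (ENNReal.ofReal (poissonWeight 1 n))⁻¹
  have hpos : 0 < poissonWeight 1 n := by unfold poissonWeight; positivity
  rw [smul_smul, ENNReal.inv_mul_cancel (by simpa using hpos) ENNReal.ofReal_ne_top, one_smul] at h2
  have h3 := (measurableEmbedding_sigmaMk n).aemeasurable_map_iff.1 h2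
  exact h3

lemma chainLength_range_le {d n : ℕ} (X : Fin n → Fin d → ℝ) :
    chainLength d (Set.range X) ≤ n := by
  refine (chainLength_le_ncard (Set.finite_range X)).trans ?_
  rw [← Set.image_univ]
  refine (Set.ncard_image_le Set.finite_univ).trans ?_
  simp

lemma integrable_chainLength_range {d : ℕ} (hd : 0 < d) (n : ℕ) :
    Integrable (fun X : Fin n → Fin d → ℝ => (chainLength d (Set.range X) : ℝ))
      (Measure.pi fun _ => uniformCube d) := by
  refine Integrable.of_bound (aemeasurable_chainLength_range hd n).aestronglyMeasurable n ?_
  refine Eventually.of_forall fun X => ?_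
  rw [Real.norm_of_nonneg (Nat.cast_nonneg _)]
  exact_mod_cast chainLength_range_le X

lemma BWexpect_nonneg (d n : ℕ) : 0 ≤ BWexpect d n :=
  integral_nonneg fun _ => Nat.cast_nonneg _

lemma BWexpect_le {d : ℕ} (hd : 0 < d) (n : ℕ) : BWexpect d n ≤ n := by
  have h := integral_mono (integrable_chainLength_range hd n) (integrable_const (n : ℝ))
    (fun X => Nat.cast_le.2 (chainLength_range_le X))
  rw [integral_const, probReal_univ, one_smul] at h
  exact h

lemma lintegral_chainLength_poissonized {d : ℕ} (hd : 0 < d) {r : ℝ} (hr : 0 ≤ r) :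
    ∫⁻ ω, ENNReal.ofReal (chainLength d (Set.range ω.2)) ∂poissonized d r
      = ENNReal.ofReal (poissonAvg r (BWexpect d)) := by
  rw [lintegral_poissonized, poissonAvg, ← tsum_ofReal_poissonWeight_mul hr (BWexpect_nonneg d)
    (summable_poissonAvg hr (BWexpect_nonneg d) (BWexpect_le hd)).hasSum]
  refine tsum_congr fun n => ?_
  congr 1
  exact (ofReal_integral_eq_lintegral_ofReal (integrable_chainLength_range hd n)
    (Eventually.of_forall fun _ => Nat.cast_nonneg _)).symm

/-! ### Poisson point processes in boxes -/

lemma MemB.exists_bound {d : ℕ} {f : (Fin d → ℝ) → ℝ} (hf : MemB d f) {K : Set (Fin d → ℝ)}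
    (hK : IsCompact K) : ∃ b, 0 ≤ b ∧ ∀ z ∈ K, f z ≤ b := by
  have h : BddAbove (f '' K) := by
    refine hK.induction_on (p := fun s => BddAbove (f '' s)) (by simp)
      (fun s t hst ht => ht.mono (image_mono hst))
      (fun s t hs ht => by rw [image_union]; exact hs.union ht) fun x _ => ?_
    obtain ⟨U, hU, hb⟩ := hf.2.2 x
    exact ⟨U, mem_nhdsWithin_of_mem_nhds hU, hb⟩
  obtain ⟨b, hb⟩ := h
  exact ⟨max b 0, le_max_right _ _, fun z hz =>
    (hb (mem_image_of_mem f hz)).trans (le_max_left _ _)⟩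

lemma MemB.const_mul {d : ℕ} {f : (Fin d → ℝ) → ℝ} (hf : MemB d f) {a : ℝ} (ha : 0 ≤ a) :
    MemB d fun x => a * f x := by
  refine ⟨hf.1.const_mul a, fun x => mul_nonneg ha (hf.2.1 x), fun x => ?_⟩
  obtain ⟨U, hU, b, hb⟩ := hf.2.2 x
  refine ⟨U, hU, a * b, ?_⟩
  rintro _ ⟨z, hz, rfl⟩
  exact mul_le_mul_of_nonneg_left (hb (mem_image_of_mem f hz)) ha

lemma MemB.integrableOn {d : ℕ} {f : (Fin d → ℝ) → ℝ} (hf : MemB d f) {A : Set (Fin d → ℝ)}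
    (hA : Bornology.IsBounded A) : IntegrableOn f A := by
  obtain ⟨b, -, hb⟩ := hf.exists_bound hA.isCompact_closure
  refine IntegrableOn.mono_set ?_ (subset_closure (s := A))
  refine IntegrableOn.of_bound hA.isCompact_closure.measure_lt_top
    hf.1.aestronglyMeasurable b ?_
  filter_upwards [ae_restrict_mem isClosed_closure.measurableSet] with z hz
  rw [Real.norm_of_nonneg (hf.2.1 z)]
  exact hb z hz

/-- The volume of the box `[y, x]`. -/
def boxVol {d : ℕ} (y x : Fin d → ℝ) : ℝ := ∏ i, (x i - y i)

lemma boxVol_nonneg {d : ℕ} {y x : Fin d → ℝ} (h : y ≤ x) : 0 ≤ boxVol y x :=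
  Finset.prod_nonneg fun i _ => sub_nonneg.2 (h i)

lemma volume_real_Icc_eq_boxVol {d : ℕ} {y x : Fin d → ℝ} (h : y ≤ x) :
    volume.real (Icc y x) = boxVol y x := Real.volume_Icc_pi_toReal h

namespace PoissonPP

variable {d : ℕ} {Ω : Type*} [MeasurableSpace Ω] {P : Measure Ω}
  {g : (Fin d → ℝ) → ℝ}

lemma measurableSet_void (Q : PoissonPP d P g) {A : Set (Fin d → ℝ)} (hA : MeasurableSet A)
    (hb : Bornology.IsBounded A) : MeasurableSet {ω | Q.pts ω ∩ A = ∅} := by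
  simpa using Q.measur A hA hb 0

lemma measure_void (Q : PoissonPP d P g) {A : Set (Fin d → ℝ)} (hA : MeasurableSet A)
    (hb : Bornology.IsBounded A) :
    P {ω | Q.pts ω ∩ A = ∅} = ENNReal.ofReal (Real.exp (-∫ x in A, g x)) := by
  simpa using Q.poisson A hA hb 0

variable [IsProbabilityMeasure P]

lemma ae_finite (Q : PoissonPP d P g) (hg : ∀ x, 0 ≤ g x) {A : Set (Fin d → ℝ)}
    (hA : MeasurableSet A) (hb : Bornology.IsBounded A) : ∀ᵐ ω ∂P, (Q.pts ω ∩ A).Finite := by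
  have hl : 0 ≤ ∫ x in A, g x := integral_nonneg hg
  have h1 : P (⋃ k : ℕ, {ω | (Q.pts ω ∩ A).encard = k}) = 1 := by
    rw [measure_iUnion ?_ (Q.measur A hA hb)]
    · simp only [Q.poisson A hA hb]
      have h := tsum_ofReal_poissonWeight_mul hl (e := fun _ => 1) (fun _ => zero_le_one)
        (by simpa using hasSum_poissonWeight _)
      simpa [poissonWeight] using h
    · intro i j hij
      refine Set.disjoint_left.2 fun ω hi hj => hij ?_
      have : (i : ℕ∞) = j := hi.symm.trans hj
      exact_mod_cast this
  have h2 := (prob_compl_eq_zero_iff (MeasurableSet.iUnion (Q.measur A hA hb))).2 h1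
  refine measure_mono_null (fun ω hω => ?_) h2
  simp only [mem_compl_iff, mem_iUnion, mem_ofPred_eq, not_exists] at hω ⊢
  intro k hk
  exact hω (Set.finite_of_encard_eq_coe hk)

lemma measure_two_le (Q : PoissonPP d P g) (hg : ∀ x, 0 ≤ g x) {A : Set (Fin d → ℝ)}
    (hA : MeasurableSet A) (hb : Bornology.IsBounded A) :
    P {ω | ¬ (Q.pts ω ∩ A).Subsingleton} ≤ ENNReal.ofReal ((∫ x in A, g x) ^ 2) := by
  set l := ∫ x in A, g x with hl
  have hl0 : 0 ≤ l := integral_nonneg hg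
  have hset : {ω | ¬ (Q.pts ω ∩ A).Subsingleton}
      = ({ω | (Q.pts ω ∩ A).encard = (0 : ℕ)} ∪ {ω | (Q.pts ω ∩ A).encard = (1 : ℕ)})ᶜ := by
    ext ω
    simp only [mem_ofPred_eq, mem_compl_iff, mem_union, not_iff_not,
      ← Set.encard_le_one_iff_subsingleton, Nat.cast_zero, Nat.cast_one]
    rw [le_iff_lt_or_eq, Order.lt_one_iff]
  have hmeas := (Q.measur A hA hb 0).union (Q.measur A hA hb 1)
  rw [hset, prob_compl_eq_one_sub hmeas, measure_union ?_ (Q.measur A hA hb 1),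
    Q.poisson A hA hb, Q.poisson A hA hb, ← hl]
  · simp only [pow_zero, Nat.factorial_zero, pow_one, Nat.factorial_one, Nat.cast_one, div_one,
      mul_one]
    rw [← ENNReal.ofReal_add (Real.exp_nonneg _) (by positivity), ← ENNReal.ofReal_one,
      ← ENNReal.ofReal_sub _ (by positivity)]
    refine ENNReal.ofReal_le_ofReal ?_
    have := Real.add_one_le_exp (-l)
    nlinarith
  · refine Set.disjoint_left.2 fun ω hi hj => ?_
    have : ((0 : ℕ) : ℕ∞) = (1 : ℕ) := hi.symm.trans hj
    simp at this

/-- Almost surely, points of the process in a box have pairwise distinct coordinates. -/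
lemma ae_injOn (Q : PoissonPP d P g) (hg : MemB d g) {y x : Fin d → ℝ} (hyx : ∀ i, y i < x i) :
    ∀ᵐ ω ∂P, ∀ j, Set.InjOn (fun z : Fin d → ℝ => z j) (Q.pts ω ∩ Icc y x) := by
  rw [ae_all_iff]
  intro j
  obtain ⟨b, hb0, hb⟩ := hg.exists_bound (isCompact_Icc (a := y) (b := x))
  have hw : 0 < x j - y j := sub_pos.2 (hyx j)
  set V := boxVol y x with hV
  let lo : ℕ → ℕ → ℝ := fun K k => y j + (x j - y j) * k / K
  let S : ℕ → ℕ → Set (Fin d → ℝ) := fun K k =>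
    Icc (Function.update y j (lo K k)) (Function.update x j (lo K (k + 1)))
  have hSsub : ∀ K k, k < K → S K k ⊆ Icc y x := by
    intro K k hk z hz
    have hK : (0 : ℝ) < K := by exact_mod_cast (Nat.zero_le k).trans_lt hk
    have h1 : y j ≤ lo K k := by
      have : 0 ≤ (x j - y j) * k / K := by positivity
      simp only [lo]
      linarith
    have h2 : lo K (k + 1) ≤ x j := by
      simp only [lo]
      have : (x j - y j) * ((k + 1 : ℕ) : ℝ) / K ≤ x j - y j := by
        rw [div_le_iff₀ hK]
        exact mul_le_mul_of_nonneg_left (by exact_mod_cast hk) hw.le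
      linarith
    refine ⟨le_trans ?_ hz.1, hz.2.trans ?_⟩
    · exact le_update_iff.2 ⟨h1, fun _ _ => le_rfl⟩
    · exact update_le_iff.2 ⟨h2, fun _ _ => le_rfl⟩
  have hinteg : ∀ K k, k < K → ∫ z in S K k, g z ≤ b * V / K := by
    intro K k hk
    have hK : (0 : ℝ) < K := by exact_mod_cast (Nat.zero_le k).trans_lt hk
    have hlo : lo K (k + 1) - lo K k = (x j - y j) / K := by
      simp only [lo]; push_cast; field_simp; ring
    have hle : Function.update y j (lo K k) ≤ Function.update x j (lo K (k + 1)) := by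
      intro i
      rcases eq_or_ne i j with rfl | hij
      · simp only [Function.update_self]
        have : 0 ≤ (x i - y i) / K := by positivity
        linarith
      · simpa [hij] using (hyx i).le
    have hvol : volume.real (S K k) = V / K := by
      rw [volume_real_Icc_eq_boxVol hle, boxVol]
      have : (fun i => Function.update x j (lo K (k + 1)) i - Function.update y j (lo K k) i)
          = Function.update (fun i => x i - y i) j ((x j - y j) / K) := by
        funext i
        rcases eq_or_ne i j with rfl | hij
        · simp [hlo]
        · simp [hij]
      rw [show ∏ i, (Function.update x j (lo K (k + 1)) i - Function.update y j (lo K k) i)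
        = ∏ i, Function.update (fun i => x i - y i) j ((x j - y j) / K) i from
        Finset.prod_congr rfl fun i _ => congrFun this i,
        Finset.prod_update_of_mem (Finset.mem_univ j), hV, boxVol,
        ← Finset.mul_prod_erase _ _ (Finset.mem_univ j), Finset.sdiff_singleton_eq_erase]
      ring
    have hbd : Bornology.IsBounded (S K k) := isCompact_Icc.isBounded
    calc ∫ z in S K k, g z ≤ ∫ z in S K k, b := by
          refine setIntegral_mono_on (hg.integrableOn hbd) ?_ measurableSet_Icc
            fun z hz => hb z (hSsub K k hk hz)
          exact integrableOn_const isCompact_Icc.measure_lt_top.ne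
      _ = b * V / K := by
          rw [setIntegral_const, hvol, smul_eq_mul]; ring
  have hbound : ∀ K : ℕ, 0 < K → P {ω | ¬ Set.InjOn (fun z : Fin d → ℝ => z j)
      (Q.pts ω ∩ Icc y x)} ≤ ENNReal.ofReal ((b * V) ^ 2 / K) := by
    intro K hK
    have hKr : (0 : ℝ) < K := by exact_mod_cast hK
    have hsub : {ω | ¬ Set.InjOn (fun z : Fin d → ℝ => z j) (Q.pts ω ∩ Icc y x)}
        ⊆ ⋃ k ∈ Finset.range K, {ω | ¬ (Q.pts ω ∩ S K k).Subsingleton} := by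
      intro ω hω
      simp only [mem_ofPred_eq, Set.InjOn, not_forall] at hω
      obtain ⟨z, hz, z', hz', heq, hne⟩ := hω
      obtain ⟨k, hk, h1, h2⟩ : ∃ k < K, lo K k ≤ z j ∧ z j ≤ lo K (k + 1) := by
        set t := (z j - y j) / (x j - y j) * K with ht
        have ht0 : 0 ≤ t := by
          have := hz.2.1 j
          have : 0 ≤ z j - y j := sub_nonneg.2 this
          positivity
        have htK : t ≤ K := by
          have h3 : (z j - y j) / (x j - y j) ≤ 1 := by
            rw [div_le_one hw]; linarith [hz.2.2 j]
          rw [ht]; nlinarith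
        have hzt : z j = y j + (x j - y j) * t / K := by rw [ht]; field_simp; ring
        refine ⟨min ⌊t⌋₊ (K - 1), by omega, ?_, ?_⟩
        · rw [hzt]
          have : ((min ⌊t⌋₊ (K - 1) : ℕ) : ℝ) ≤ t :=
            le_trans (by exact_mod_cast min_le_left _ _) (Nat.floor_le ht0)
          simp only [lo]; gcongr
        · rw [hzt]
          have : t ≤ ((min ⌊t⌋₊ (K - 1) + 1 : ℕ) : ℝ) := by
            rcases le_total ⌊t⌋₊ (K - 1) with h | h
            · rw [min_eq_left h]; push_cast; exact (Nat.lt_floor_add_one t).le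
            · rw [min_eq_right h, Nat.sub_add_cancel hK]; exact htK
          simp only [lo]; gcongr
      have hmem : ∀ w ∈ Q.pts ω ∩ Icc y x, w j = z j → w ∈ Q.pts ω ∩ S K k := by
        intro w hw' hwz
        refine ⟨hw'.1, ?_, ?_⟩
        · exact update_le_iff.2 ⟨by rw [hwz]; exact h1, fun i _ => hw'.2.1 i⟩
        · exact le_update_iff.2 ⟨by rw [hwz]; exact h2, fun i _ => hw'.2.2 i⟩
      simp only [mem_iUnion, Finset.mem_range]
      exact ⟨k, hk, fun hs => hne (hs (hmem z hz rfl) (hmem z' hz' heq.symm))⟩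
    refine (measure_mono hsub).trans ((measure_biUnion_finset_le _ _).trans ?_)
    calc ∑ k ∈ Finset.range K, P {ω | ¬ (Q.pts ω ∩ S K k).Subsingleton}
        ≤ ∑ k ∈ Finset.range K, ENNReal.ofReal ((b * V / K) ^ 2) := by
          refine Finset.sum_le_sum fun k hk => ?_
          refine (Q.measure_two_le hg.2.1 measurableSet_Icc isCompact_Icc.isBounded).trans ?_
          refine ENNReal.ofReal_le_ofReal (pow_le_pow_left₀ (integral_nonneg hg.2.1)
            (hinteg K k (Finset.mem_range.1 hk)) 2)
      _ = ENNReal.ofReal ((b * V) ^ 2 / K) := by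
          rw [Finset.sum_const, Finset.card_range, nsmul_eq_mul, ← ENNReal.ofReal_natCast K,
            ← ENNReal.ofReal_mul hKr.le]
          congr 1
          field_simp
  have hlim : Tendsto (fun K : ℕ => ENNReal.ofReal ((b * V) ^ 2 / K)) atTop (𝓝 0) := by
    rw [← ENNReal.ofReal_zero]
    exact (ENNReal.continuous_ofReal.tendsto 0).comp (tendsto_const_div_atTop_nhds_zero_nat _)
  refine le_antisymm (ge_of_tendsto hlim ?_) bot_le
  filter_upwards [eventually_gt_atTop 0] with K hK using hbound K hK

end PoissonPP

/-- The affine map sending the box `[y, x]` onto the unit cube. -/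
def boxScale {d : ℕ} (y x z : Fin d → ℝ) : Fin d → ℝ := fun i => (z i - y i) / (x i - y i)

lemma measurable_boxScale {d : ℕ} (y x : Fin d → ℝ) : Measurable (boxScale y x) := by
  unfold boxScale; fun_prop

lemma boxScale_le_iff {d : ℕ} {y x : Fin d → ℝ} (h : ∀ i, y i < x i) (z w : Fin d → ℝ) :
    boxScale y x z ≤ boxScale y x w ↔ z ≤ w := by
  simp only [Pi.le_def, boxScale]
  refine forall_congr' fun i => ?_
  rw [div_le_div_iff_of_pos_right (sub_pos.2 (h i)), sub_le_sub_iff_right]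

lemma volume_boxScale_preimage {d : ℕ} {y x : Fin d → ℝ} (h : ∀ i, y i < x i)
    (A : Set (Fin d → ℝ)) :
    volume (boxScale y x ⁻¹' A ∩ Icc y x) = ENNReal.ofReal (boxVol y x) * volume (A ∩ Icc 0 1) := by
  let L : (Fin d → ℝ) →ₗ[ℝ] (Fin d → ℝ) := Matrix.toLin' (Matrix.diagonal fun i => x i - y i)
  have hL : ∀ w i, L w i = (x i - y i) * w i := by
    intro w i
    simp [L, Matrix.mulVec_diagonal]
  have hset : boxScale y x ⁻¹' A ∩ Icc y x = (fun w => -y + w) ⁻¹' (L '' (A ∩ Icc 0 1)) := by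
    ext z
    simp only [mem_inter_iff, mem_preimage, mem_image]
    constructor
    · rintro ⟨hA, hz⟩
      refine ⟨boxScale y x z, ⟨hA, ?_, ?_⟩, ?_⟩
      · intro i
        exact div_nonneg (sub_nonneg.2 (hz.1 i)) (sub_pos.2 (h i)).le
      · intro i
        exact (div_le_one (sub_pos.2 (h i))).2 (by linarith [hz.2 i])
      · funext i
        rw [hL, boxScale, mul_div_cancel₀ _ (sub_pos.2 (h i)).ne']
        simp only [Pi.add_apply, Pi.neg_apply]; ring
    · rintro ⟨w, ⟨hA, hw⟩, hwz⟩
      have hz : ∀ i, z i = y i + (x i - y i) * w i := by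
        intro i
        have := congrFun hwz i
        rw [hL] at this
        simp only [Pi.add_apply, Pi.neg_apply] at this
        linarith
      have hs : boxScale y x z = w := by
        funext i
        have := (sub_pos.2 (h i)).ne'
        rw [boxScale, hz]
        field_simp
        ring
      refine ⟨hs ▸ hA, fun i => ?_, fun i => ?_⟩
      · rw [hz]
        have : 0 ≤ (x i - y i) * w i := mul_nonneg (sub_pos.2 (h i)).le (hw.1 i)
        linarith
      · rw [hz]
        have := mul_le_mul_of_nonneg_left (hw.2 i) (sub_pos.2 (h i)).le
        simp only [Pi.one_apply] at this
        linarith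
  rw [hset, measure_preimage_add, Measure.addHaar_image_linearMap, LinearMap.det_toLin',
    Matrix.det_diagonal, abs_of_nonneg (Finset.prod_nonneg fun i _ => (sub_pos.2 (h i)).le), boxVol]

/-- The intensity measure of a process in the box `[y, x]`, transported to the unit cube. -/
def boxIntensity {d : ℕ} (g : (Fin d → ℝ) → ℝ) (y x : Fin d → ℝ) : Measure (Fin d → ℝ) :=
  ((volume.withDensity fun z => ENNReal.ofReal (g z)).restrict (Icc y x)).map (boxScale y x)

section boxIntensity

variable {d : ℕ} {g : (Fin d → ℝ) → ℝ} {y x : Fin d → ℝ}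

lemma boxIntensity_apply {A : Set (Fin d → ℝ)} (hA : MeasurableSet A) :
    boxIntensity g y x A = ∫⁻ z in boxScale y x ⁻¹' A ∩ Icc y x, ENNReal.ofReal (g z) := by
  have hm := measurable_boxScale y x hA
  rw [boxIntensity, Measure.map_apply (measurable_boxScale y x) hA, Measure.restrict_apply hm,
    withDensity_apply _ (hm.inter measurableSet_Icc)]

lemma boxIntensity_eq_ofReal (hg : MemB d g) {A : Set (Fin d → ℝ)} (hA : MeasurableSet A) :
    boxIntensity g y x A = ENNReal.ofReal (∫ z in boxScale y x ⁻¹' A ∩ Icc y x, g z) := by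
  rw [boxIntensity_apply hA, ofReal_integral_eq_lintegral_ofReal
    (hg.integrableOn (isCompact_Icc.isBounded.subset inter_subset_right))
    (Eventually.of_forall hg.2.1)]

lemma isFiniteMeasure_boxIntensity (hg : MemB d g) : IsFiniteMeasure (boxIntensity g y x) := by
  constructor
  rw [boxIntensity_eq_ofReal hg MeasurableSet.univ]
  exact ENNReal.ofReal_lt_top

lemma boxIntensity_le {b : ℝ} (hb : 0 ≤ b) (h : ∀ i, y i < x i) (hgb : ∀ z ∈ Icc y x, g z ≤ b) :
    boxIntensity g y x ≤ ENNReal.ofReal (b * boxVol y x) • uniformCube d := by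
  refine Measure.le_iff.2 fun A hA => ?_
  have hm := (measurable_boxScale y x hA).inter (measurableSet_Icc (a := y) (b := x))
  rw [boxIntensity_apply hA]
  calc ∫⁻ z in boxScale y x ⁻¹' A ∩ Icc y x, ENNReal.ofReal (g z)
      ≤ ∫⁻ z in boxScale y x ⁻¹' A ∩ Icc y x, ENNReal.ofReal b :=
        setLIntegral_mono measurable_const fun z hz => ENNReal.ofReal_le_ofReal (hgb z hz.2)
    _ = _ := by
        rw [setLIntegral_const, volume_boxScale_preimage h, Measure.smul_apply, uniformCube,
          Measure.restrict_apply hA, smul_eq_mul, ENNReal.ofReal_mul hb, mul_assoc]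

lemma le_boxIntensity {a : ℝ} (ha : 0 ≤ a) (h : ∀ i, y i < x i) (hga : ∀ z ∈ Icc y x, a ≤ g z) :
    ENNReal.ofReal (a * boxVol y x) • uniformCube d ≤ boxIntensity g y x := by
  refine Measure.le_iff.2 fun A hA => ?_
  have hm := (measurable_boxScale y x hA).inter (measurableSet_Icc (a := y) (b := x))
  rw [boxIntensity_apply hA]
  calc _ = ∫⁻ z in boxScale y x ⁻¹' A ∩ Icc y x, ENNReal.ofReal a := by
        rw [setLIntegral_const, volume_boxScale_preimage h, Measure.smul_apply, uniformCube,
          Measure.restrict_apply hA, smul_eq_mul, ENNReal.ofReal_mul ha, mul_assoc]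
    _ ≤ _ := setLIntegral_mono' hm fun z hz => ENNReal.ofReal_le_ofReal (hga z hz.2)

end boxIntensity

namespace PoissonPP

variable {d : ℕ} {Ω : Type*} [MeasurableSpace Ω] {P : Measure Ω}
  {g : (Fin d → ℝ) → ℝ} {y x : Fin d → ℝ}

/-- The length of a longest chain of points of the process in the box `[y, x]`. -/
def boxLength (Q : PoissonPP d P g) (y x : Fin d → ℝ) (ω : Ω) : ℝ :=
  chainLength d (Q.pts ω ∩ Icc y x)

/-- The expectation of the length of a longest chain in the box `[y, x]`. -/
def boxMean (Q : PoissonPP d P g) (y x : Fin d → ℝ) : ℝ := ∫ ω, Q.boxLength y x ω ∂P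

lemma boxLength_nonneg (Q : PoissonPP d P g) (y x : Fin d → ℝ) (ω : Ω) : 0 ≤ Q.boxLength y x ω :=
  Nat.cast_nonneg _

lemma boxMean_nonneg (Q : PoissonPP d P g) (y x : Fin d → ℝ) : 0 ≤ Q.boxMean y x :=
  integral_nonneg fun _ => Q.boxLength_nonneg y x _

variable [IsProbabilityMeasure P]

lemma isVoidModel (Q : PoissonPP d P g) (hg : MemB d g) (h : ∀ i, y i < x i) :
    IsVoidModel P (boxIntensity g y x) fun ω => boxScale y x '' (Q.pts ω ∩ Icc y x) := by
  have hset : ∀ A, {ω | boxScale y x '' (Q.pts ω ∩ Icc y x) ∩ A = ∅}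
      = {ω | Q.pts ω ∩ (boxScale y x ⁻¹' A ∩ Icc y x) = ∅} := by
    intro A
    ext ω
    simp only [mem_ofPred_eq, ← Set.disjoint_iff_inter_eq_empty, Set.disjoint_left,
      forall_mem_image, mem_inter_iff, mem_preimage]
    exact ⟨fun h z hz h2 => h ⟨hz, h2.2⟩ h2.1, fun h z hz h2 => h hz.1 ⟨h2, hz.2⟩⟩
  have hmeas : ∀ A, MeasurableSet A → MeasurableSet (boxScale y x ⁻¹' A ∩ Icc y x) := fun A hA =>
    (measurable_boxScale y x hA).inter measurableSet_Icc
  have hbd : ∀ A, Bornology.IsBounded (boxScale y x ⁻¹' A ∩ Icc y x) := fun A =>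
    isCompact_Icc.isBounded.subset inter_subset_right
  refine ⟨Eventually.of_forall fun ω => ?_, ?_, ?_, fun A hA => ?_, fun A hA => ?_⟩
  · rintro _ ⟨z, hz, rfl⟩
    refine ⟨fun i => ?_, fun i => ?_⟩
    · exact div_nonneg (sub_nonneg.2 (hz.2.1 i)) (sub_pos.2 (h i)).le
    · exact (div_le_one (sub_pos.2 (h i))).2 (by linarith [hz.2.2 i])
  · filter_upwards [Q.ae_finite hg.2.1 measurableSet_Icc isCompact_Icc.isBounded] with ω hω
    exact hω.image _
  · filter_upwards [Q.ae_injOn hg h] with ω hω j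
    rintro _ ⟨z, hz, rfl⟩ _ ⟨w, hw, rfl⟩ hzw
    have : z j = w j := by
      simp only [boxScale] at hzw
      rw [div_left_inj' (sub_pos.2 (h j)).ne'] at hzw
      linarith
    rw [hω j hz hw this]
  · rw [hset]
    exact Q.measurableSet_void (hmeas A hA) (hbd A)
  · rw [hset, measureReal_def, Q.measure_void (hmeas A hA) (hbd A), measureReal_def,
      boxIntensity_eq_ofReal hg hA, ENNReal.toReal_ofReal (Real.exp_nonneg _),
      ENNReal.toReal_ofReal (integral_nonneg hg.2.1)]

lemma boxLength_ae_eq (Q : PoissonPP d P g) (hg : MemB d g) (h : ∀ i, y i < x i) :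
    (fun ω => (chainLength d (boxScale y x '' (Q.pts ω ∩ Icc y x)) : ℝ)) =ᵐ[P] Q.boxLength y x := by
  filter_upwards [Q.ae_finite hg.2.1 measurableSet_Icc isCompact_Icc.isBounded] with ω hω
  rw [chainLength_image hω (boxScale_le_iff h), boxLength]

lemma boxLength_ae_eq_zero (Q : PoissonPP d P g) (h : ∃ i, x i ≤ y i) :
    Q.boxLength y x =ᵐ[P] 0 := by
  obtain ⟨i, hi⟩ := h
  have hvol : volume (Icc y x) = 0 := by
    rw [Real.volume_Icc_pi, Finset.prod_eq_zero (Finset.mem_univ i)]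
    rw [ENNReal.ofReal_eq_zero]; linarith
  have h1 : P {ω | Q.pts ω ∩ Icc y x = ∅} = 1 := by
    rw [Q.measure_void measurableSet_Icc isCompact_Icc.isBounded, setIntegral_measure_zero _ hvol]
    simp
  have h2 := (prob_compl_eq_zero_iff
    (Q.measurableSet_void measurableSet_Icc isCompact_Icc.isBounded)).2 h1
  have h3 : ∀ᵐ ω ∂P, Q.pts ω ∩ Icc y x = ∅ := h2
  filter_upwards [h3] with ω hω
  simp [boxLength, hω]

lemma lintegral_boxLength_le (Q : PoissonPP d P g) (hd : 0 < d) (hg : MemB d g)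
    (h : ∀ i, y i < x i) {b : ℝ} (hb : 0 ≤ b) (hgb : ∀ z ∈ Icc y x, g z ≤ b) :
    ∫⁻ ω, ENNReal.ofReal (Q.boxLength y x ω) ∂P
      ≤ ENNReal.ofReal (poissonAvg (b * boxVol y x) (BWexpect d)) := by
  have hV : 0 ≤ b * boxVol y x := mul_nonneg hb (boxVol_nonneg fun i => (h i).le)
  have := isFiniteMeasure_boxIntensity (y := y) (x := x) hg
  have := isProbabilityMeasure_poissonized d hV
  have : IsFiniteMeasure (ENNReal.ofReal (b * boxVol y x) • uniformCube d) :=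
    Measure.smul_finite _ ENNReal.ofReal_ne_top
  rw [← lintegral_chainLength_poissonized hd hV]
  refine le_trans (le_of_eq (lintegral_congr_ae ?_))
    ((Q.isVoidModel hg h).lintegral_chainLength_mono hd
    (isVoidModel_poissonized d hV) (boxIntensity_le hb h hgb))
  filter_upwards [Q.boxLength_ae_eq hg h] with ω hω
  rw [hω]

lemma le_lintegral_boxLength (Q : PoissonPP d P g) (hd : 0 < d) (hg : MemB d g)
    (h : ∀ i, y i < x i) {a : ℝ} (ha : 0 ≤ a) (hga : ∀ z ∈ Icc y x, a ≤ g z) :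
    ENNReal.ofReal (poissonAvg (a * boxVol y x) (BWexpect d))
      ≤ ∫⁻ ω, ENNReal.ofReal (Q.boxLength y x ω) ∂P := by
  have hV : 0 ≤ a * boxVol y x := mul_nonneg ha (boxVol_nonneg fun i => (h i).le)
  have := isFiniteMeasure_boxIntensity (y := y) (x := x) hg
  have := isProbabilityMeasure_poissonized d hV
  have : IsFiniteMeasure (ENNReal.ofReal (a * boxVol y x) • uniformCube d) :=
    Measure.smul_finite _ ENNReal.ofReal_ne_top
  rw [← lintegral_chainLength_poissonized hd hV]
  refine ((isVoidModel_poissonized d hV).lintegral_chainLength_mono hd (Q.isVoidModel hg h)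
    (le_boxIntensity ha h hga)).trans (le_of_eq (lintegral_congr_ae ?_))
  filter_upwards [Q.boxLength_ae_eq hg h] with ω hω
  rw [hω]

lemma aemeasurable_boxLength (Q : PoissonPP d P g) (hd : 0 < d) (hg : MemB d g)
    (y x : Fin d → ℝ) : AEMeasurable (Q.boxLength y x) P := by
  by_cases h : ∀ i, y i < x i
  · exact ((Q.isVoidModel hg h).aemeasurable_chainLength hd).congr (Q.boxLength_ae_eq hg h)
  · push Not at h
    exact aemeasurable_zero.congr (Q.boxLength_ae_eq_zero h).symm

lemma integrable_boxLength (Q : PoissonPP d P g) (hd : 0 < d) (hg : MemB d g)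
    (y x : Fin d → ℝ) : Integrable (Q.boxLength y x) P := by
  by_cases h : ∀ i, y i < x i
  · refine ⟨(Q.aemeasurable_boxLength hd hg y x).aestronglyMeasurable, ?_⟩
    obtain ⟨b, hb, hgb⟩ := hg.exists_bound (isCompact_Icc (a := y) (b := x))
    rw [hasFiniteIntegral_iff_ofReal (Eventually.of_forall (Q.boxLength_nonneg y x))]
    exact (Q.lintegral_boxLength_le hd hg h hb hgb).trans_lt ENNReal.ofReal_lt_top
  · push Not at h
    exact (integrable_zero _ _ _).congr (Q.boxLength_ae_eq_zero h).symm

lemma ofReal_boxMean (Q : PoissonPP d P g) (hd : 0 < d) (hg : MemB d g) (y x : Fin d → ℝ) :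
    ENNReal.ofReal (Q.boxMean y x) = ∫⁻ ω, ENNReal.ofReal (Q.boxLength y x ω) ∂P :=
  ofReal_integral_eq_lintegral_ofReal (Q.integrable_boxLength hd hg y x)
    (Eventually.of_forall (Q.boxLength_nonneg y x))

lemma boxMean_eq_zero (Q : PoissonPP d P g) (h : ∃ i, x i ≤ y i) :
    Q.boxMean y x = 0 := integral_eq_zero_of_ae (Q.boxLength_ae_eq_zero h)

lemma boxMean_le (Q : PoissonPP d P g) (hd : 0 < d) (hg : MemB d g) (h : y ≤ x) {b : ℝ}
    (hb : 0 ≤ b) (hgb : ∀ z ∈ Icc y x, g z ≤ b) :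
    Q.boxMean y x ≤ poissonAvg (b * boxVol y x) (BWexpect d) := by
  have hnn := poissonAvg_nonneg (mul_nonneg hb (boxVol_nonneg h)) (BWexpect_nonneg d)
  by_cases hlt : ∀ i, y i < x i
  · rw [← ENNReal.ofReal_le_ofReal_iff hnn, Q.ofReal_boxMean hd hg]
    exact Q.lintegral_boxLength_le hd hg hlt hb hgb
  · push Not at hlt
    rwa [Q.boxMean_eq_zero hlt]

lemma le_boxMean (Q : PoissonPP d P g) (hd : 0 < d) (hg : MemB d g) (h : ∀ i, y i < x i) {a : ℝ}
    (ha : 0 ≤ a) (hga : ∀ z ∈ Icc y x, a ≤ g z) :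
    poissonAvg (a * boxVol y x) (BWexpect d) ≤ Q.boxMean y x := by
  rw [← ENNReal.ofReal_le_ofReal_iff (Q.boxMean_nonneg y x), Q.ofReal_boxMean hd hg]
  exact Q.le_lintegral_boxLength hd hg h ha hga

lemma lintegral_exp_boxLength_le (Q : PoissonPP d P g) (hd : 0 < d) (hg : MemB d g)
    (y x : Fin d → ℝ) (θ : ℝ) :
    ∫⁻ ω, ENNReal.ofReal (Real.exp (θ * Q.boxLength y x ω)) ∂P
      ≤ ENNReal.ofReal (Real.exp ((Real.exp θ - 1) * Q.boxMean y x)) := by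
  by_cases h : ∀ i, y i < x i
  · have := isFiniteMeasure_boxIntensity (y := y) (x := x) hg
    have hae := Q.boxLength_ae_eq hg h
    have h1 := (Q.isVoidModel hg h).lintegral_exp_chainLength_le hd
      ((Q.integrable_boxLength hd hg y x).congr hae.symm) θ
    rw [integral_congr_ae hae] at h1
    refine le_trans (le_of_eq (lintegral_congr_ae ?_)) h1
    filter_upwards [hae] with ω hω
    rw [hω]
  · push Not at h
    rw [Q.boxMean_eq_zero h, lintegral_congr_ae (g := fun _ => 1) ?_]
    · simp
    · filter_upwards [Q.boxLength_ae_eq_zero h] with ω hω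
      rw [hω]; simp

end PoissonPP

/-! ### Laws of large numbers in boxes -/

/-- The normalization `n ^ (-1 / d)`. -/
def chainRate (d n : ℕ) : ℝ := (n : ℝ) ^ (-(1 : ℝ) / d)

lemma chainRate_nonneg (d n : ℕ) : 0 ≤ chainRate d n := Real.rpow_nonneg (Nat.cast_nonneg n) _

lemma chainRate_eq (d n : ℕ) : chainRate d n = (n : ℝ) ^ (-(1 / (d : ℝ))) := by
  rw [chainRate, neg_div]

lemma chainRate_mul {d n : ℕ} (hn : 0 < n) : chainRate d n * (n : ℝ) ^ (1 / (d : ℝ)) = 1 := by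
  have : (0 : ℝ) < n := by exact_mod_cast hn
  rw [chainRate_eq, ← Real.rpow_add this]
  simp

lemma tendsto_chainRate {d : ℕ} (hd : 0 < d) : Tendsto (chainRate d) atTop (𝓝 0) := by
  have h : (0 : ℝ) < 1 / d := by positivity
  have := (tendsto_rpow_neg_atTop h).comp (tendsto_natCast_atTop_atTop (R := ℝ))
  refine this.congr fun n => ?_
  rw [chainRate_eq, Function.comp]

lemma summable_exp_neg_mul_rpow {d : ℕ} (hd : 0 < d) {a : ℝ} (ha : 0 < a) :
    Summable fun n : ℕ => Real.exp (-a * (n : ℝ) ^ (1 / (d : ℝ))) := by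
  have h : (0 : ℝ) < 1 / d := by positivity
  have hlim : Tendsto (fun n : ℕ => (n : ℝ) ^ (1 / (d : ℝ))) atTop atTop :=
    (tendsto_rpow_atTop h).comp (tendsto_natCast_atTop_atTop (R := ℝ))
  have hO := ((isLittleO_exp_neg_mul_rpow_atTop ha (-(2 * d))).comp_tendsto hlim).isBigO
  refine summable_of_isBigO_nat (Real.summable_nat_rpow.2 (show (-2 : ℝ) < -1 by norm_num)) ?_
  refine hO.congr (fun n => rfl) fun n => ?_
  have hd' : (d : ℝ) ≠ 0 := by positivity
  simp only [Function.comp]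
  rw [← Real.rpow_mul (Nat.cast_nonneg n)]
  congr 1
  field_simp

section Limits

variable {d : ℕ} {c : ℝ} {f : (Fin d → ℝ) → ℝ} {Ω : Type*} [MeasurableSpace Ω] {P : Measure Ω}
  [IsProbabilityMeasure P]

lemma IsBWConstant.tendsto_poissonAvg (hd : 0 < d) (hc : IsBWConstant d c) {β : ℝ} (hβ : 0 ≤ β) :
    Tendsto (fun n : ℕ => chainRate d n * poissonAvg (n * β) (BWexpect d)) atTop
      (𝓝 (c * β ^ (1 / (d : ℝ)))) := by
  have hd1 : (1 : ℝ) ≤ d := by exact_mod_cast hd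
  simp only [chainRate_eq]
  refine tendsto_poissonAvg_nat_mul (by positivity) ?_ hc.1 hβ (BWexpect_nonneg d) (BWexpect_le hd)
    ?_
  · rw [div_le_one (by positivity)]; exact hd1
  · simpa only [neg_div] using hc.2

lemma eventually_boxMean_le (hd : 0 < d) (hc : IsBWConstant d c) (hf : MemB d f)
    (PP : ∀ n : ℕ, PoissonPP d P fun x => (n : ℝ) * f x) {y x : Fin d → ℝ} (h : y ≤ x) {b : ℝ}
    (hb : 0 ≤ b) (hfb : ∀ z ∈ Icc y x, f z ≤ b) {ε : ℝ} (hε : 0 < ε) :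
    ∀ᶠ n in atTop, chainRate d n * (PP n).boxMean y x
      ≤ c * (b * boxVol y x) ^ (1 / (d : ℝ)) + ε := by
  have hlim := hc.tendsto_poissonAvg hd (mul_nonneg hb (boxVol_nonneg h))
  filter_upwards [(tendsto_order.1 hlim).2 _ (lt_add_of_pos_right _ hε)] with n hn
  refine le_trans (mul_le_mul_of_nonneg_left ?_ (chainRate_nonneg d n)) hn.le
  rw [← mul_assoc]
  exact (PP n).boxMean_le hd (hf.const_mul (Nat.cast_nonneg n)) h (by positivity)
    fun z hz => mul_le_mul_of_nonneg_left (hfb z hz) (Nat.cast_nonneg n)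

lemma eventually_le_boxMean (hd : 0 < d) (hc : IsBWConstant d c) (hf : MemB d f)
    (PP : ∀ n : ℕ, PoissonPP d P fun x => (n : ℝ) * f x) {y x : Fin d → ℝ} (h : ∀ i, y i < x i)
    {a : ℝ} (ha : 0 ≤ a) (hfa : ∀ z ∈ Icc y x, a ≤ f z) {ε : ℝ} (hε : 0 < ε) :
    ∀ᶠ n in atTop, c * (a * boxVol y x) ^ (1 / (d : ℝ)) - ε
      ≤ chainRate d n * (PP n).boxMean y x := by
  have hlim := hc.tendsto_poissonAvg hd (mul_nonneg ha (boxVol_nonneg fun i => (h i).le))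
  filter_upwards [(tendsto_order.1 hlim).1 _ (sub_lt_self _ hε)] with n hn
  refine hn.le.trans (mul_le_mul_of_nonneg_left ?_ (chainRate_nonneg d n))
  rw [← mul_assoc]
  exact (PP n).le_boxMean hd (hf.const_mul (Nat.cast_nonneg n)) h (by positivity)
    fun z hz => mul_le_mul_of_nonneg_left (hfa z hz) (Nat.cast_nonneg n)

lemma exists_boxMean_le (hd : 0 < d) (hc : IsBWConstant d c) (hf : MemB d f)
    (PP : ∀ n : ℕ, PoissonPP d P fun x => (n : ℝ) * f x) (y x : Fin d → ℝ) :
    ∃ K, 0 < K ∧ ∀ n, chainRate d n * (PP n).boxMean y x ≤ K := by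
  by_cases h : y ≤ x
  · obtain ⟨b, hb, hfb⟩ := hf.exists_bound (isCompact_Icc (a := y) (b := x))
    obtain ⟨K, hK⟩ := (hc.tendsto_poissonAvg hd (mul_nonneg hb (boxVol_nonneg h))).bddAbove_range
    refine ⟨max K 1, by positivity, fun n => le_trans ?_ ((hK (mem_range_self n)).trans
      (le_max_left _ _))⟩
    refine mul_le_mul_of_nonneg_left ?_ (chainRate_nonneg d n)
    rw [← mul_assoc]
    exact (PP n).boxMean_le hd (hf.const_mul (Nat.cast_nonneg n)) h (by positivity)
      fun z hz => mul_le_mul_of_nonneg_left (hfb z hz) (Nat.cast_nonneg n)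
  · refine ⟨1, one_pos, fun n => ?_⟩
    rw [Pi.le_def] at h
    push Not at h
    obtain ⟨i, hi⟩ := h
    rw [(PP n).boxMean_eq_zero ⟨i, hi.le⟩, mul_zero]
    exact zero_le_one

/-- Almost surely, the normalized chain length of a box is close to its expectation. -/
lemma ae_tendsto_boxLength_sub (hd : 0 < d) (hc : IsBWConstant d c) (hf : MemB d f)
    (PP : ∀ n : ℕ, PoissonPP d P fun x => (n : ℝ) * f x) (y x : Fin d → ℝ) :
    ∀ᵐ ω ∂P, Tendsto (fun n => chainRate d n * ((PP n).boxLength y x ω - (PP n).boxMean y x))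
      atTop (𝓝 0) := by
  obtain ⟨K, hK, hKn⟩ := exists_boxMean_le hd hc hf PP y x
  have key : ∀ ε : ℝ, 0 < ε → ∀ᵐ ω ∂P, ∀ᶠ n in atTop,
      |chainRate d n * ((PP n).boxLength y x ω - (PP n).boxMean y x)| < ε := by
    intro ε hε
    set θ := min 1 (ε / (2 * K)) with hθ
    have hθ0 : 0 < θ := by positivity
    have hθ1 : θ ≤ 1 := min_le_left _ _
    have hθK : θ * K ≤ ε / 2 := by
      have : θ ≤ ε / (2 * K) := min_le_right _ _
      calc θ * K ≤ ε / (2 * K) * K := by gcongr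
        _ = ε / 2 := by field_simp
    have hsum : ∑' n, P {ω | ε ≤ |chainRate d n *
        ((PP n).boxLength y x ω - (PP n).boxMean y x)|} ≠ ⊤ := by
      have hs := (summable_exp_neg_mul_rpow hd (a := θ * ε / 2) (by positivity)).tsum_ofReal_ne_top
      have hs2 := ENNReal.mul_ne_top (ENNReal.ofNat_ne_top (n := 2)) hs
      rw [← ENNReal.tsum_mul_left] at hs2
      refine ne_top_of_le_ne_top hs2 (ENNReal.tsum_le_tsum fun n => ?_)
      rcases Nat.eq_zero_or_pos n with rfl | hn
      · have h0 : chainRate d 0 = 0 := by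
          rw [chainRate, Nat.cast_zero, Real.zero_rpow]
          have : (0 : ℝ) < d := by exact_mod_cast hd
          exact div_ne_zero (by norm_num) this.ne'
        simp [h0, hε.not_ge]
      · set N := (n : ℝ) ^ (1 / (d : ℝ)) with hN
        have hN0 : 0 < N := Real.rpow_pos_of_pos (by exact_mod_cast hn) _
        have hrN : chainRate d n * N = 1 := chainRate_mul hn
        have hr0 : 0 < chainRate d n := Real.rpow_pos_of_pos (by exact_mod_cast hn) _
        have hr : chainRate d n = N⁻¹ := eq_inv_of_mul_eq_one_left hrN
        have hmu : (PP n).boxMean y x ≤ K * N := by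
          have := hKn n
          rwa [hr, inv_mul_le_iff₀ hN0, mul_comm] at this
        have hg := hf.const_mul (Nat.cast_nonneg (α := ℝ) n)
        have hbd := measure_abs_sub_ge_le ((PP n).aemeasurable_boxLength hd hg y x)
          ((PP n).boxMean_nonneg y x) ((PP n).lintegral_exp_boxLength_le hd hg y x) hθ0.le hθ1
          (ε * N)
        refine le_trans (measure_mono fun ω hω => ?_) (hbd.trans ?_)
        · simp only [mem_ofPred_eq, abs_mul, abs_of_pos hr0] at hω ⊢
          rwa [hr, le_inv_mul_iff₀ hN0, mul_comm] at hω
        · gcongr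
          have h1 : θ ^ 2 * (PP n).boxMean y x ≤ θ * (θ * K) * N := by
            calc θ ^ 2 * (PP n).boxMean y x ≤ θ ^ 2 * (K * N) := by gcongr
              _ = θ * (θ * K) * N := by ring
          have h2 : θ * (θ * K) * N ≤ θ * (ε / 2) * N := by gcongr
          nlinarith
    filter_upwards [ae_eventually_notMem hsum] with ω hω
    filter_upwards [hω] with n hn
    exact not_le.1 hn
  have hall := ae_all_iff.2 fun k : ℕ => key (1 / (k + 1)) (by positivity)
  filter_upwards [hall] with ω hω
  rw [Metric.tendsto_nhds]
  intro ε hε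
  obtain ⟨k, hk⟩ := exists_nat_one_div_lt hε
  filter_upwards [hω k] with n hn
  rw [dist_zero_right, Real.norm_eq_abs]
  exact hn.trans hk

end Limits

/-! ### Splitting chains -/

lemma chainLength_add_le {d : ℕ} {A : Set (Fin d → ℝ)} {z y x : Fin d → ℝ} (hzy : z ≤ y)
    (hyx : y ≤ x) (hA : (A ∩ Icc z x).Finite) :
    chainLength d (A ∩ Icc z y) + chainLength d (A ∩ Icc y x)
      ≤ chainLength d (A ∩ Icc z x) + 1 := by
  classical
  have hs1 : A ∩ Icc z y ⊆ A ∩ Icc z x := inter_subset_inter_right _ (Icc_subset_Icc_right hyx)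
  have hs2 : A ∩ Icc y x ⊆ A ∩ Icc z x := inter_subset_inter_right _ (Icc_subset_Icc_left hzy)
  obtain ⟨C₁, hC₁, hch₁, hc₁⟩ := exists_card_eq_chainLength (hA.subset hs1)
  obtain ⟨C₂, hC₂, hch₂, hc₂⟩ := exists_card_eq_chainLength (hA.subset hs2)
  have hle : ∀ p ∈ C₁, ∀ q ∈ C₂, p ≤ q := fun p hp q hq => (hC₁ hp).2.2.trans (hC₂ hq).2.1
  have hunion : (C₁ ∪ C₂).card ≤ chainLength d (A ∩ Icc z x) := by
    refine card_le_chainLength hA ?_ ?_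
    · rw [Finset.coe_union]
      exact union_subset (hC₁.trans hs1) (hC₂.trans hs2)
    · rw [Finset.coe_union]
      rintro p (hp | hp) q (hq | hq) hne
      · exact hch₁ hp hq hne
      · exact Or.inl (hle p hp q hq)
      · exact Or.inr (hle q hq p hp)
      · exact hch₂ hp hq hne
  have hinter : (C₁ ∩ C₂).card ≤ 1 := by
    refine Finset.card_le_one.2 fun p hp q hq => ?_
    rw [Finset.mem_inter] at hp hq
    exact le_antisymm (hle p hp.1 q hq.2) (hle q hq.1 p hp.2)
  have := Finset.card_union_add_card_inter C₁ C₂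
  omega

lemma chainLength_Icc_le_add_sum {d : ℕ} {A : Set (Fin d → ℝ)} {y x : Fin d → ℝ}
    (hA : ∀ z w : Fin d → ℝ, (A ∩ Icc z w).Finite) :
    chainLength d (A ∩ Icc 0 x) ≤ chainLength d (A ∩ Icc 0 y)
      + ∑ i, chainLength d (A ∩ Icc (Function.update 0 i (y i)) x) := by
  classical
  have hsub : A ∩ Icc 0 x ⊆ (A ∩ Icc 0 y) ∪
      ⋃ i ∈ (Finset.univ : Finset (Fin d)), A ∩ Icc (Function.update 0 i (y i)) x := by
    rintro z ⟨hzA, hz0, hzx⟩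
    by_cases h : z ≤ y
    · exact Or.inl ⟨hzA, hz0, h⟩
    · rw [Pi.le_def] at h
      push Not at h
      obtain ⟨i, hi⟩ := h
      refine Or.inr (mem_biUnion (Finset.mem_univ i) ⟨hzA, ?_, hzx⟩)
      exact update_le_iff.2 ⟨hi.le, fun j _ => hz0 j⟩
  have hfin : (⋃ i ∈ (Finset.univ : Finset (Fin d)),
      A ∩ Icc (Function.update 0 i (y i)) x).Finite :=
    Set.Finite.biUnion (Finset.finite_toSet _) fun i _ => hA _ _
  refine (chainLength_mono ((hA _ _).union hfin) hsub).trans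
    ((chainLength_union_le (hA _ _) hfin).trans ?_)
  gcongr
  exact chainLength_iUnion_le _ fun i => hA _ _

/-- A longest chain in `[0, x]` can be split at a point of any prescribed level set of a
decreasing linear function. -/
lemma exists_chainLength_le_add {d : ℕ} {A : Set (Fin d → ℝ)} {x w : Fin d → ℝ} {δ : ℝ}
    (hA : ∀ z w : Fin d → ℝ, (A ∩ Icc z w).Finite) (hx : 0 ≤ x) (hw : ∀ i, 0 < w i)
    (hδ : 0 ≤ δ) (hδ' : δ ≤ ∑ i, w i * x i) :
    ∃ y, 0 ≤ y ∧ y ≤ x ∧ ∑ i, w i * (x i - y i) = δ ∧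
      chainLength d (A ∩ Icc 0 x) ≤ chainLength d (A ∩ Icc 0 y) + chainLength d (A ∩ Icc y x) := by
  classical
  obtain ⟨C, hC, hch, hc⟩ := exists_card_eq_chainLength (hA 0 x)
  let h : (Fin d → ℝ) → ℝ := fun y => ∑ i, w i * (x i - y i)
  have hanti : ∀ {p q : Fin d → ℝ}, p ≤ q → h q ≤ h p := fun {p q} hpq =>
    Finset.sum_le_sum fun i _ => mul_le_mul_of_nonneg_left (by linarith [hpq i]) (hw i).le
  let C₁ := insert 0 (C.filter fun z => δ ≤ h z)
  let C₂ := insert x (C.filter fun z => h z < δ)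
  have hC0 : ∀ z ∈ C, 0 ≤ z ∧ z ≤ x := fun z hz => (hC hz).2
  have h0 : δ ≤ h 0 := by simpa [h] using hδ'
  have hx0 : h x ≤ δ := by simpa [h] using hδ
  have h12 : ∀ p ∈ C₁, ∀ q ∈ C₂, p ≤ q := by
    intro p hp q hq
    simp only [C₁, C₂, Finset.mem_insert, Finset.mem_filter] at hp hq
    rcases hp with rfl | ⟨hp, hp'⟩ <;> rcases hq with rfl | ⟨hq, hq'⟩
    · exact hx
    · exact (hC0 q hq).1
    · exact (hC0 p hp).2
    · rcases hch.total hp hq with h1 | h1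
      · exact h1
      · exact absurd (hanti h1) (by linarith)
  have hC₁h : ∀ p ∈ C₁, δ ≤ h p := by
    intro p hp
    simp only [C₁, Finset.mem_insert, Finset.mem_filter] at hp
    rcases hp with rfl | hp
    · exact h0
    · exact hp.2
  have hC₂h : ∀ p ∈ C₂, h p ≤ δ := by
    intro p hp
    simp only [C₂, Finset.mem_insert, Finset.mem_filter] at hp
    rcases hp with rfl | hp
    · exact hx0
    · exact hp.2.le
  have tot₁ : ∀ p ∈ C₁, ∀ q ∈ C₁, p ≤ q ∨ q ≤ p := by
    intro p hp q hq
    simp only [C₁, Finset.mem_insert, Finset.mem_filter] at hp hq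
    rcases hp with rfl | ⟨hp, hp'⟩
    · rcases hq with rfl | ⟨hq, hq'⟩
      · exact Or.inl le_rfl
      · exact Or.inl (hC0 q hq).1
    · rcases hq with rfl | ⟨hq, hq'⟩
      · exact Or.inr (hC0 p hp).1
      · exact hch.total hp hq
  have tot₂ : ∀ p ∈ C₂, ∀ q ∈ C₂, p ≤ q ∨ q ≤ p := by
    intro p hp q hq
    simp only [C₂, Finset.mem_insert, Finset.mem_filter] at hp hq
    rcases hp with rfl | ⟨hp, hp'⟩
    · rcases hq with rfl | ⟨hq, hq'⟩
      · exact Or.inl le_rfl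
      · exact Or.inr (hC0 q hq).2
    · rcases hq with rfl | ⟨hq, hq'⟩
      · exact Or.inl (hC0 p hp).2
      · exact hch.total hp hq
  have ne₁ : C₁.Nonempty := Finset.insert_nonempty _ _
  have ne₂ : C₂.Nonempty := Finset.insert_nonempty _ _
  have hp : C₁.sup' ne₁ id ∈ (C₁ : Set (Fin d → ℝ)) := by
    refine Finset.sup'_mem _ (fun a ha b hb => ?_) _ _ _ fun i hi => hi
    rcases tot₁ a ha b hb with h1 | h1
    · rwa [sup_eq_right.2 h1]
    · rwa [sup_eq_left.2 h1]
  have hq : C₂.inf' ne₂ id ∈ (C₂ : Set (Fin d → ℝ)) := by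
    refine Finset.inf'_mem _ (fun a ha b hb => ?_) _ _ _ fun i hi => hi
    rcases tot₂ a ha b hb with h1 | h1
    · rwa [inf_eq_left.2 h1]
    · rwa [inf_eq_right.2 h1]
  set p := C₁.sup' ne₁ id with hpdef
  set q := C₂.inf' ne₂ id with hqdef
  have hpq : p ≤ q := h12 p hp q hq
  obtain ⟨t, ht, hty⟩ : ∃ t ∈ Icc (0 : ℝ) 1, h (p + t • (q - p)) = δ := by
    have hcont : ContinuousOn (fun t : ℝ => h (p + t • (q - p))) (Icc 0 1) := by
      refine Continuous.continuousOn ?_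
      simp only [h, Pi.add_apply, Pi.smul_apply, Pi.sub_apply, smul_eq_mul]
      fun_prop
    have := intermediate_value_Icc' zero_le_one hcont
    exact this ⟨by simpa using hC₂h q hq, by simpa using hC₁h p hp⟩
  have hpy : p ≤ p + t • (q - p) := by
    intro i
    have := mul_nonneg ht.1 (sub_nonneg.2 (hpq i))
    simpa using this
  have hyq : p + t • (q - p) ≤ q := by
    intro i
    have := mul_le_mul_of_nonneg_right ht.2 (sub_nonneg.2 (hpq i))
    simp only [Pi.add_apply, Pi.smul_apply, Pi.sub_apply, smul_eq_mul]
    linarith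
  have hle_p : ∀ z ∈ C₁, z ≤ p := fun z hz => Finset.le_sup' id hz
  have hq_le : ∀ z ∈ C₂, q ≤ z := fun z hz => Finset.inf'_le id hz
  refine ⟨p + t • (q - p), (hle_p 0 (Finset.mem_insert_self _ _)).trans hpy,
    hyq.trans (hq_le x (Finset.mem_insert_self _ _)), hty, ?_⟩
  rw [← hc, ← Finset.card_filter_add_card_filter_not (s := C) (fun z => δ ≤ h z)]
  refine add_le_add (card_le_chainLength (hA _ _) ?_ (hch.mono ?_))
    (card_le_chainLength (hA _ _) ?_ (hch.mono ?_))
  · intro z hz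
    have hz' := Finset.mem_filter.1 (Finset.mem_coe.1 hz)
    exact ⟨(hC hz'.1).1, (hC0 z hz'.1).1, (hle_p z (Finset.mem_insert_of_mem hz)).trans hpy⟩
  · exact Finset.coe_subset.2 (Finset.filter_subset _ _)
  · intro z hz
    have hz' := Finset.mem_filter.1 (Finset.mem_coe.1 hz)
    refine ⟨(hC hz'.1).1, hyq.trans (hq_le z (Finset.mem_insert_of_mem ?_)), (hC0 z hz'.1).2⟩
    exact Finset.mem_filter.2 ⟨hz'.1, not_le.1 hz'.2⟩
  · exact Finset.coe_subset.2 (Finset.filter_subset _ _)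

/-! ### Limits of normalized expected chain lengths along an ultrafilter -/

section UltraLimit

variable {d : ℕ} {c : ℝ} {f : (Fin d → ℝ) → ℝ} {Ω : Type*} [MeasurableSpace Ω] {P : Measure Ω}
  [IsProbabilityMeasure P]

/-- The limit of the normalized expected chain length in the box `[y, x]` along `𝒰`. -/
def boxLimit (PP : ∀ n : ℕ, PoissonPP d P fun x => (n : ℝ) * f x) (𝒰 : Ultrafilter ℕ)
    (y x : Fin d → ℝ) : ℝ :=
  limUnder (𝒰 : Filter ℕ) fun n => chainRate d n * (PP n).boxMean y x

variable (PP : ∀ n : ℕ, PoissonPP d P fun x => (n : ℝ) * f x) {𝒰 : Ultrafilter ℕ}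

lemma tendsto_boxLimit (hd : 0 < d) (hc : IsBWConstant d c) (hf : MemB d f)
    (𝒰 : Ultrafilter ℕ) (y x : Fin d → ℝ) :
    Tendsto (fun n => chainRate d n * (PP n).boxMean y x) 𝒰 (𝓝 (boxLimit PP 𝒰 y x)) := by
  obtain ⟨K, -, hK⟩ := exists_boxMean_le hd hc hf PP y x
  refine tendsto_nhds_limUnder ?_
  have hmem : (𝒰.map fun n => chainRate d n * (PP n).boxMean y x : Filter ℝ) ≤ 𝓟 (Icc 0 K) := by
    refine le_principal_iff.2 (Filter.mem_map.2 (Filter.univ_mem' fun n => ?_))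
    exact ⟨mul_nonneg (chainRate_nonneg d n) ((PP n).boxMean_nonneg y x), hK n⟩
  obtain ⟨a, -, ha⟩ := isCompact_Icc.ultrafilter_le_nhds
    (𝒰.map fun n => chainRate d n * (PP n).boxMean y x) hmem
  exact ⟨a, ha⟩

lemma ae_forall_finite (hf : MemB d f) :
    ∀ᵐ ω ∂P, ∀ n, ∀ z w : Fin d → ℝ, ((PP n).pts ω ∩ Icc z w).Finite := by
  have h : ∀ᵐ ω ∂P, ∀ n, ∀ k : ℕ,
      ((PP n).pts ω ∩ Icc (fun _ => -(k : ℝ)) fun _ => (k : ℝ)).Finite := by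
    simp only [ae_all_iff]
    intro n k
    exact (PP n).ae_finite (hf.const_mul (Nat.cast_nonneg n)).2.1 measurableSet_Icc
      isCompact_Icc.isBounded
  filter_upwards [h] with ω hω n z w
  obtain ⟨k, hk⟩ := exists_nat_ge (‖z‖ + ‖w‖)
  refine (hω n k).subset (inter_subset_inter_right _ (Icc_subset_Icc ?_ ?_))
  · intro i
    have h1 := norm_le_pi_norm z i
    have h2 := norm_nonneg w
    have h3 := neg_abs_le (z i)
    rw [Real.norm_eq_abs] at h1
    linarith
  · intro i
    have h1 := norm_le_pi_norm w i
    have h2 := norm_nonneg z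
    have h3 := le_abs_self (w i)
    rw [Real.norm_eq_abs] at h1
    linarith

/-- A typical realization realizes the limits of a countable family of boxes. -/
lemma exists_realization (hd : 0 < d) (hc : IsBWConstant d c) (hf : MemB d f)
    (h𝒰 : (𝒰 : Filter ℕ) ≤ atTop) {ι : Type*} [Countable ι] (y x : ι → Fin d → ℝ) :
    ∃ ω, (∀ n, ∀ z w : Fin d → ℝ, ((PP n).pts ω ∩ Icc z w).Finite) ∧
      ∀ k, Tendsto (fun n => chainRate d n * (PP n).boxLength (y k) (x k) ω) 𝒰
        (𝓝 (boxLimit PP 𝒰 (y k) (x k))) := by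
  have h := ae_all_iff.2 fun k => ae_tendsto_boxLength_sub hd hc hf PP (y k) (x k)
  obtain ⟨ω, h1, h2⟩ := ((ae_forall_finite PP hf).and h).exists
  refine ⟨ω, h1, fun k => ?_⟩
  have h3 := ((h2 k).mono_left h𝒰).add (tendsto_boxLimit PP hd hc hf 𝒰 (y k) (x k))
  rw [zero_add] at h3
  exact h3.congr fun n => by ring

lemma boxLimit_eq_zero (hd : 0 < d) (hc : IsBWConstant d c) (hf : MemB d f)
    (𝒰 : Ultrafilter ℕ) {y x : Fin d → ℝ} (h : ∃ i, x i ≤ y i) : boxLimit PP 𝒰 y x = 0 := by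
  refine tendsto_nhds_unique (tendsto_boxLimit PP hd hc hf 𝒰 y x) ?_
  simp [(PP _).boxMean_eq_zero h]

lemma boxLimit_le (hd : 0 < d) (hc : IsBWConstant d c) (hf : MemB d f)
    (h𝒰 : (𝒰 : Filter ℕ) ≤ atTop) {y x : Fin d → ℝ} (h : y ≤ x) {b : ℝ}
    (hb : 0 ≤ b) (hfb : ∀ z ∈ Icc y x, f z ≤ b) :
    boxLimit PP 𝒰 y x ≤ c * (b * boxVol y x) ^ (1 / (d : ℝ)) :=
  le_of_forall_pos_le_add fun _ hε => le_of_tendsto (tendsto_boxLimit PP hd hc hf 𝒰 y x)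
    (h𝒰 (eventually_boxMean_le hd hc hf PP h hb hfb hε))

lemma le_boxLimit (hd : 0 < d) (hc : IsBWConstant d c) (hf : MemB d f)
    (h𝒰 : (𝒰 : Filter ℕ) ≤ atTop) {y x : Fin d → ℝ} (h : ∀ i, y i < x i) {a : ℝ}
    (ha : 0 ≤ a) (hfa : ∀ z ∈ Icc y x, a ≤ f z) :
    c * (a * boxVol y x) ^ (1 / (d : ℝ)) ≤ boxLimit PP 𝒰 y x :=
  le_of_forall_sub_le fun _ hε => ge_of_tendsto (tendsto_boxLimit PP hd hc hf 𝒰 y x)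
    (h𝒰 (eventually_le_boxMean hd hc hf PP h ha hfa hε))

lemma boxLimit_mono (hd : 0 < d) (hc : IsBWConstant d c) (hf : MemB d f)
    (h𝒰 : (𝒰 : Filter ℕ) ≤ atTop) {y x y' x' : Fin d → ℝ} (hy : y' ≤ y) (hx : x ≤ x') :
    boxLimit PP 𝒰 y x ≤ boxLimit PP 𝒰 y' x' := by
  obtain ⟨ω, hfin, hω⟩ := exists_realization PP hd hc hf h𝒰 ![y, y'] ![x, x']
  refine le_of_tendsto_of_tendsto' (hω 0) (hω 1) fun n => ?_
  refine mul_le_mul_of_nonneg_left ?_ (chainRate_nonneg d n)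
  exact Nat.cast_le.2 (chainLength_mono (hfin n _ _)
    (inter_subset_inter_right _ (Icc_subset_Icc hy hx)))

/-- Superadditivity along ordered boxes. -/
lemma boxLimit_add_le (hd : 0 < d) (hc : IsBWConstant d c) (hf : MemB d f)
    (h𝒰 : (𝒰 : Filter ℕ) ≤ atTop) {z y x : Fin d → ℝ} (hzy : z ≤ y) (hyx : y ≤ x) :
    boxLimit PP 𝒰 z y + boxLimit PP 𝒰 y x ≤ boxLimit PP 𝒰 z x := by
  obtain ⟨ω, hfin, hω⟩ := exists_realization PP hd hc hf h𝒰 ![z, y, z] ![y, x, x]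
  have hlim := (hω 2).add ((tendsto_chainRate hd).mono_left h𝒰)
  rw [add_zero] at hlim
  refine le_of_tendsto_of_tendsto' ((hω 0).add (hω 1)) hlim fun n => ?_
  rw [← mul_add, ← mul_add_one]
  refine mul_le_mul_of_nonneg_left ?_ (chainRate_nonneg d n)
  have := chainLength_add_le hzy hyx (hfin n z x)
  change (chainLength d ((PP n).pts ω ∩ Icc z y) : ℝ) + chainLength d ((PP n).pts ω ∩ Icc y x)
    ≤ chainLength d ((PP n).pts ω ∩ Icc z x) + 1
  exact_mod_cast this

lemma boxLimit_le_add_sum (hd : 0 < d) (hc : IsBWConstant d c) (hf : MemB d f)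
    (h𝒰 : (𝒰 : Filter ℕ) ≤ atTop) (y x : Fin d → ℝ) :
    boxLimit PP 𝒰 0 x
      ≤ boxLimit PP 𝒰 0 y + ∑ i, boxLimit PP 𝒰 (Function.update 0 i (y i)) x := by
  obtain ⟨ω, hfin, hω⟩ := exists_realization PP hd hc hf h𝒰
    (Sum.elim ![0, 0] fun i => Function.update (0 : Fin d → ℝ) i (y i))
    (Sum.elim ![x, y] fun _ => x)
  refine le_of_tendsto_of_tendsto' (hω (Sum.inl 0)) ((hω (Sum.inl 1)).add
    (tendsto_finsetSum Finset.univ fun i _ => hω (Sum.inr i))) fun n => ?_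
  rw [← Finset.mul_sum, ← mul_add]
  refine mul_le_mul_of_nonneg_left ?_ (chainRate_nonneg d n)
  have := chainLength_Icc_le_add_sum (y := y) (x := x) (hfin n)
  simp only [PoissonPP.boxLength, Sum.elim_inl, Sum.elim_inr]
  exact_mod_cast this

lemma boxVol_update_le {y x : Fin d → ℝ} {M : ℝ} (hx : 0 ≤ x) (hyx : y ≤ x) (hxM : ∀ i, x i ≤ M)
    (i : Fin d) : boxVol (Function.update 0 i (y i)) x ≤ M ^ (d - 1) * (x i - y i) := by
  classical
  have e : boxVol (Function.update 0 i (y i)) x = (x i - y i) * ∏ j ∈ Finset.univ.erase i, x j := by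
    rw [boxVol, ← Finset.mul_prod_erase _ _ (Finset.mem_univ i)]
    congr 1
    · simp
    · refine Finset.prod_congr rfl fun j hj => ?_
      simp [Finset.ne_of_mem_erase hj]
  rw [e, mul_comm]
  refine mul_le_mul_of_nonneg_right ?_ (sub_nonneg.2 (hyx i))
  calc ∏ j ∈ Finset.univ.erase i, x j ≤ ∏ j ∈ Finset.univ.erase i, M :=
        Finset.prod_le_prod (fun j _ => hx j) fun j _ => hxM j
    _ = M ^ (d - 1) := by simp

/-- Hölder-type modulus of continuity of the limit. -/
lemma exists_abs_boxLimit_sub_le (hd : 0 < d) (hc : IsBWConstant d c) (hf : MemB d f)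
    (h𝒰 : (𝒰 : Filter ℕ) ≤ atTop) {M : ℝ} (hM : 0 ≤ M) : ∃ B, 0 ≤ B ∧
      ∀ x ∈ Icc (0 : Fin d → ℝ) (fun _ => M), ∀ y ∈ Icc (0 : Fin d → ℝ) (fun _ => M),
      |boxLimit PP 𝒰 0 x - boxLimit PP 𝒰 0 y| ≤ ∑ i, c * (B * |x i - y i|) ^ (1 / (d : ℝ)) := by
  obtain ⟨b, hb, hfb⟩ := hf.exists_bound (isCompact_Icc (a := (0 : Fin d → ℝ)) (b := fun _ => M))
  have hmono : ∀ x ∈ Icc (0 : Fin d → ℝ) (fun _ => M), ∀ y ∈ Icc (0 : Fin d → ℝ) (fun _ => M),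
      y ≤ x → boxLimit PP 𝒰 0 x
        ≤ boxLimit PP 𝒰 0 y + ∑ i, c * (b * M ^ (d - 1) * |x i - y i|) ^ (1 / (d : ℝ)) := by
    intro x hx y hy hyx
    refine (boxLimit_le_add_sum PP hd hc hf h𝒰 y x).trans ?_
    gcongr with i
    have hu : Function.update (0 : Fin d → ℝ) i (y i) ≤ x :=
      update_le_iff.2 ⟨hyx i, fun j _ => hx.1 j⟩
    have hu0 : 0 ≤ Function.update (0 : Fin d → ℝ) i (y i) :=
      le_update_iff.2 ⟨hy.1 i, fun _ _ => le_rfl⟩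
    refine (boxLimit_le PP hd hc hf h𝒰 hu hb fun z hz =>
      hfb z ⟨hu0.trans hz.1, hz.2.trans hx.2⟩).trans ?_
    have h1 := boxVol_update_le hx.1 hyx hx.2 i
    have h2 := hc.1
    have h3 := boxVol_nonneg hu
    rw [abs_of_nonneg (sub_nonneg.2 (hyx i)), mul_assoc]
    gcongr
  refine ⟨b * M ^ (d - 1), by positivity, fun x hx y hy => ?_⟩
  have hsup : x ⊔ y ∈ Icc (0 : Fin d → ℝ) (fun _ => M) :=
    ⟨hx.1.trans le_sup_left, sup_le hx.2 hy.2⟩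
  have hinf : x ⊓ y ∈ Icc (0 : Fin d → ℝ) (fun _ => M) :=
    ⟨le_inf hx.1 hy.1, inf_le_left.trans hx.2⟩
  have h1 := hmono _ hsup _ hinf inf_le_sup
  have e : ∀ i, |(x ⊔ y) i - (x ⊓ y) i| = |x i - y i| := fun i => by
    rw [Pi.sup_apply, Pi.inf_apply, sup_sub_inf_eq_abs_sub, abs_abs, abs_sub_comm]
  simp only [e] at h1
  have mono := fun {p q : Fin d → ℝ} (h : p ≤ q) => boxLimit_mono PP hd hc hf h𝒰 (le_refl 0) h
  have a1 := mono (le_sup_left (a := x) (b := y))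
  have a2 := mono (le_sup_right (a := x) (b := y))
  have a3 := mono (inf_le_left (a := x) (b := y))
  have a4 := mono (inf_le_right (a := x) (b := y))
  rw [abs_le]
  constructor <;> linarith

lemma continuousOn_boxLimit (hd : 0 < d) (hc : IsBWConstant d c) (hf : MemB d f)
    (h𝒰 : (𝒰 : Filter ℕ) ≤ atTop) : ContinuousOn (boxLimit PP 𝒰 0) (Ici 0) := by
  intro x hx
  obtain ⟨B, hB, hmod⟩ := exists_abs_boxLimit_sub_le PP hd hc hf h𝒰
    (M := ‖x‖ + 1) (by positivity)
  have hs : (0 : ℝ) < 1 / d := by positivity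
  have hlim : Tendsto (fun y : Fin d → ℝ => ∑ i, c * (B * |y i - x i|) ^ (1 / (d : ℝ)))
      (𝓝[Ici 0] x) (𝓝 0) := by
    have hcont : Continuous fun y : Fin d → ℝ => ∑ i, c * (B * |y i - x i|) ^ (1 / (d : ℝ)) := by
      refine continuous_finsetSum _ fun i _ => continuous_const.mul ?_
      exact Continuous.rpow_const (by fun_prop) fun _ => Or.inr hs.le
    have := hcont.tendsto x
    simp only [sub_self, abs_zero, mul_zero, Real.zero_rpow hs.ne', Finset.sum_const_zero] at this
    exact this.mono_left nhdsWithin_le_nhds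
  rw [ContinuousWithinAt, tendsto_iff_dist_tendsto_zero]
  refine squeeze_zero' (Eventually.of_forall fun _ => dist_nonneg) ?_ hlim
  filter_upwards [self_mem_nhdsWithin, mem_nhdsWithin_of_mem_nhds (Metric.ball_mem_nhds x one_pos)]
    with y hy hyb
  have hcoord : ∀ i, |x i| ≤ ‖x‖ := fun i => norm_le_pi_norm x i
  rw [Real.dist_eq]
  refine hmod y ⟨hy, fun i => ?_⟩ x ⟨hx, fun i => ?_⟩
  · have h1 : |y i - x i| < 1 := (norm_le_pi_norm (y - x) i).trans_lt (by
      rwa [← dist_eq_norm])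
    have := (abs_lt.1 h1).2
    have := le_abs_self (x i)
    have := hcoord i
    linarith
  · have := le_abs_self (x i)
    have := hcoord i
    linarith

end UltraLimit

/-! ### The dynamic programming inequality -/

section DynamicProgramming

variable {d : ℕ} {c : ℝ} {f : (Fin d → ℝ) → ℝ} {Ω : Type*} [MeasurableSpace Ω] {P : Measure Ω}
  [IsProbabilityMeasure P] (PP : ∀ n : ℕ, PoissonPP d P fun x => (n : ℝ) * f x)
  {𝒰 : Ultrafilter ℕ}

lemma continuous_boxVol (x : Fin d → ℝ) : Continuous fun y => boxVol y x := by
  unfold boxVol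
  fun_prop

/-- Every vector is a limit of rational vectors that are strictly above it and of rational
vectors that are strictly below it. -/
lemma exists_seq_rat_lt_tendsto (y : Fin d → ℝ) :
    (∃ q : ℕ → Fin d → ℚ, (∀ k i, (q k i : ℝ) < y i) ∧
      Tendsto (fun k i => (q k i : ℝ)) atTop (𝓝 y)) ∧
    ∃ q : ℕ → Fin d → ℚ, (∀ k i, y i < (q k i : ℝ)) ∧
      Tendsto (fun k i => (q k i : ℝ)) atTop (𝓝 y) := by
  have hpos : ∀ k : ℕ, (0 : ℝ) < 1 / ((k : ℝ) + 1) := fun k => by positivity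
  have h0 := tendsto_one_div_add_atTop_nhds_zero_nat (𝕜 := ℝ)
  constructor
  · choose q hq hq' using fun (k : ℕ) (i : Fin d) =>
      exists_rat_btwn (sub_lt_self (y i) (hpos k))
    refine ⟨q, hq', tendsto_pi_nhds.2 fun i => ?_⟩
    have h1 := (tendsto_const_nhds (x := y i)).sub h0
    rw [sub_zero] at h1
    exact tendsto_of_tendsto_of_tendsto_of_le_of_le h1 tendsto_const_nhds
      (fun k => (hq k i).le) fun k => (hq' k i).le
  · choose q hq hq' using fun (k : ℕ) (i : Fin d) =>
      exists_rat_btwn (lt_add_of_pos_right (y i) (hpos k))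
    refine ⟨q, hq, tendsto_pi_nhds.2 fun i => ?_⟩
    have h1 := (tendsto_const_nhds (x := y i)).add h0
    rw [add_zero] at h1
    exact tendsto_of_tendsto_of_tendsto_of_le_of_le tendsto_const_nhds h1
      (fun k => (hq k i).le) fun k => (hq' k i).le

lemma exists_boxLimit_le_add (hd : 0 < d) (hc : IsBWConstant d c) (hf : MemB d f)
    (h𝒰 : (𝒰 : Filter ℕ) ≤ atTop) {x w : Fin d → ℝ} {δ b r : ℝ} (hx : 0 ≤ x)
    (hw : ∀ i, 0 < w i) (hδ : 0 ≤ δ) (hδ' : δ ≤ ∑ i, w i * x i) (hb : 0 ≤ b)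
    (hr : ∀ i, δ / w i < r) (hfb : ∀ z ∈ Metric.ball x r, f z ≤ b) :
    ∃ y, 0 ≤ y ∧ y ≤ x ∧ ∑ i, w i * (x i - y i) = δ ∧
      boxLimit PP 𝒰 0 x ≤ boxLimit PP 𝒰 0 y + c * (b * boxVol y x) ^ (1 / (d : ℝ)) := by
  obtain ⟨ω, hfin, hω⟩ := exists_realization PP hd hc hf h𝒰
    (ι := (Fin d → ℚ) ⊕ (Fin d → ℚ) ⊕ Unit)
    (Sum.elim (fun q i => (q i : ℝ)) fun _ => 0)
    (Sum.elim (fun _ => x) (Sum.elim (fun q i => (q i : ℝ)) fun _ => x))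
  choose Y hY0 hYx hYδ hY using fun n => exists_chainLength_le_add (hfin n) hx hw hδ hδ'
  have hcompact : IsCompact (Icc 0 x ∩ {y : Fin d → ℝ | ∑ i, w i * (x i - y i) = δ}) :=
    isCompact_Icc.inter_right (isClosed_eq (by fun_prop) continuous_const)
  obtain ⟨y, ⟨⟨hy0, hyx⟩, hyδ⟩, hlim⟩ := hcompact.ultrafilter_le_nhds (𝒰.map Y)
    (le_principal_iff.2 (Filter.mem_map.2 (Filter.univ_mem' fun n => ⟨⟨hY0 n, hYx n⟩, hYδ n⟩)))
  rw [mem_ofPred_eq] at hyδ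
  have hYlim : Tendsto Y 𝒰 (𝓝 y) := hlim
  refine ⟨y, hy0, hyx, hyδ, ?_⟩
  have key : ∀ p q : Fin d → ℚ, (∀ i, (p i : ℝ) < y i) → (∀ i, y i < (q i : ℝ)) →
      boxLimit PP 𝒰 0 x ≤ boxLimit PP 𝒰 0 (fun i => (q i : ℝ))
        + boxLimit PP 𝒰 (fun i => (p i : ℝ)) x := by
    intro p q hp hq
    refine le_of_tendsto_of_tendsto (hω (Sum.inr (Sum.inr ())))
      ((hω (Sum.inr (Sum.inl q))).add (hω (Sum.inl p))) ?_
    have h1 : ∀ᶠ n in (𝒰 : Filter ℕ), ∀ i, (p i : ℝ) < Y n i ∧ Y n i < (q i : ℝ) :=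
      eventually_all.2 fun i => ((tendsto_pi_nhds.1 hYlim i).eventually_const_lt (hp i)).and
        ((tendsto_pi_nhds.1 hYlim i).eventually_lt_const (hq i))
    filter_upwards [h1] with n hn
    rw [← mul_add]
    refine mul_le_mul_of_nonneg_left ?_ (chainRate_nonneg d n)
    have h2 : chainLength d ((PP n).pts ω ∩ Icc 0 (Y n))
        ≤ chainLength d ((PP n).pts ω ∩ Icc 0 fun i => (q i : ℝ)) :=
      chainLength_mono (hfin n _ _) (inter_subset_inter_right _
        (Icc_subset_Icc_right fun i => (hn i).2.le))
    have h3 : chainLength d ((PP n).pts ω ∩ Icc (Y n) x)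
        ≤ chainLength d ((PP n).pts ω ∩ Icc (fun i => (p i : ℝ)) x) :=
      chainLength_mono (hfin n _ _) (inter_subset_inter_right _
        (Icc_subset_Icc_left fun i => (hn i).1.le))
    have h4 := (hY n).trans (add_le_add h2 h3)
    change (chainLength d ((PP n).pts ω ∩ Icc 0 x) : ℝ)
      ≤ chainLength d ((PP n).pts ω ∩ Icc 0 fun i => (q i : ℝ))
        + chainLength d ((PP n).pts ω ∩ Icc (fun i => (p i : ℝ)) x)
    exact_mod_cast h4
  obtain ⟨⟨p, hp, hplim⟩, q, hq, hqlim⟩ := exists_seq_rat_lt_tendsto y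
  have hq0 : ∀ k, (0 : Fin d → ℝ) ≤ fun i => (q k i : ℝ) :=
    fun k i => (hy0 i).trans (hq k i).le
  have hV := (continuousOn_boxLimit PP hd hc hf h𝒰 y hy0).tendsto.comp
    (tendsto_nhdsWithin_iff.2 ⟨hqlim, Eventually.of_forall hq0⟩)
  have hcont : Continuous fun z => c * (b * boxVol z x) ^ (1 / (d : ℝ)) :=
    continuous_const.mul (((continuous_boxVol x).const_mul b).rpow_const
      fun _ => Or.inr (by positivity))
  refine ge_of_tendsto (hV.add ((hcont.tendsto y).comp hplim)) ?_
  have hclose : ∀ i, x i - y i < r := fun i => by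
    refine lt_of_le_of_lt ?_ (hr i)
    rw [le_div_iff₀' (hw i), ← hyδ]
    exact Finset.single_le_sum (f := fun i => w i * (x i - y i))
      (fun j _ => mul_nonneg (hw j).le (sub_nonneg.2 (hyx j))) (Finset.mem_univ i)
  have hev : ∀ᶠ k in atTop, ∀ i, x i - r < (p k i : ℝ) :=
    eventually_all.2 fun i => (tendsto_pi_nhds.1 hplim i).eventually_const_lt
      (by linarith [hclose i])
  have hrpos : 0 < r := (div_nonneg hδ (hw ⟨0, hd⟩).le).trans_lt (hr ⟨0, hd⟩)
  filter_upwards [hev] with k hk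
  refine (key (p k) (q k) (hp k) (hq k)).trans (add_le_add le_rfl ?_)
  refine boxLimit_le PP hd hc hf h𝒰 (fun i => (hp k i).le.trans (hyx i)) hb fun z hz => hfb z ?_
  rw [Metric.mem_ball, dist_pi_lt_iff hrpos]
  intro i
  rw [Real.dist_eq, abs_lt]
  have h1 := hz.1 i
  have h2 := hz.2 i
  have h3 := hk i
  constructor <;> linarith

/-- The arithmetic-geometric mean inequality for weighted box volumes. -/
lemma rpow_mul_boxVol_le (hd : 0 < d) {x y w : Fin d → ℝ} {δ b : ℝ} (hyx : y ≤ x)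
    (hw : ∀ i, 0 < w i) (hb : 0 ≤ b) (hδ : ∑ i, w i * (x i - y i) = δ) :
    (b * boxVol y x) ^ (1 / (d : ℝ)) ≤ (b / ∏ i, w i) ^ (1 / (d : ℝ)) * (δ / d) := by
  have hd' : (0 : ℝ) < d := Nat.cast_pos.2 hd
  have hnn : ∀ i, 0 ≤ w i * (x i - y i) := fun i => mul_nonneg (hw i).le (sub_nonneg.2 (hyx i))
  have hprod : 0 < ∏ i, w i := Finset.prod_pos fun i _ => hw i
  have amgm := Real.geom_mean_le_arith_mean_weighted Finset.univ (fun _ : Fin d => 1 / (d : ℝ))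
    (fun i => w i * (x i - y i)) (fun _ _ => by positivity) (by simp [hd'.ne'])
    (fun i _ => hnn i)
  rw [Real.finsetProd_rpow _ _ (fun i _ => hnn i), ← Finset.mul_sum, hδ,
    Finset.prod_mul_distrib] at amgm
  have e : b * boxVol y x = b / (∏ i, w i) * ((∏ i, w i) * ∏ i, (x i - y i)) := by
    rw [boxVol]
    field_simp
  have hvol : 0 ≤ ∏ i, (x i - y i) := boxVol_nonneg hyx
  rw [e, Real.mul_rpow (by positivity) (mul_nonneg hprod.le hvol)]
  refine mul_le_mul_of_nonneg_left (amgm.trans_eq ?_) (by positivity)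
  ring

end DynamicProgramming

/-! ### Ultrafilter limits are viscosity solutions -/

section Viscosity

variable {d : ℕ} {c : ℝ} {f : (Fin d → ℝ) → ℝ} {Ω : Type*} [MeasurableSpace Ω] {P : Measure Ω}
  [IsProbabilityMeasure P] (PP : ∀ n : ℕ, PoissonPP d P fun x => (n : ℝ) * f x)
  {𝒰 : Ultrafilter ℕ} {φ : (Fin d → ℝ) → ℝ} {x₀ : Fin d → ℝ}

lemma fderiv_nonneg_of_eventually_le (hφ : DifferentiableAt ℝ φ x₀) {h : Fin d → ℝ}
    (hle : ∀ᶠ t in 𝓝[>] (0 : ℝ), φ x₀ ≤ φ (x₀ + t • h)) : 0 ≤ fderiv ℝ φ x₀ h := by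
  have h1 : HasDerivAt (fun t : ℝ => φ (x₀ + t • h)) (fderiv ℝ φ x₀ h) 0 :=
    hφ.hasFDerivAt.hasLineDerivAt h
  refine ge_of_tendsto h1.tendsto_slope_zero_right ?_
  filter_upwards [hle, self_mem_nhdsWithin] with t ht ht0
  have ht0 : 0 < t := ht0
  simp only [zero_add, zero_smul, add_zero, smul_eq_mul]
  exact mul_nonneg (inv_nonneg.2 ht0.le) (sub_nonneg.2 ht)

lemma fderiv_eq_sum (φ : (Fin d → ℝ) → ℝ) (x₀ h : Fin d → ℝ) :
    fderiv ℝ φ x₀ h = ∑ i, fderiv ℝ φ x₀ (Pi.single i 1) * h i := by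
  conv_lhs => rw [pi_eq_sum_univ' h]
  simp only [map_sum, map_smul, smul_eq_mul]
  exact Finset.sum_congr rfl fun i _ => mul_comm _ _

/-- First order expansion of a differentiable function at a point, in uniform form. -/
lemma exists_ball_abs_sub_le (hφ : DifferentiableAt ℝ φ x₀) {ε : ℝ} (hε : 0 < ε) :
    ∀ᶠ y in 𝓝 x₀, |φ x₀ - φ y - ∑ i, fderiv ℝ φ x₀ (Pi.single i 1) * (x₀ i - y i)|
      ≤ ε * ‖x₀ - y‖ := by
  filter_upwards [hφ.hasFDerivAt.isLittleO.def hε] with y hy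
  have e : ∑ i, fderiv ℝ φ x₀ (Pi.single i 1) * (x₀ i - y i) = fderiv ℝ φ x₀ (x₀ - y) := by
    rw [fderiv_eq_sum φ x₀ (x₀ - y)]
    rfl
  have e' : φ x₀ - φ y - fderiv ℝ φ x₀ (x₀ - y)
      = -(φ y - φ x₀ - fderiv ℝ φ x₀ (y - x₀)) := by
    rw [← neg_sub y x₀, map_neg]
    ring
  rw [e, e', abs_neg, norm_sub_rev x₀ y]
  exact hy

lemma Ici_mem_nhds_of_pos (hx₀ : ∀ i, 0 < x₀ i) : Ici (0 : Fin d → ℝ) ∈ 𝓝 x₀ := by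
  have : ∀ᶠ y in 𝓝 x₀, ∀ i, 0 < y i :=
    eventually_all.2 fun i => (continuous_apply i).continuousAt.eventually_const_lt (hx₀ i)
  filter_upwards [this] with y hy i using (hy i).le

lemma tendsto_add_smul (x₀ h : Fin d → ℝ) :
    Tendsto (fun t : ℝ => x₀ + t • h) (𝓝[>] 0) (𝓝 x₀) := by
  have : Continuous fun t : ℝ => x₀ + t • h := by fun_prop
  have h1 := this.tendsto 0
  rw [zero_smul, add_zero] at h1
  exact h1.mono_left nhdsWithin_le_nhds

lemma rate_pow_eq (hd : 0 < d) (c : ℝ) {s : ℝ} (hs : 0 ≤ s) :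
    (c * s ^ (1 / (d : ℝ)) / d) ^ d = (c / d) ^ d * s := by
  rw [mul_div_right_comm, mul_pow, one_div, Real.rpow_inv_natCast_pow hs hd.ne']

lemma isBoundedUnder_le (hf : MemB d f) (x : Fin d → ℝ) :
    IsBoundedUnder (· ≤ ·) (𝓝 x) f := by
  obtain ⟨U, hU, b, hb⟩ := hf.2.2 x
  exact ⟨b, eventually_map.2 (eventually_of_mem hU fun y hy => hb (mem_image_of_mem f hy))⟩

lemma isBoundedUnder_ge (hf : MemB d f) (x : Fin d → ℝ) :
    IsBoundedUnder (· ≥ ·) (𝓝 x) f :=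
  ⟨0, eventually_map.2 (Eventually.of_forall hf.2.1)⟩

lemma prod_fderiv_le_of_isLocalMax (hd : 0 < d) (hc : IsBWConstant d c) (hf : MemB d f)
    (h𝒰 : (𝒰 : Filter ℕ) ≤ atTop) (hx₀ : ∀ i, 0 < x₀ i) (hφ : DifferentiableAt ℝ φ x₀)
    (hmax : IsLocalMaxOn (fun y => boxLimit PP 𝒰 0 y - φ y) (Ici 0) x₀) :
    ∏ i, fderiv ℝ φ x₀ (Pi.single i 1) ≤ (c / d) ^ d * upperEnv d f x₀ := by
  have hd' : (0 : ℝ) < d := Nat.cast_pos.2 hd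
  have hc0 := hc.1
  have hIci := Ici_mem_nhds_of_pos hx₀
  have hmax' : ∀ᶠ y in 𝓝 x₀, boxLimit PP 𝒰 0 y - φ y ≤ boxLimit PP 𝒰 0 x₀ - φ x₀ := by
    have := hmax
    rwa [IsLocalMaxOn, IsMaxFilter, nhdsWithin_eq_nhds.2 hIci] at this
  set p : Fin d → ℝ := fun i => fderiv ℝ φ x₀ (Pi.single i 1) with hp
  have hp0 : ∀ i, 0 ≤ p i := fun i => by
    refine fderiv_nonneg_of_eventually_le hφ ?_
    filter_upwards [(tendsto_add_smul x₀ (Pi.single i 1)).eventually hmax', self_mem_nhdsWithin]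
      with t ht ht0
    have ht0 : 0 < t := ht0
    have := boxLimit_mono PP hd hc hf h𝒰 (le_refl (0 : Fin d → ℝ))
      (le_add_of_nonneg_right (a := x₀) (smul_nonneg ht0.le (Pi.single_nonneg.2 zero_le_one)) :
        x₀ ≤ x₀ + t • Pi.single i 1)
    linarith
  suffices ∀ b, upperEnv d f x₀ < b → ∏ i, p i ≤ (c / d) ^ d * b by
    rw [← div_le_iff₀' (by positivity)]
    exact le_of_forall_gt_imp_ge_of_dense fun b hb => (div_le_iff₀' (by positivity)).2 (this b hb)
  intro b hb
  have hfb : ∀ᶠ y in 𝓝 x₀, f y < b := eventually_lt_of_limsup_lt hb (isBoundedUnder_le hf x₀)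
  have hb0 : 0 ≤ b := (hf.2.1 x₀).trans hfb.self_of_nhds.le
  by_cases hpz : ∃ i, p i = 0
  · obtain ⟨i, hi⟩ := hpz
    rw [Finset.prod_eq_zero (Finset.mem_univ i) hi]
    positivity
  push Not at hpz
  have hpp : ∀ i, 0 < p i := fun i => lt_of_le_of_ne (hp0 i) (hpz i).symm
  have hprod : 0 < ∏ i, p i := Finset.prod_pos fun i _ => hpp i
  set K := c * (b / ∏ i, p i) ^ (1 / (d : ℝ)) / d with hK
  set C := ∑ i, 1 / p i with hC
  have hCi : ∀ i, 1 / p i ≤ C := fun i => Finset.single_le_sum (f := fun i => 1 / p i)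
    (fun j _ => (one_div_pos.2 (hpp j)).le) (Finset.mem_univ i)
  have hCpos : 0 < C := (one_div_pos.2 (hpp ⟨0, hd⟩)).trans_le (hCi ⟨0, hd⟩)
  have hmain : ∀ ε, 0 < ε → 1 ≤ K + ε := by
    intro ε hε
    obtain ⟨r, hr, hball⟩ := Metric.eventually_nhds_iff_ball.1
      ((hmax'.and hfb).and (exists_ball_abs_sub_le hφ (div_pos hε hCpos)))
    have hsum : 0 < ∑ i, p i * x₀ i :=
      Finset.sum_pos (fun i _ => mul_pos (hpp i) (hx₀ i)) ⟨⟨0, hd⟩, Finset.mem_univ _⟩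
    set δ := min (r / (2 * C)) (∑ i, p i * x₀ i) with hδ
    have hδ0 : 0 < δ := lt_min (by positivity) hsum
    have hδr : C * δ < r := by
      have : δ ≤ r / (2 * C) := min_le_left _ _
      rw [le_div_iff₀ (by positivity)] at this
      linarith
    have hδp : ∀ i, δ / p i ≤ C * δ := fun i => by
      have := mul_le_mul_of_nonneg_right (hCi i) hδ0.le
      rwa [one_div_mul_eq_div] at this
    obtain ⟨y, hy0, hyx, hyδ, hy⟩ := exists_boxLimit_le_add PP hd hc hf h𝒰 (fun i => (hx₀ i).le)
      hpp hδ0.le (min_le_right _ _) hb0 (fun i => (hδp i).trans_lt hδr)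
      fun z hz => (hball z hz).1.2.le
    have hnorm : ‖x₀ - y‖ ≤ C * δ := by
      refine (pi_norm_le_iff_of_nonneg (by positivity)).2 fun i => ?_
      rw [Pi.sub_apply, Real.norm_eq_abs, abs_of_nonneg (sub_nonneg.2 (hyx i))]
      refine le_trans ?_ (hδp i)
      rw [le_div_iff₀' (hpp i), ← hyδ]
      exact Finset.single_le_sum (f := fun i => p i * (x₀ i - y i))
        (fun j _ => mul_nonneg (hpp j).le (sub_nonneg.2 (hyx j))) (Finset.mem_univ i)
    have hyb : y ∈ Metric.ball x₀ r := by
      rw [Metric.mem_ball', dist_eq_norm]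
      exact hnorm.trans_lt hδr
    obtain ⟨⟨h1, -⟩, h2⟩ := hball y hyb
    have h3 := (abs_le.1 h2).1
    have h4 : ε / C * ‖x₀ - y‖ ≤ ε * δ := by
      calc ε / C * ‖x₀ - y‖ ≤ ε / C * (C * δ) := by gcongr
        _ = ε * δ := by field_simp
    have h5 : c * (b * boxVol y x₀) ^ (1 / (d : ℝ)) ≤ K * δ := by
      calc c * (b * boxVol y x₀) ^ (1 / (d : ℝ))
          ≤ c * ((b / ∏ i, p i) ^ (1 / (d : ℝ)) * (δ / d)) := by
            gcongr
            exact rpow_mul_boxVol_le hd hyx hpp hb0 hyδ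
        _ = K * δ := by rw [hK]; ring
    have h6 : δ * 1 ≤ δ * (K + ε) := by linarith
    exact le_of_mul_le_mul_left h6 hδ0
  have hK1 : 1 ≤ K := le_of_forall_pos_le_add hmain
  have h7 : 1 ≤ (c / d) ^ d * (b / ∏ i, p i) := by
    rw [← rate_pow_eq hd c (by positivity), ← hK]
    exact one_le_pow₀ hK1
  rwa [← mul_div_assoc, one_le_div hprod] at h7

lemma le_prod_fderiv_of_isLocalMin (hd : 0 < d) (hc : IsBWConstant d c) (hf : MemB d f)
    (h𝒰 : (𝒰 : Filter ℕ) ≤ atTop) (hx₀ : ∀ i, 0 < x₀ i) (hφ : DifferentiableAt ℝ φ x₀)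
    (hmin : IsLocalMinOn (fun y => boxLimit PP 𝒰 0 y - φ y) (Ici 0) x₀) :
    (c / d) ^ d * lowerEnv d f x₀ ≤ ∏ i, fderiv ℝ φ x₀ (Pi.single i 1) := by
  have hd' : (0 : ℝ) < d := Nat.cast_pos.2 hd
  have hc0 := hc.1
  have hIci := Ici_mem_nhds_of_pos hx₀
  have hmin' : ∀ᶠ y in 𝓝 x₀, boxLimit PP 𝒰 0 x₀ - φ x₀ ≤ boxLimit PP 𝒰 0 y - φ y := by
    have := hmin
    rwa [IsLocalMinOn, IsMinFilter, nhdsWithin_eq_nhds.2 hIci] at this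
  set p : Fin d → ℝ := fun i => fderiv ℝ φ x₀ (Pi.single i 1) with hp
  have hp0 : ∀ i, 0 ≤ p i := fun i => by
    have : 0 ≤ fderiv ℝ (fun y => -φ y) x₀ (-Pi.single i 1) := by
      refine fderiv_nonneg_of_eventually_le hφ.neg ?_
      filter_upwards [(tendsto_add_smul x₀ (-Pi.single i 1)).eventually hmin',
        self_mem_nhdsWithin] with t ht ht0
      have ht0 : 0 < t := ht0
      have := boxLimit_mono PP hd hc hf h𝒰 (le_refl (0 : Fin d → ℝ))
        (add_le_of_nonpos_right (a := x₀) (smul_nonpos_of_nonneg_of_nonpos ht0.le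
          (neg_nonpos.2 (Pi.single_nonneg.2 zero_le_one))) :
          x₀ + t • (-Pi.single i 1) ≤ x₀)
      rw [Pi.neg_apply, Pi.neg_apply]
      linarith
    rwa [fderiv_fun_neg, map_neg, neg_apply, neg_neg] at this
  suffices ∀ a, a < lowerEnv d f x₀ → (c / d) ^ d * a ≤ ∏ i, p i by
    rw [← le_div_iff₀' (by positivity)]
    exact le_of_forall_lt_imp_le_of_dense fun a ha => (le_div_iff₀' (by positivity)).2 (this a ha)
  intro a ha
  rcases lt_or_ge a 0 with ha0 | ha0
  · exact (mul_nonpos_of_nonneg_of_nonpos (by positivity) ha0.le).trans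
      (Finset.prod_nonneg fun i _ => hp0 i)
  have hfa : ∀ᶠ y in 𝓝 x₀, a < f y := eventually_lt_of_lt_liminf ha (isBoundedUnder_ge hf x₀)
  suffices ∀ η : ℝ, 0 < η → (c / d) ^ d * a ≤ ∏ i, (p i + η) by
    have hcont : Continuous fun η : ℝ => ∏ i, (p i + η) := by fun_prop
    have h1 := (hcont.tendsto 0).mono_left (nhdsWithin_le_nhds (s := Ioi 0))
    simp only [add_zero] at h1
    exact ge_of_tendsto h1 (eventually_nhdsWithin_of_forall this)
  intro η hη
  set w : Fin d → ℝ := fun i => p i + η with hw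
  have hwp : ∀ i, 0 < w i := fun i => add_pos_of_nonneg_of_pos (hp0 i) hη
  have hprod : 0 < ∏ i, w i := Finset.prod_pos fun i _ => hwp i
  set K := c * (a / ∏ i, w i) ^ (1 / (d : ℝ)) / d with hK
  set C := ∑ i, 1 / (d * w i) with hC
  have hCi : ∀ i, 1 / (d * w i) ≤ C := fun i =>
    Finset.single_le_sum (f := fun i => 1 / (d * w i))
      (fun j _ => (one_div_pos.2 (mul_pos hd' (hwp j))).le) (Finset.mem_univ i)
  have hCpos : 0 < C := (one_div_pos.2 (mul_pos hd' (hwp ⟨0, hd⟩))).trans_le (hCi ⟨0, hd⟩)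
  have hmain : ∀ ε, 0 < ε → K ≤ 1 + ε := by
    intro ε hε
    obtain ⟨r, hr, hball⟩ := Metric.eventually_nhds_iff_ball.1
      (((hmin'.and hfa).and (exists_ball_abs_sub_le hφ (div_pos hε hCpos))).and hIci)
    obtain ⟨δ, hδ0, hδr⟩ : ∃ δ, 0 < δ ∧ C * δ < r := by
      refine ⟨r / (2 * C), by positivity, ?_⟩
      have : C * (r / (2 * C)) = r / 2 := by field_simp
      linarith
    set y : Fin d → ℝ := fun i => x₀ i - δ / (d * w i) with hy
    have hxy : ∀ i, x₀ i - y i = δ / (d * w i) := fun i => by simp [hy]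
    have hpos : ∀ i, 0 < δ / (d * w i) := fun i => div_pos hδ0 (mul_pos hd' (hwp i))
    have hlt : ∀ i, y i < x₀ i := fun i => sub_pos.1 ((hxy i).symm ▸ hpos i)
    have hδw : ∀ i, δ / (d * w i) ≤ C * δ := fun i => by
      have := mul_le_mul_of_nonneg_right (hCi i) hδ0.le
      rwa [one_div_mul_eq_div] at this
    have hclose : ∀ z ∈ Icc y x₀, ‖x₀ - z‖ ≤ C * δ := fun z hz => by
      refine (pi_norm_le_iff_of_nonneg (by positivity)).2 fun i => ?_
      rw [Pi.sub_apply, Real.norm_eq_abs, abs_of_nonneg (sub_nonneg.2 (hz.2 i))]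
      refine le_trans ?_ ((hxy i).trans_le (hδw i))
      linarith [hz.1 i]
    have hIcc : ∀ z ∈ Icc y x₀, z ∈ Metric.ball x₀ r := fun z hz => by
      rw [Metric.mem_ball', dist_eq_norm]
      exact (hclose z hz).trans_lt hδr
    have hyx : y ≤ x₀ := fun i => (hlt i).le
    obtain ⟨⟨⟨h1, -⟩, h2⟩, h0⟩ := hball y (hIcc y (left_mem_Icc.2 hyx))
    have h3 := (abs_le.1 h2).2
    have h4 : ε / C * ‖x₀ - y‖ ≤ ε * δ := by
      calc ε / C * ‖x₀ - y‖ ≤ ε / C * (C * δ) := by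
            gcongr
            exact hclose y (left_mem_Icc.2 hyx)
        _ = ε * δ := by field_simp
    have h5 : K * δ = c * (a * boxVol y x₀) ^ (1 / (d : ℝ)) := by
      have e : a * boxVol y x₀ = a / (∏ i, w i) * (δ / d) ^ d := by
        simp only [boxVol, hxy, Finset.prod_div_distrib, Finset.prod_mul_distrib,
          Finset.prod_const, Finset.card_univ, Fintype.card_fin]
        rw [div_pow]
        field_simp
      rw [e, Real.mul_rpow (by positivity) (by positivity), one_div (d : ℝ),
        Real.pow_rpow_inv_natCast (by positivity) hd.ne', hK]
      ring_nf
    have h6 : ∑ i, p i * (x₀ i - y i) ≤ δ := by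
      calc ∑ i, p i * (x₀ i - y i) ≤ ∑ _i : Fin d, δ / d := by
            refine Finset.sum_le_sum fun i _ => ?_
            rw [hxy i]
            calc p i * (δ / (d * w i)) ≤ w i * (δ / (d * w i)) :=
                  mul_le_mul_of_nonneg_right (by simp [hw, hη.le]) (hpos i).le
              _ = δ / d := by
                have := (hwp i).ne'
                field_simp
        _ = δ := by
            rw [Finset.sum_const, Finset.card_univ, Fintype.card_fin, nsmul_eq_mul]
            field_simp
    have h7 := le_boxLimit PP hd hc hf h𝒰 hlt ha0 fun z hz => (hball z (hIcc z hz)).1.1.2.le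
    have h8 := boxLimit_add_le PP hd hc hf h𝒰 h0 hyx
    have h9 : δ * K ≤ δ * (1 + ε) := by linarith
    exact le_of_mul_le_mul_left h9 hδ0
  have hK1 : K ≤ 1 := le_of_forall_pos_le_add hmain
  have h7 : (c / d) ^ d * (a / ∏ i, w i) ≤ 1 := by
    rw [← rate_pow_eq hd c (by positivity), ← hK]
    exact pow_le_one₀ (by positivity) hK1
  rwa [← mul_div_assoc, div_le_one hprod] at h7

theorem isNDViscSol_boxLimit (hd : 0 < d) (hc : IsBWConstant d c) (hf : MemB d f)
    (h𝒰 : (𝒰 : Filter ℕ) ≤ atTop) : IsNDViscSol d c f (boxLimit PP 𝒰 0) := by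
  refine ⟨continuousOn_boxLimit PP hd hc hf h𝒰,
    fun x y _ hxy => boxLimit_mono PP hd hc hf h𝒰 le_rfl hxy,
    fun x _ ⟨i, hi⟩ => boxLimit_eq_zero PP hd hc hf 𝒰 ⟨i, hi.le⟩,
    fun x₀ hx₀ φ hφ hmax => ?_, fun x₀ hx₀ φ hφ hmin => ?_⟩
  · exact prod_fderiv_le_of_isLocalMax PP hd hc hf h𝒰 hx₀
      (hφ.differentiable (by simp)).differentiableAt hmax
  · exact le_prod_fderiv_of_isLocalMin PP hd hc hf h𝒰 hx₀
      (hφ.differentiable (by simp)).differentiableAt hmin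

end Viscosity

/-! ### Locally uniform convergence -/

/-- Monotone functions that converge at nonnegative rational points to a monotone continuous
function converge locally uniformly on the nonnegative orthant. -/
lemma tendstoUniformlyOn_of_tendsto_rat {d : ℕ} {F : ℕ → (Fin d → ℝ) → ℝ} {u : (Fin d → ℝ) → ℝ}
    (hF : ∀ n, Monotone (F n)) (hu : ContinuousOn u (Ici 0))
    (humono : ∀ x y : Fin d → ℝ, 0 ≤ x → x ≤ y → u x ≤ u y)
    (hlim : ∀ q : Fin d → ℚ, (0 : Fin d → ℝ) ≤ (fun i => (q i : ℝ)) →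
      Tendsto (fun n => F n fun i => (q i : ℝ)) atTop (𝓝 (u fun i => (q i : ℝ)))) (M : ℝ) :
    TendstoUniformlyOn F u atTop (Icc (0 : Fin d → ℝ) fun _ => M) := by
  rw [← tendstoLocallyUniformlyOn_iff_tendstoUniformlyOn_of_compact isCompact_Icc,
    Metric.tendstoLocallyUniformlyOn_iff]
  intro ε hε x hx
  have hε4 : 0 < ε / 4 := by positivity
  obtain ⟨⟨p, hp, hplim⟩, q, hq, hqlim⟩ := exists_seq_rat_lt_tendsto x
  have hp'lim : Tendsto (fun k i => ((max (p k i) 0 : ℚ) : ℝ)) atTop (𝓝 x) := by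
    refine tendsto_pi_nhds.2 fun i => ?_
    have h1 := (tendsto_pi_nhds.1 hplim i).max (tendsto_const_nhds (x := (0 : ℝ)))
    rw [max_eq_left (show (0 : ℝ) ≤ x i from hx.1 i)] at h1
    exact h1.congr fun k => by push_cast; rfl
  have hp0 : ∀ k, (0 : Fin d → ℝ) ≤ fun i => ((max (p k i) 0 : ℚ) : ℝ) :=
    fun k i => Rat.cast_nonneg.2 (le_max_right _ _)
  have hq0 : ∀ k, (0 : Fin d → ℝ) ≤ fun i => (q k i : ℝ) :=
    fun k i => (hx.1 i).trans (hq k i).le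
  have hup := (hu x hx.1).tendsto.comp
    (tendsto_nhdsWithin_iff.2 ⟨hp'lim, Eventually.of_forall hp0⟩)
  have huq := (hu x hx.1).tendsto.comp
    (tendsto_nhdsWithin_iff.2 ⟨hqlim, Eventually.of_forall hq0⟩)
  obtain ⟨k, hkp, hkq⟩ := ((hup.eventually_const_lt (sub_lt_self (u x) hε4)).and
    (huq.eventually_lt_const (lt_add_of_pos_right (u x) hε4))).exists
  simp only [Function.comp_apply] at hkp hkq
  set a : Fin d → ℝ := fun i => ((max (p k i) 0 : ℚ) : ℝ) with ha
  set b : Fin d → ℝ := fun i => (q k i : ℝ) with hb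
  refine ⟨Icc a b ∩ Icc 0 fun _ => M, ?_, ?_⟩
  · have h1 : ∀ᶠ y in 𝓝 x, ∀ i, (p k i : ℝ) < y i ∧ y i < (q k i : ℝ) :=
      eventually_all.2 fun i =>
        (((continuous_apply i).tendsto x).eventually_const_lt (hp k i)).and
          (((continuous_apply i).tendsto x).eventually_lt_const (hq k i))
    filter_upwards [mem_nhdsWithin_of_mem_nhds h1, self_mem_nhdsWithin] with y hy hyM
    refine ⟨⟨fun i => ?_, fun i => (hy i).2.le⟩, hyM⟩
    simp only [ha, Rat.cast_max, Rat.cast_zero]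
    exact max_le (hy i).1.le (hyM.1 i)
  · filter_upwards [(hlim _ (hp0 k)).eventually_const_lt (sub_lt_self _ hε4),
      (hlim _ (hq0 k)).eventually_lt_const (lt_add_of_pos_right _ hε4)] with n h1 h2 y hy
    have h3 := hF n hy.1.1
    have h4 := hF n hy.1.2
    have h5 := humono a y (hp0 k) hy.1.1
    have h6 := humono y b hy.2.1 hy.1.2
    rw [Real.dist_eq, abs_lt]
    constructor <;> linarith

/-- If `f ∈ ℬ` and (P) has a unique nondecreasing viscosity solution `u`, then
with probability one `n^{-1/d} U_n → u` locally uniformly on `[0,∞)^d`. -/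
theorem nondominated_sorting_continuum_limit
    {d : ℕ} (hd : 0 < d) (c : ℝ) (hc : IsBWConstant d c)
    (f : (Fin d → ℝ) → ℝ) (hf : MemB d f)
    (u : (Fin d → ℝ) → ℝ) (hu : IsNDViscSol d c f u)
    (huniq : ∀ v : (Fin d → ℝ) → ℝ, IsNDViscSol d c f v →
      Set.EqOn v u (Set.Ici (0 : Fin d → ℝ)))
    {Ω : Type*} [MeasurableSpace Ω] (P : Measure Ω) [IsProbabilityMeasure P]
    (PP : ∀ n : ℕ, PoissonPP d P fun x => (n : ℝ) * f x) :
    P {ω | ∀ M : ℝ, 0 < M →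
      TendstoUniformlyOn
        (fun (n : ℕ) (x : Fin d → ℝ) =>
          (n : ℝ) ^ (-(1 : ℝ) / d) *
            (chainLength d ((PP n).pts ω ∩ Set.Icc 0 x) : ℝ))
        u atTop (Set.Icc (0 : Fin d → ℝ) fun _ => M)} = 1 := by
  have hmean : ∀ x : Fin d → ℝ, 0 ≤ x →
      Tendsto (fun n => chainRate d n * (PP n).boxMean 0 x) atTop (𝓝 (u x)) := by
    intro x hx
    rw [tendsto_iff_ultrafilter]
    intro 𝒰 h𝒰
    rw [← huniq _ (isNDViscSol_boxLimit PP hd hc hf h𝒰) hx]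
    exact tendsto_boxLimit PP hd hc hf 𝒰 0 x
  have hrat := ae_all_iff.2 fun q : Fin d → ℚ =>
    ae_tendsto_boxLength_sub hd hc hf PP 0 fun i => (q i : ℝ)
  refine (measure_congr (eventuallyEq_univ.2 ?_)).trans measure_univ
  filter_upwards [hrat, ae_forall_finite PP hf] with ω hω hfin M _
  refine tendstoUniformlyOn_of_tendsto_rat (fun n x y hxy => ?_) hu.1 hu.2.1 (fun q hq => ?_) M
  · exact mul_le_mul_of_nonneg_left (Nat.cast_le.2 (chainLength_mono (hfin n _ _)
      (inter_subset_inter_right _ (Icc_subset_Icc_right hxy)))) (chainRate_nonneg d n)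
  · have h := (hω q).add (hmean _ hq)
    rw [zero_add] at h
    refine h.congr fun n => ?_
    rw [mul_sub, sub_add_cancel]
    rfl

end
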